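/- Let N_CO(x) be the number of ternary integers n = pqr ≤ x (with 3 ≤ p < q < r odd primes) such that h(Ψ_n) = p - 1, and let N_T(x) be the number of ternary integers ≤ x. Then N_CO(x)/N_T(x) ∼ 2C₁/((log x)·(log log x)²) as x → ∞, where C₁ = 4·Σ_{p odd prime} (1/(p(p-1)²))·log((p-1)/(p-2)). In particular, Ψ_n is not coefficient optimal for almost all ternary n. -/

import Mathlib

open Real Filter Polynomial

/-- The height of a polynomial over `ℤ`: the maximum of the absolute values of
its coefficients. -/
noncomputable def polyHeight (f : Polynomial ℤ) : ℕ :=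
  f.support.sup fun k => (f.coeff k).natAbs

/-- The `n`-th inverse cyclotomic polynomial `Ψ_n = (x^n - 1)/Φ_n`. -/
noncomputable def invCyclotomic (n : ℕ) : Polynomial ℤ :=
  (X ^ n - 1) /ₘ Polynomial.cyclotomic n ℤ

/-- The constant `C₁ = 4 Σ_{p odd prime} (1/(p(p-1)²)) log((p-1)/(p-2))`. -/
noncomputable def C1 : ℝ :=
  4 * ∑' p : {p : ℕ // p.Prime ∧ 3 ≤ p},
    (1 / ((p.1 : ℝ) * ((p.1 : ℝ) - 1) ^ 2)) * Real.log (((p.1 : ℝ) - 1) / ((p.1 : ℝ) - 2))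

/-- `N_CO(x)`: the number of ternary `n = pqr ≤ x` with `h(Ψ_n) = p - 1`. -/
noncomputable def NCOcount (x : ℝ) : ℕ :=
  {n : ℕ | ∃ p q r : ℕ, p.Prime ∧ q.Prime ∧ r.Prime ∧
    3 ≤ p ∧ p < q ∧ q < r ∧ n = p * q * r ∧ (n : ℝ) ≤ x ∧
    polyHeight (invCyclotomic n) = p - 1}.ncard

/-- `N_T(x)`: the number of ternary integers `n ≤ x`. -/
noncomputable def NTcount (x : ℝ) : ℕ :=
  {n : ℕ | ∃ p q r : ℕ, p.Prime ∧ q.Prime ∧ r.Prime ∧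
    3 ≤ p ∧ p < q ∧ q < r ∧ n = p * q * r ∧ (n : ℝ) ≤ x}.ncard



/-! ### The Fejer kernel -/

/-- The Fejér kernel. -/
noncomputable def fejK (v : ℝ) : ℝ := (Real.sinc (v / 2)) ^ 2

lemma fejK_cont : Continuous fejK := by
  unfold fejK
  exact (Real.continuous_sinc.comp (continuous_id.div_const 2)).pow 2

lemma fejK_nonneg (v : ℝ) : 0 ≤ fejK v := sq_nonneg _

lemma fejK_le_one (v : ℝ) : fejK v ≤ 1 := by
  unfold fejK
  have := Real.abs_sinc_le_one (v / 2)
  rw [← sq_abs]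
  exact pow_le_one₀ (abs_nonneg _) this

lemma fejK_le (v : ℝ) : fejK v ≤ 5 * (1 + v ^ 2)⁻¹ := by
  rcases eq_or_ne v 0 with rfl | hv
  · have := fejK_le_one 0
    norm_num; linarith
  have h1 := fejK_le_one v
  have h2 : fejK v * v ^ 2 ≤ 4 := by
    unfold fejK
    rw [Real.sinc_of_ne_zero (by positivity)]
    have : (sin (v / 2) / (v / 2)) ^ 2 * v ^ 2 = 4 * sin (v / 2) ^ 2 := by
      field_simp; ring
    rw [this]
    have := Real.sin_sq_le_one (v / 2)
    linarith
  rw [← div_eq_mul_inv, le_div_iff₀ (by positivity)]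
  nlinarith

lemma fejK_integrable : MeasureTheory.Integrable fejK := by
  refine MeasureTheory.Integrable.mono' (integrable_inv_one_add_sq.const_mul 5)
    fejK_cont.aestronglyMeasurable (Eventually.of_forall fun v => ?_)
  rw [Real.norm_of_nonneg (fejK_nonneg v)]
  exact fejK_le v

lemma fejK_integral_pos : 0 < ∫ v, fejK v := by
  refine MeasureTheory.integral_pos_of_integrable_nonneg_nonzero (x := 0) fejK_cont
    fejK_integrable fejK_nonneg ?_
  simp [fejK]

lemma fejK_aux (a : ℂ) (ha : a ≠ 0) :
    ∫ y in (0:ℝ)..1, ((1 - y : ℝ) : ℂ) * Complex.exp (a * y) =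
      Complex.exp a / a ^ 2 - 1 / a - 1 / a ^ 2 := by
  have hd : ∀ y ∈ Set.uIcc (0:ℝ) 1, HasDerivAt
      (fun y : ℝ => (1 - (y:ℂ)) * Complex.exp (a * y) / a + Complex.exp (a * y) / a ^ 2)
      (((1 - y : ℝ) : ℂ) * Complex.exp (a * y)) y := by
    intro y _
    have h1 : HasDerivAt (fun y : ℝ => (y : ℂ)) 1 y := Complex.ofRealCLM.hasDerivAt
    have h2 : HasDerivAt (fun y : ℝ => Complex.exp (a * y)) (Complex.exp (a * y) * (a * 1)) y :=
      (h1.const_mul a).cexp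
    have h3 := (((h1.const_sub 1).mul h2).div_const a).add (h2.div_const (a ^ 2))
    refine h3.congr_deriv ?_
    push_cast
    have : (-1 * Complex.exp (a * y) + (1 - (y:ℂ)) * (Complex.exp (a * y) * (a * 1))) / a +
      Complex.exp (a * y) * (a * 1) / a ^ 2 = (1 - (y:ℂ)) * Complex.exp (a * y) := by
      field_simp; ring
    exact this
  rw [intervalIntegral.integral_eq_sub_of_hasDerivAt hd]
  · simp; ring
  · apply Continuous.intervalIntegrable
    fun_prop

lemma fejK_fourier (v : ℝ) :
    ∫ y in (-1:ℝ)..1, ((1 - |y| : ℝ) : ℂ) * Complex.exp (Complex.I * (y * v)) = (fejK v : ℂ) := by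
  have hc : Continuous fun y : ℝ => ((1 - |y| : ℝ) : ℂ) * Complex.exp (Complex.I * (y * v)) := by
    fun_prop
  rw [← intervalIntegral.integral_add_adjacent_intervals (b := 0) (hc.intervalIntegrable _ _)
    (hc.intervalIntegrable _ _)]
  have e1 : ∫ y in (-1:ℝ)..0, ((1 - |y| : ℝ) : ℂ) * Complex.exp (Complex.I * (y * v)) =
      ∫ y in (0:ℝ)..1, ((1 - y : ℝ) : ℂ) * Complex.exp ((-(Complex.I * v)) * y) := by
    have := intervalIntegral.integral_comp_neg (a := 0) (b := 1)
      (fun y : ℝ => ((1 - |y| : ℝ) : ℂ) * Complex.exp (Complex.I * (y * v)))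
    simp only [neg_zero] at this
    rw [← this]
    refine intervalIntegral.integral_congr fun y hy => ?_
    rw [Set.uIcc_of_le zero_le_one] at hy
    simp only [abs_neg, abs_of_nonneg hy.1]
    congr 2
    push_cast; ring
  have e2 : ∫ y in (0:ℝ)..1, ((1 - |y| : ℝ) : ℂ) * Complex.exp (Complex.I * (y * v)) =
      ∫ y in (0:ℝ)..1, ((1 - y : ℝ) : ℂ) * Complex.exp ((Complex.I * v) * y) := by
    refine intervalIntegral.integral_congr fun y hy => ?_
    rw [Set.uIcc_of_le zero_le_one] at hy
    simp only [abs_of_nonneg hy.1]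
    congr 2
    ring
  rw [e1, e2]
  rcases eq_or_ne v 0 with rfl | hv
  · simp only [Complex.ofReal_zero, mul_zero, neg_zero, zero_mul, Complex.exp_zero, mul_one]
    rw [intervalIntegral.integral_ofReal]
    have : ∫ x in (0:ℝ)..1, (1 - x) = 1 / 2 := by
      rw [intervalIntegral.integral_sub (by simp) (by simp)]
      simp; norm_num
    rw [this]
    simp [fejK]
    norm_num
  · have hv' : (v : ℂ) ≠ 0 := by exact_mod_cast hv
    have hI : Complex.I * v ≠ 0 := mul_ne_zero Complex.I_ne_zero hv'
    rw [fejK_aux _ hI, fejK_aux _ (neg_ne_zero.mpr hI)]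
    unfold fejK
    rw [Real.sinc_of_ne_zero (by positivity)]
    have h1 : Complex.exp (Complex.I * v) + Complex.exp (-(Complex.I * v)) = 2 * Complex.cos v := by
      rw [Complex.cos]; rw [mul_comm Complex.I]; ring_nf
    have h2 : Complex.cos v = 1 - 2 * Complex.sin (v / 2) ^ 2 := by
      have := Complex.cos_two_mul (v / 2 : ℂ)
      rw [show 2 * (v / 2 : ℂ) = v by ring] at this
      rw [this, Complex.cos_sq']; ring
    have h3 : (Complex.I * v) ^ 2 = - (v:ℂ) ^ 2 := by rw [mul_pow, Complex.I_sq]; ring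
    have : Complex.exp (-(Complex.I * v)) / (-(Complex.I * v)) ^ 2 - 1 / (-(Complex.I * v))
        - 1 / (-(Complex.I * v)) ^ 2 + (Complex.exp (Complex.I * v) / (Complex.I * v) ^ 2
        - 1 / (Complex.I * v) - 1 / (Complex.I * v) ^ 2) =
        (Complex.exp (Complex.I * v) + Complex.exp (-(Complex.I * v)) - 2) / (Complex.I * v) ^ 2 := by
      rw [neg_sq, div_neg]; ring
    rw [this, h1, h2, h3]
    push_cast
    field_simp
    ring


open MeasureTheory in
lemma tauber_swap (f : ℝ → ℝ) (M c : ℝ) (hfm : Measurable f) (hfM : ∀ t, |f t - c| ≤ M)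
    (G : ℂ → ℂ)
    (hLap : ∀ z : ℂ, 0 < z.re →
      ∫ t in Set.Ioi (0:ℝ), ((f t - c : ℝ) : ℂ) * Complex.exp (-(z * t)) = G z)
    (l u σ : ℝ) (hσ : 0 < σ) :
    ∫ t in Set.Ioi (0:ℝ), ((f t - c : ℝ) : ℂ) * Complex.exp (-(σ * t)) * (fejK (l * (u - t)) : ℂ) =
    ∫ y in (-1:ℝ)..1, ((1 - |y| : ℝ) : ℂ) * Complex.exp (Complex.I * (y * (l * u))) *
      G (σ + Complex.I * (l * y)) := by
  rw [intervalIntegral.integral_of_le (by norm_num)]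
  have hM : 0 ≤ M := (abs_nonneg _).trans (hfM 0)
  -- the function of two variables
  set F : ℝ → ℝ → ℂ := fun t y => ((f t - c : ℝ) : ℂ) * Complex.exp (-(σ * t)) *
    (((1 - |y| : ℝ) : ℂ) * Complex.exp (Complex.I * (y * ((l * (u - t) : ℝ) : ℂ)))) with hF
  have e1 : ∀ t : ℝ, ((f t - c : ℝ) : ℂ) * Complex.exp (-(σ * t)) * (fejK (l * (u - t)) : ℂ) =
      ∫ y in Set.Ioc (-1:ℝ) 1, F t y := by
    intro t
    rw [← fejK_fourier, intervalIntegral.integral_of_le (by norm_num), ← integral_const_mul]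
  have e2 : ∀ y : ℝ, ((1 - |y| : ℝ) : ℂ) * Complex.exp (Complex.I * (y * (l * u))) *
      G (σ + Complex.I * (l * y)) = ∫ t in Set.Ioi (0:ℝ), F t y := by
    intro y
    rw [← hLap _ (by simpa using hσ), ← integral_const_mul]
    refine integral_congr_ae (Eventually.of_forall fun t => ?_)
    simp only [hF]
    have : Complex.exp (-((σ + Complex.I * (l * y)) * t)) * Complex.exp (Complex.I * (y * (l * u))) =
        Complex.exp (-(σ * t)) * Complex.exp (Complex.I * (y * ((l * (u - t) : ℝ) : ℂ))) := by
      rw [← Complex.exp_add, ← Complex.exp_add]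
      congr 1
      push_cast; ring
    linear_combination ((1 - |y| : ℝ) : ℂ) * ((f t - c : ℝ) : ℂ) * this
  simp_rw [e1, e2]
  refine integral_integral_swap ?_
  have h1 : Integrable (fun t : ℝ => M * Real.exp (-σ * t)) (volume.restrict (Set.Ioi 0)) :=
    (exp_neg_integrableOn_Ioi 0 hσ).const_mul M
  have h2 : Integrable (fun _ : ℝ => (1:ℝ)) (volume.restrict (Set.Ioc (-1:ℝ) 1)) := by
    simp
  refine Integrable.mono' (h1.mul_prod h2) ?_ ?_
  · apply Measurable.aestronglyMeasurable
    simp only [hF, Function.uncurry_def]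
    have : Measurable fun p : ℝ × ℝ => f p.1 := hfm.comp measurable_fst
    fun_prop
  · rw [Measure.prod_restrict, ae_restrict_iff' (measurableSet_Ioi.prod measurableSet_Ioc)]
    refine Eventually.of_forall fun p hp => ?_
    obtain ⟨hp1, hp2⟩ := hp
    simp only [hF, Function.uncurry_def, norm_mul, Complex.norm_real, mul_one]
    have a1 : ‖Complex.exp (-(σ * p.1))‖ = Real.exp (-σ * p.1) := by
      rw [Complex.norm_exp]; simp
    have a2 : ‖Complex.exp (Complex.I * (p.2 * ((l * (u - p.1) : ℝ) : ℂ)))‖ = 1 := by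
      rw [← Complex.ofReal_mul, mul_comm, Complex.norm_exp_ofReal_mul_I]
    have a3 : ‖1 - |p.2|‖ ≤ 1 := by
      have : |p.2| ≤ 1 := abs_le.mpr ⟨hp2.1.le, hp2.2⟩
      rw [Real.norm_of_nonneg (by linarith)]
      linarith [abs_nonneg p.2]
    rw [a1, ← Complex.ofReal_mul, mul_comm Complex.I, Complex.norm_exp_ofReal_mul_I, mul_one]
    have := hfM p.1
    rw [Real.norm_eq_abs]
    calc _ ≤ M * Real.exp (-σ * p.1) * 1 := by gcongr
      _ = _ := mul_one _

open MeasureTheory in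
lemma tauber_limit (f : ℝ → ℝ) (M c : ℝ) (hfm : Measurable f) (hfM : ∀ t, |f t - c| ≤ M)
    (G : ℂ → ℂ) (hG : ContinuousOn G {z | 0 ≤ z.re})
    (hLap : ∀ z : ℂ, 0 < z.re →
      ∫ t in Set.Ioi (0:ℝ), ((f t - c : ℝ) : ℂ) * Complex.exp (-(z * t)) = G z)
    (l u : ℝ) (hl : 0 < l) :
    ∫ t in Set.Ioi (0:ℝ), ((f t - c : ℝ) : ℂ) * (fejK (l * (u - t)) : ℂ) =
    ∫ y in (-1:ℝ)..1, ((1 - |y| : ℝ) : ℂ) * Complex.exp (Complex.I * (y * (l * u))) *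
      G (Complex.I * (l * y)) := by
  have hM : 0 ≤ M := (abs_nonneg _).trans (hfM 0)
  have L1 : Tendsto (fun σ : ℝ => ∫ t in Set.Ioi (0:ℝ),
      ((f t - c : ℝ) : ℂ) * Complex.exp (-(σ * t)) * (fejK (l * (u - t)) : ℂ)) (nhdsWithin 0 (Set.Ioi 0))
      (nhds (∫ t in Set.Ioi (0:ℝ), ((f t - c : ℝ) : ℂ) * (fejK (l * (u - t)) : ℂ))) := by
    refine tendsto_integral_filter_of_dominated_convergence (fun t => M * fejK (l * (u - t)))
      ?_ ?_ ?_ ?_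
    · refine Eventually.of_forall fun σ => Measurable.aestronglyMeasurable ?_
      have := fejK_cont.measurable
      fun_prop
    · filter_upwards [self_mem_nhdsWithin] with σ hσ
      rw [ae_restrict_iff' measurableSet_Ioi]
      refine Eventually.of_forall fun t ht => ?_
      have hσ' : 0 < σ := hσ
      have ht' : 0 < t := ht
      simp only [norm_mul, Complex.norm_real]
      have a1 : ‖Complex.exp (-(σ * t))‖ ≤ 1 := by
        rw [Complex.norm_exp]
        simp
        positivity
      rw [Real.norm_of_nonneg (fejK_nonneg _)]
      have := hfM t
      rw [Real.norm_eq_abs]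
      calc _ ≤ M * 1 * fejK (l * (u - t)) := by gcongr; exact fejK_nonneg _
        _ = _ := by ring
    · have : Integrable (fun t => fejK (l * (u - t))) := by
        have := (fejK_integrable.comp_mul_left' hl.ne').comp_sub_left u
        simpa using this
      exact (this.const_mul M).integrableOn
    · refine Eventually.of_forall fun t => ?_
      have : Tendsto (fun σ : ℝ => ((f t - c : ℝ) : ℂ) * Complex.exp (-(σ * t)) *
          (fejK (l * (u - t)) : ℂ)) (nhds 0) (nhds (((f t - c : ℝ) : ℂ) *
            Complex.exp (-(((0:ℝ):ℂ) * t)) * (fejK (l * (u - t)) : ℂ))) := by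
        apply Continuous.tendsto
        fun_prop
      simp only [Complex.ofReal_zero, zero_mul, neg_zero, Complex.exp_zero, mul_one] at this
      exact this.mono_left nhdsWithin_le_nhds
  -- boundedness of G on a compact set
  have hcomp : IsCompact ((fun p : ℝ × ℝ => (p.1 : ℂ) + Complex.I * (l * p.2)) ''
      (Set.Icc 0 1 ×ˢ Set.Icc (-1) 1)) :=
    (isCompact_Icc.prod isCompact_Icc).image (by fun_prop)
  obtain ⟨B, hB⟩ := hcomp.exists_bound_of_continuousOn (f := G) (hG.mono (by
    rintro _ ⟨p, hp, rfl⟩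
    simpa using hp.1.1))
  have L2 : Tendsto (fun σ : ℝ => ∫ y in (-1:ℝ)..1, ((1 - |y| : ℝ) : ℂ) *
      Complex.exp (Complex.I * (y * (l * u))) * G (σ + Complex.I * (l * y)))
      (nhdsWithin 0 (Set.Ioi 0))
      (nhds (∫ y in (-1:ℝ)..1, ((1 - |y| : ℝ) : ℂ) * Complex.exp (Complex.I * (y * (l * u))) *
      G (Complex.I * (l * y)))) := by
    refine intervalIntegral.tendsto_integral_filter_of_dominated_convergence (fun _ => B) ?_ ?_ ?_ ?_
    · filter_upwards [self_mem_nhdsWithin] with σ hσ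
      have hσ' : 0 < σ := hσ
      apply Continuous.aestronglyMeasurable
      have : Continuous fun y : ℝ => G (σ + Complex.I * (l * y)) := by
        refine hG.comp_continuous (by fun_prop) fun y => ?_
        simpa using hσ'.le
      exact Continuous.mul (by fun_prop) this
    · have : ∀ᶠ σ : ℝ in nhdsWithin 0 (Set.Ioi 0), σ ≤ 1 :=
        nhdsWithin_le_nhds (eventually_le_nhds zero_lt_one)
      filter_upwards [self_mem_nhdsWithin, this] with σ hσ hσ1
      refine Eventually.of_forall fun y hy => ?_
      rw [Set.uIoc_of_le (by norm_num)] at hy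
      have hσ' : 0 < σ := hσ
      have b1 := hB _ ⟨(σ, y), ⟨⟨hσ'.le, hσ1⟩, ⟨hy.1.le, hy.2⟩⟩, rfl⟩
      simp only at b1
      rw [norm_mul, norm_mul, Complex.norm_real]
      have a2 : ‖Complex.exp (Complex.I * (y * (l * u)))‖ = 1 := by
        rw [← Complex.ofReal_mul, ← Complex.ofReal_mul, mul_comm, Complex.norm_exp_ofReal_mul_I]
      have a3 : ‖1 - |y|‖ ≤ 1 := by
        have : |y| ≤ 1 := abs_le.mpr ⟨hy.1.le, hy.2⟩
        rw [Real.norm_of_nonneg (by linarith)]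
        linarith [abs_nonneg y]
      rw [a2, mul_one]
      calc _ ≤ 1 * B := by gcongr
        _ = B := one_mul _
    · simp
    · refine Eventually.of_forall fun y _ => Tendsto.const_mul _ ?_
      have h0 : ContinuousWithinAt G {z | 0 ≤ z.re} (Complex.I * (l * y)) := hG _ (by simp)
      refine h0.tendsto.comp (tendsto_nhdsWithin_iff.mpr ⟨?_, ?_⟩)
      · have : Tendsto (fun σ : ℝ => (σ : ℂ) + Complex.I * (l * y)) (nhds 0)
          (nhds (((0:ℝ) : ℂ) + Complex.I * (l * y))) := by
          apply Continuous.tendsto; fun_prop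
        rw [Complex.ofReal_zero, zero_add] at this
        exact this.mono_left nhdsWithin_le_nhds
      · filter_upwards [self_mem_nhdsWithin] with σ hσ
        have hσ' : 0 < σ := hσ
        simpa using hσ'.le
  refine tendsto_nhds_unique L1 (L2.congr' ?_)
  filter_upwards [self_mem_nhdsWithin] with σ hσ
  exact (tauber_swap f M c hfm hfM G hLap l u σ hσ).symm

open MeasureTheory in
lemma tauber_conv (f : ℝ → ℝ) (M c : ℝ) (hfm : Measurable f) (hfM : ∀ t, |f t - c| ≤ M)
    (G : ℂ → ℂ) (hG : ContinuousOn G {z | 0 ≤ z.re})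
    (hLap : ∀ z : ℂ, 0 < z.re →
      ∫ t in Set.Ioi (0:ℝ), ((f t - c : ℝ) : ℂ) * Complex.exp (-(z * t)) = G z)
    (l : ℝ) (hl : 0 < l) :
    Tendsto (fun u : ℝ => ∫ t in Set.Ioi (0:ℝ), (f t - c) * fejK (l * (u - t))) atTop (nhds 0) := by
  have key : Tendsto (fun u : ℝ => ∫ t in Set.Ioi (0:ℝ),
      ((f t - c : ℝ) : ℂ) * (fejK (l * (u - t)) : ℂ)) atTop (nhds 0) := by
    simp_rw [fun u => tauber_limit f M c hfm hfM G hG hLap l u hl]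
    have h1 := Real.tendsto_integral_exp_smul_cocompact (fun y : ℝ =>
      Set.indicator (Set.Ioc (-1:ℝ) 1) (fun y : ℝ => ((1 - |y| : ℝ) : ℂ) * G (Complex.I * (l * y))) y)
    have h2 : Tendsto (fun u : ℝ => -(l * u / (2 * π))) atTop (cocompact ℝ) := by
      have : Tendsto (fun u : ℝ => -(l * u / (2 * π))) atTop atBot := by
        apply tendsto_neg_atTop_atBot.comp
        exact (tendsto_id.const_mul_atTop hl).atTop_div_const (by positivity)
      exact this.mono_right atBot_le_cocompact
    refine (h1.comp h2).congr fun u => ?_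
    simp only [Function.comp]
    rw [intervalIntegral.integral_of_le (by norm_num), ← integral_indicator measurableSet_Ioc]
    refine integral_congr_ae (Eventually.of_forall fun y => ?_)
    simp only [Set.indicator_apply]
    split_ifs with hy
    · rw [Circle.smul_def, Real.fourierChar_apply, smul_eq_mul]
      have : ((2 * π * -(y * -(l * u / (2 * π))) : ℝ) : ℂ) * Complex.I =
          Complex.I * (y * (l * u)) := by
        have : (2 * π * -(y * -(l * u / (2 * π))) : ℝ) = y * (l * u) := by
          field_simp
        rw [this]; push_cast; ring
      rw [this]; ring
    · simp
  have := (Complex.continuous_re.tendsto 0).comp key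
  rw [Complex.zero_re] at this
  refine this.congr fun u => ?_
  simp only [Function.comp]
  simp_rw [← Complex.ofReal_mul]
  rw [integral_complex_ofReal, Complex.ofReal_re]


open MeasureTheory in
lemma tauber_int (f : ℝ → ℝ) (M : ℝ) (hfm : Measurable f) (hf0 : ∀ t, 0 ≤ f t)
    (hfM : ∀ t, f t ≤ M) (l u : ℝ) :
    Integrable (fun w => f (u - w / l) * fejK w) := by
  refine Integrable.mono' (fejK_integrable.const_mul M) ?_ (Eventually.of_forall fun w => ?_)
  · apply Measurable.aestronglyMeasurable
    have := fejK_cont.measurable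
    fun_prop
  · rw [Real.norm_of_nonneg (mul_nonneg (hf0 _) (fejK_nonneg _))]
    exact mul_le_mul_of_nonneg_right (hfM _) (fejK_nonneg _)

open MeasureTheory in
lemma tauber_conv' (f : ℝ → ℝ) (M c : ℝ) (hfm : Measurable f) (hf0 : ∀ t, 0 ≤ f t)
    (hfM : ∀ t, f t ≤ M) (hfneg : ∀ t, t < 0 → f t = 0) (hc : 0 ≤ c)
    (G : ℂ → ℂ) (hG : ContinuousOn G {z | 0 ≤ z.re})
    (hLap : ∀ z : ℂ, 0 < z.re →
      ∫ t in Set.Ioi (0:ℝ), ((f t - c : ℝ) : ℂ) * Complex.exp (-(z * t)) = G z)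
    (l : ℝ) (hl : 0 < l) :
    Tendsto (fun u : ℝ => ∫ w, f (u - w / l) * fejK w) atTop (nhds (c * ∫ w, fejK w)) := by
  have h1 := tauber_conv f (M + c) c hfm (fun t => by
    rw [abs_le]; constructor <;> linarith [hf0 t, hfM t]) G hG hLap l hl
  -- rewrite as integral in `w`
  set χ : ℝ → ℝ := Set.indicator (Set.Ioi 0) (fun _ => (1:ℝ)) with hχ
  have hχm : Measurable χ := measurable_const.indicator measurableSet_Ioi
  have hχ0 : ∀ t, 0 ≤ χ t := fun t => Set.indicator_nonneg (fun _ _ => zero_le_one) t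
  have hχ1 : ∀ t, χ t ≤ 1 := fun t => by
    simp only [hχ, Set.indicator_apply]; split_ifs <;> norm_num
  have i1 : ∀ u, Integrable (fun w => χ (u - w / l) * fejK w) := fun u =>
    tauber_int χ 1 hχm hχ0 hχ1 l u
  have i2 : ∀ u, Integrable (fun w => f (u - w / l) * fejK w) := fun u =>
    tauber_int f M hfm hf0 hfM l u
  have e1 : ∀ u, l * ∫ t in Set.Ioi (0:ℝ), (f t - c) * fejK (l * (u - t)) =
      (∫ w, f (u - w / l) * fejK w) - c * ∫ w, χ (u - w / l) * fejK w := by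
    intro u
    rw [← integral_indicator measurableSet_Ioi, ← integral_const_mul c, ← integral_sub (i2 u)
      ((i1 u).const_mul c)]
    have s1 := integral_sub_left_eq_self (fun t => Set.indicator (Set.Ioi (0:ℝ))
      (fun t => (f t - c) * fejK (l * (u - t))) t) volume u
    rw [← s1]
    have s2 := Measure.integral_comp_div (fun v => Set.indicator (Set.Ioi (0:ℝ))
      (fun t => (f t - c) * fejK (l * (u - t))) (u - v)) l
    rw [abs_of_pos hl, smul_eq_mul] at s2
    rw [← s2]
    have hne : ∀ᵐ w : ℝ, w ≠ u * l := by
      rw [ae_iff]; simp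
    refine integral_congr_ae ?_
    filter_upwards [hne] with w hw
    have hK : l * (u - (u - w / l)) = w := by field_simp; ring
    simp only [Set.indicator_apply, hχ, Set.mem_Ioi]
    split_ifs with h
    · rw [hK]; ring
    · have : u - w / l ≠ 0 := by
        intro h0
        apply hw
        field_simp at h0
        linarith
      rw [hfneg _ (lt_of_le_of_ne (not_lt.mp h) this)]
      ring
  have L2 : Tendsto (fun u => ∫ w, χ (u - w / l) * fejK w) atTop (nhds (∫ w, fejK w)) := by
    refine tendsto_integral_filter_of_dominated_convergence fejK ?_ ?_ fejK_integrable ?_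
    · exact Eventually.of_forall fun u => (i1 u).aestronglyMeasurable
    · refine Eventually.of_forall fun u => Eventually.of_forall fun w => ?_
      rw [Real.norm_of_nonneg (mul_nonneg (hχ0 _) (fejK_nonneg _))]
      have := mul_le_mul_of_nonneg_right (hχ1 (u - w / l)) (fejK_nonneg w)
      linarith
    · refine Eventually.of_forall fun w => ?_
      refine tendsto_const_nhds.congr' ?_
      filter_upwards [eventually_gt_atTop (w / l)] with u hu
      simp [hχ, hu]
  have L3 := (h1.const_mul l).add (L2.const_mul c)
  rw [mul_zero, zero_add] at L3
  refine L3.congr fun u => ?_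
  rw [e1]; ring

open MeasureTheory in
/-- A Tauberian theorem of Wiener-Ikehara type. -/
theorem tauber_main (f : ℝ → ℝ) (M c : ℝ) (hfm : Measurable f) (hf0 : ∀ t, 0 ≤ f t)
    (hfM : ∀ t, f t ≤ M) (hfneg : ∀ t, t < 0 → f t = 0) (hc : 0 ≤ c)
    (hslow : ∀ s t, s ≤ t → f s ≤ f t * Real.exp (t - s))
    (G : ℂ → ℂ) (hG : ContinuousOn G {z | 0 ≤ z.re})
    (hLap : ∀ z : ℂ, 0 < z.re →
      ∫ t in Set.Ioi (0:ℝ), ((f t - c : ℝ) : ℂ) * Complex.exp (-(z * t)) = G z) :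
    Tendsto f atTop (nhds c) := by
  have conv := tauber_conv' f M c hfm hf0 hfM hfneg hc G hG hLap
  set I := ∫ w, fejK w with hI
  have hIpos : 0 < I := fejK_integral_pos
  have hM : 0 ≤ M := (hf0 0).trans (hfM 0)
  -- truncated integrals
  have hIR : Tendsto (fun R : ℝ => ∫ w in Set.Ioc (-R) R, fejK w) atTop (nhds I) := by
    have := intervalIntegral_tendsto_integral fejK_integrable
      (tendsto_neg_atTop_atBot) (tendsto_id (α := ℝ) (x := atTop))
    refine this.congr' ?_
    filter_upwards [eventually_ge_atTop (0:ℝ)] with R hR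
    rw [id, intervalIntegral.integral_of_le (by linarith)]
  have hsplit : ∀ R : ℝ, ∫ w in (Set.Ioc (-R) R)ᶜ, fejK w = I - ∫ w in Set.Ioc (-R) R, fejK w := by
    intro R
    have := integral_add_compl (measurableSet_Ioc (a := -R) (b := R)) fejK_integrable
    linarith
  have hexp : ∀ b : ℝ, Tendsto (fun δ : ℝ => b * Real.exp (2 * δ)) (nhdsWithin 0 (Set.Ioi 0))
      (nhds b) := by
    intro b
    have : Tendsto (fun δ : ℝ => b * Real.exp (2 * δ)) (nhds 0) (nhds (b * Real.exp (2 * 0))) := by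
      apply Continuous.tendsto; fun_prop
    simp only [mul_zero, Real.exp_zero, mul_one] at this
    exact this.mono_left nhdsWithin_le_nhds
  refine tendsto_order.mpr ⟨fun a ha => ?_, fun b hb => ?_⟩
  · obtain ⟨δ, hδ1, hδ⟩ := (((hexp a).eventually_lt_const ha).and self_mem_nhdsWithin).exists
    have hδ' : 0 < δ := hδ
    have h2 : Tendsto (fun R : ℝ => a * Real.exp (2 * δ) * I + M * (I - ∫ w in Set.Ioc (-R) R, fejK w))
        atTop (nhds (a * Real.exp (2 * δ) * I + M * (I - I))) :=
      tendsto_const_nhds.add ((tendsto_const_nhds.sub hIR).const_mul M)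
    have h3 : a * Real.exp (2 * δ) * I + M * (I - I) < c * I := by
      rw [sub_self, mul_zero, add_zero]
      exact mul_lt_mul_of_pos_right hδ1 hIpos
    obtain ⟨R, hR1, hR⟩ := ((h2.eventually_lt_const h3).and (eventually_gt_atTop 0)).exists
    have h4 := (conv (R / δ) (by positivity)).eventually_const_lt hR1
    have h5 : Tendsto (fun u : ℝ => u - δ) atTop atTop := tendsto_atTop_add_const_right _ _ tendsto_id
    filter_upwards [h5.eventually h4] with u hu
    by_contra hcon
    push Not at hcon
    have i2 := tauber_int f M hfm hf0 hfM (R / δ) (u - δ)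
    have b1 : ∫ w in Set.Ioc (-R) R, f (u - δ - w / (R / δ)) * fejK w ≤
        ∫ w in Set.Ioc (-R) R, f u * Real.exp (2 * δ) * fejK w := by
      refine setIntegral_mono_on i2.integrableOn (fejK_integrable.const_mul _).integrableOn
        measurableSet_Ioc fun w hw => ?_
      refine mul_le_mul_of_nonneg_right ?_ (fejK_nonneg w)
      have q1 : w / (R / δ) ≤ δ := by
        rw [div_le_iff₀ (by positivity)]
        have : δ * (R / δ) = R := by field_simp
        rw [this]; exact hw.2
      have q2 : -δ ≤ w / (R / δ) := by
        rw [le_div_iff₀ (by positivity)]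
        have : -δ * (R / δ) = -R := by field_simp
        rw [this]; exact hw.1.le
      refine (hslow (u - δ - w / (R / δ)) u (by linarith)).trans ?_
      refine mul_le_mul_of_nonneg_left (Real.exp_le_exp.mpr (by linarith)) (hf0 u)
    have b2 : ∫ w in (Set.Ioc (-R) R)ᶜ, f (u - δ - w / (R / δ)) * fejK w ≤
        ∫ w in (Set.Ioc (-R) R)ᶜ, M * fejK w := by
      refine setIntegral_mono_on i2.integrableOn (fejK_integrable.const_mul _).integrableOn
        measurableSet_Ioc.compl fun w hw => ?_
      exact mul_le_mul_of_nonneg_right (hfM _) (fejK_nonneg w)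
    have b3 := integral_add_compl (measurableSet_Ioc (a := -R) (b := R)) i2
    rw [integral_const_mul] at b1 b2
    rw [hsplit] at b2
    have b4 : ∫ w in Set.Ioc (-R) R, fejK w ≤ I :=
      setIntegral_le_integral fejK_integrable (Eventually.of_forall fejK_nonneg)
    have b5 : f u * Real.exp (2 * δ) * ∫ w in Set.Ioc (-R) R, fejK w ≤
        f u * Real.exp (2 * δ) * I :=
      mul_le_mul_of_nonneg_left b4 (mul_nonneg (hf0 u) (Real.exp_pos _).le)
    have b6 : f u * Real.exp (2 * δ) * I ≤ a * Real.exp (2 * δ) * I := by gcongr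
    linarith
  · obtain ⟨δ, hδ1, hδ⟩ := (((hexp c).eventually_lt_const hb).and self_mem_nhdsWithin).exists
    have hδ' : 0 < δ := hδ
    have h2 : Tendsto (fun R : ℝ => b * Real.exp (-(2 * δ)) * ∫ w in Set.Ioc (-R) R, fejK w)
        atTop (nhds (b * Real.exp (-(2 * δ)) * I)) := hIR.const_mul _
    have h3 : c * I < b * Real.exp (-(2 * δ)) * I := by
      refine mul_lt_mul_of_pos_right ?_ hIpos
      rw [Real.exp_neg, ← div_eq_mul_inv, lt_div_iff₀ (Real.exp_pos _)]
      exact hδ1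
    obtain ⟨R, hR1, hR⟩ := ((h2.eventually_const_lt h3).and (eventually_gt_atTop 0)).exists
    have h4 := (conv (R / δ) (by positivity)).eventually_lt_const hR1
    have h5 : Tendsto (fun u : ℝ => u + δ) atTop atTop := tendsto_atTop_add_const_right _ _ tendsto_id
    filter_upwards [h5.eventually h4] with u hu
    by_contra hcon
    push Not at hcon
    have i2 := tauber_int f M hfm hf0 hfM (R / δ) (u + δ)
    have b1 : ∫ w in Set.Ioc (-R) R, f u * Real.exp (-(2 * δ)) * fejK w ≤
        ∫ w in Set.Ioc (-R) R, f (u + δ - w / (R / δ)) * fejK w := by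
      refine setIntegral_mono_on (fejK_integrable.const_mul _).integrableOn i2.integrableOn
        measurableSet_Ioc fun w hw => ?_
      refine mul_le_mul_of_nonneg_right ?_ (fejK_nonneg w)
      have q1 : w / (R / δ) ≤ δ := by
        rw [div_le_iff₀ (by positivity)]
        have : δ * (R / δ) = R := by field_simp
        rw [this]; exact hw.2
      have q2 : -δ ≤ w / (R / δ) := by
        rw [le_div_iff₀ (by positivity)]
        have : -δ * (R / δ) = -R := by field_simp
        rw [this]; exact hw.1.le
      rw [Real.exp_neg, ← div_eq_mul_inv, div_le_iff₀ (Real.exp_pos _)]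
      refine (hslow u (u + δ - w / (R / δ)) (by linarith)).trans ?_
      refine mul_le_mul_of_nonneg_left (Real.exp_le_exp.mpr (by linarith)) (hf0 _)
    have b2 : 0 ≤ ∫ w in (Set.Ioc (-R) R)ᶜ, f (u + δ - w / (R / δ)) * fejK w :=
      integral_nonneg fun w => mul_nonneg (hf0 _) (fejK_nonneg w)
    have b3 := integral_add_compl (measurableSet_Ioc (a := -R) (b := R)) i2
    rw [integral_const_mul] at b1
    have b4 : 0 ≤ ∫ w in Set.Ioc (-R) R, fejK w := integral_nonneg fejK_nonneg
    have b6 : b * Real.exp (-(2 * δ)) * ∫ w in Set.Ioc (-R) R, fejK w ≤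
      f u * Real.exp (-(2 * δ)) * ∫ w in Set.Ioc (-R) R, fejK w := by gcongr
    linarith


open ArithmeticFunction.vonMangoldt in
/-- The Chebyshev function in a residue class. -/
noncomputable def psiAP {q : ℕ} (a : ZMod q) (x : ℝ) : ℝ :=
  ∑ k ∈ Finset.Icc 1 ⌊x⌋₊, residueClass a k

open ArithmeticFunction.vonMangoldt in
lemma psiAP_mono {q : ℕ} (a : ZMod q) : Monotone (psiAP a) := by
  intro x y hxy
  unfold psiAP
  exact Finset.sum_le_sum_of_subset_of_nonneg
    (Finset.Icc_subset_Icc_right (Nat.floor_mono hxy)) fun i _ _ => residueClass_nonneg a i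

open ArithmeticFunction.vonMangoldt in
lemma psiAP_nonneg {q : ℕ} (a : ZMod q) (x : ℝ) : 0 ≤ psiAP a x :=
  Finset.sum_nonneg fun i _ => residueClass_nonneg a i

open ArithmeticFunction.vonMangoldt in
lemma psiAP_le {q : ℕ} (a : ZMod q) (x : ℝ) (hx : 0 ≤ x) : psiAP a x ≤ (Real.log 4 + 4) * x := by
  refine le_trans ?_ (Chebyshev.psi_le_const_mul_self hx)
  unfold psiAP Chebyshev.psi
  exact Finset.sum_le_sum fun i _ => residueClass_le a i

open ArithmeticFunction.vonMangoldt MeasureTheory in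
lemma psiAP_laplace {q : ℕ} [NeZero q] {a : ZMod q} (ha : IsUnit a) (z : ℂ) (hz : 0 < z.re) :
    ∫ t in Set.Ioi (0:ℝ), ((psiAP a (Real.exp t) * Real.exp (-t) - (q.totient : ℝ)⁻¹ : ℝ) : ℂ) *
      Complex.exp (-(z * t)) = (LFunctionResidueClassAux a (1 + z) - (q.totient : ℂ)⁻¹) / (1 + z) := by
  have hz0 : z ≠ 0 := by rintro rfl; simp at hz
  have hz1 : 1 + z ≠ 0 := by
    intro h
    have := congrArg Complex.re h
    simp at this; linarith
  have hM : ∀ t : ℝ, |psiAP a (Real.exp t) * Real.exp (-t)| ≤ Real.log 4 + 4 := by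
    intro t
    rw [abs_of_nonneg (mul_nonneg (psiAP_nonneg a _) (Real.exp_pos _).le), Real.exp_neg,
      ← div_eq_mul_inv, div_le_iff₀ (Real.exp_pos _)]
    exact psiAP_le a _ (Real.exp_pos _).le
  have hexp : IntegrableOn (fun t : ℝ => Complex.exp (-(z * t))) (Set.Ioi 0) := by
    have := integrableOn_exp_mul_complex_Ioi (a := -z) (by simpa using hz) 0
    simpa using this
  have hmeas : Measurable fun t : ℝ => psiAP a (Real.exp t) :=
    ((psiAP_mono a).measurable).comp Real.measurable_exp
  have i1 : IntegrableOn (fun t : ℝ => ((psiAP a (Real.exp t) * Real.exp (-t) : ℝ) : ℂ) *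
      Complex.exp (-(z * t))) (Set.Ioi 0) := by
    refine Integrable.bdd_mul (c := Real.log 4 + 4) hexp ?_ ?_
    · apply Measurable.aestronglyMeasurable
      fun_prop
    · refine Eventually.of_forall fun t => ?_
      rw [Complex.norm_real]; exact hM t
  have e0 : ∫ t in Set.Ioi (0:ℝ), Complex.exp (-(z * t)) = 1 / z := by
    have := integral_exp_mul_complex_Ioi (a := -z) (by simpa using hz) 0
    simpa using this
  have e1 : ∫ t in Set.Ioi (0:ℝ), ((psiAP a (Real.exp t) * Real.exp (-t) : ℝ) : ℂ) *
      Complex.exp (-(z * t)) = ∫ x in Set.Ioi (1:ℝ),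
        (∑ k ∈ Finset.Icc 1 ⌊x⌋₊, ((residueClass a k : ℝ) : ℂ)) * (x:ℂ) ^ (-((1 + z) + 1)) := by
    have himg : Real.exp '' Set.Ioi 0 = Set.Ioi 1 := by
      ext x
      simp only [Set.mem_image, Set.mem_Ioi]
      constructor
      · rintro ⟨t, ht, rfl⟩; exact Real.one_lt_exp_iff.mpr ht
      · intro hx; exact ⟨Real.log x, Real.log_pos hx, Real.exp_log (by linarith)⟩
    rw [← himg, integral_image_eq_integral_abs_deriv_smul measurableSet_Ioi
      (fun x _ => (Real.hasDerivAt_exp x).hasDerivWithinAt) (Real.exp_injective.injOn)]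
    refine setIntegral_congr_fun measurableSet_Ioi fun t _ => ?_
    rw [abs_of_pos (Real.exp_pos t), Complex.real_smul, ← Complex.ofReal_sum]
    change _ = _ * (((psiAP a (Real.exp t) : ℝ) : ℂ) * _)
    rw [Complex.ofReal_exp, Complex.cpow_def_of_ne_zero (Complex.exp_ne_zero _),
      ← Complex.ofReal_exp, ← Complex.ofReal_log (Real.exp_pos t).le, Real.log_exp]
    push_cast
    have : Complex.exp t * Complex.exp (t * (-((1 + z) + 1))) =
      Complex.exp (-t) * Complex.exp (-(z * t)) := by
      rw [← Complex.exp_add, ← Complex.exp_add]; congr 1; ring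
    linear_combination -((psiAP a (Real.exp t) : ℝ) : ℂ) * this
  have e2 := LSeries_eq_mul_integral_of_nonneg (fun n => residueClass a n) (r := 1) zero_le_one
    (s := 1 + z) (by simpa using hz) (by
      refine Asymptotics.IsBigO.of_bound (Real.log 4 + 4) (Eventually.of_forall fun n => ?_)
      have h1 := psiAP_le a n (Nat.cast_nonneg n)
      have h0 := psiAP_nonneg a n
      unfold psiAP at h1 h0
      rw [Nat.floor_natCast] at h1 h0
      rw [Real.norm_of_nonneg h0, Real.rpow_one, Real.norm_of_nonneg (Nat.cast_nonneg n)]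
      exact h1) (residueClass_nonneg a)
  have e3 := eqOn_LFunctionResidueClassAux ha (x := 1 + z) (by simpa using hz)
  simp only at e3
  have e4 : LSeries (fun n => ((residueClass a n : ℝ) : ℂ)) (1 + z) =
      LFunctionResidueClassAux a (1 + z) + (q.totient : ℂ)⁻¹ / z := by
    rw [e3, add_sub_cancel_left, sub_add_cancel]
  rw [← e1] at e2
  have e5 : ∀ t : ℝ, ((psiAP a (Real.exp t) * Real.exp (-t) - (q.totient : ℝ)⁻¹ : ℝ) : ℂ) *
      Complex.exp (-(z * t)) = ((psiAP a (Real.exp t) * Real.exp (-t) : ℝ) : ℂ) *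
      Complex.exp (-(z * t)) - (q.totient : ℂ)⁻¹ * Complex.exp (-(z * t)) := by
    intro t; push_cast; ring
  simp_rw [e5]
  rw [integral_sub i1 (hexp.const_mul _), integral_const_mul, e0]
  have e6 := e2.symm.trans e4
  have e7 : ∫ t in Set.Ioi (0:ℝ), ((psiAP a (Real.exp t) * Real.exp (-t) : ℝ) : ℂ) *
      Complex.exp (-(z * t)) = (LFunctionResidueClassAux a (1 + z) + (q.totient : ℂ)⁻¹ / z) / (1 + z) := by
    rw [eq_div_iff hz1, ← e6]; ring
  rw [e7]
  field_simp
  ring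

open ArithmeticFunction.vonMangoldt MeasureTheory in
/-- Prime number theorem in arithmetic progressions, for the Chebyshev function. -/
theorem psiAP_tendsto {q : ℕ} [NeZero q] {a : ZMod q} (ha : IsUnit a) :
    Tendsto (fun x : ℝ => psiAP a x / x) atTop (nhds (q.totient : ℝ)⁻¹) := by
  have key := tauber_main (fun t => psiAP a (Real.exp t) * Real.exp (-t)) (Real.log 4 + 4)
    (q.totient : ℝ)⁻¹ (by
      have hmeas : Measurable fun t : ℝ => psiAP a (Real.exp t) :=
        ((psiAP_mono a).measurable).comp Real.measurable_exp
      fun_prop)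
    (fun t => mul_nonneg (psiAP_nonneg a _) (Real.exp_pos _).le)
    (fun t => by
      rw [Real.exp_neg, ← div_eq_mul_inv, div_le_iff₀ (Real.exp_pos _)]
      exact psiAP_le a _ (Real.exp_pos _).le)
    (fun t ht => by
      have : ⌊Real.exp t⌋₊ = 0 := Nat.floor_eq_zero.mpr (Real.exp_lt_one_iff.mpr ht)
      simp [psiAP, this])
    (by positivity)
    (fun s t hst => by
      have h1 : psiAP a (Real.exp s) ≤ psiAP a (Real.exp t) := psiAP_mono a (Real.exp_le_exp.mpr hst)
      calc psiAP a (Real.exp s) * Real.exp (-s) ≤ psiAP a (Real.exp t) * Real.exp (-s) := by gcongr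
        _ = _ := by rw [mul_assoc, ← Real.exp_add]; congr 2; ring)
    (fun z => (LFunctionResidueClassAux a (1 + z) - (q.totient : ℂ)⁻¹) / (1 + z))
    (by
      refine ContinuousOn.div (ContinuousOn.sub ?_ continuousOn_const) (by fun_prop) ?_
      · refine (continuousOn_LFunctionResidueClassAux a).comp (by fun_prop) ?_
        intro z hz
        simpa using hz
      · intro z hz h
        have := congrArg Complex.re h
        simp at this hz; linarith)
    (fun z hz => psiAP_laplace ha z hz)
  refine (key.comp Real.tendsto_log_atTop).congr' ?_
  filter_upwards [eventually_gt_atTop 0] with x hx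
  simp only [Function.comp]
  rw [Real.exp_neg, Real.exp_log hx, div_eq_mul_inv]


/-- Primes up to `x` in a residue class. -/
noncomputable def primesAP {q : ℕ} (a : ZMod q) (x : ℝ) : Finset ℕ :=
  (Finset.Ioc 0 ⌊x⌋₊).filter fun n => n.Prime ∧ (n : ZMod q) = a

/-- Number of primes up to `x` in a residue class. -/
noncomputable def piAP {q : ℕ} (a : ZMod q) (x : ℝ) : ℝ := (primesAP a x).card

/-- theta function in a residue class. -/
noncomputable def thetaAP {q : ℕ} (a : ZMod q) (x : ℝ) : ℝ := ∑ n ∈ primesAP a x, Real.log n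

lemma primesAP_subset {q : ℕ} (a : ZMod q) {x y : ℝ} (h : x ≤ y) : primesAP a x ⊆ primesAP a y :=
  Finset.filter_subset_filter _ (Finset.Ioc_subset_Ioc_right (Nat.floor_mono h))

lemma piAP_mono {q : ℕ} (a : ZMod q) : Monotone (piAP a) := by
  intro x y h
  unfold piAP
  exact_mod_cast Finset.card_le_card (primesAP_subset a h)

lemma piAP_nonneg {q : ℕ} (a : ZMod q) (x : ℝ) : 0 ≤ piAP a x := by unfold piAP; positivity

lemma mem_primesAP {q : ℕ} {a : ZMod q} {x : ℝ} {n : ℕ} :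
    n ∈ primesAP a x ↔ n.Prime ∧ (n : ZMod q) = a ∧ (n : ℝ) ≤ x := by
  unfold primesAP
  simp only [Finset.mem_filter, Finset.mem_Ioc]
  constructor
  · rintro ⟨⟨h1, h2⟩, h3, h4⟩
    exact ⟨h3, h4, (Nat.le_floor_iff' h1.ne').mp h2⟩
  · rintro ⟨h3, h4, h2⟩
    exact ⟨⟨h3.pos, (Nat.le_floor_iff' h3.ne_zero).mpr h2⟩, h3, h4⟩

open ArithmeticFunction.vonMangoldt in
lemma thetaAP_bound {q : ℕ} (a : ZMod q) (x : ℝ) :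
    |psiAP a x - thetaAP a x| ≤ Chebyshev.psi x - Chebyshev.theta x := by
  have h : psiAP a x - thetaAP a x =
      ∑ n ∈ Finset.Ioc 0 ⌊x⌋₊ with ¬ n.Prime, residueClass a n := by
    unfold psiAP thetaAP primesAP
    rw [Finset.sum_filter, Finset.sum_filter]
    change ∑ n ∈ Finset.Ioc 0 ⌊x⌋₊, _ - _ = _
    rw [← Finset.sum_sub_distrib]
    refine Finset.sum_congr rfl fun n hn => ?_
    by_cases hp : n.Prime
    · by_cases hc : (n : ZMod q) = a
      · simp [hp, hc, residueClass, ArithmeticFunction.vonMangoldt_apply_prime hp, Set.indicator]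
      · simp [hp, hc, residueClass, Set.indicator]
    · simp [hp]
  rw [h, Chebyshev.psi_sub_theta_eq_sum_not_prime, abs_of_nonneg
    (Finset.sum_nonneg fun i _ => residueClass_nonneg a i)]
  exact Finset.sum_le_sum fun i _ => residueClass_le a i

lemma piAP_bound {q : ℕ} (a : ZMod q) (x : ℝ) (hx : 2 ≤ x) :
    |piAP a x - thetaAP a x / Real.log x| ≤ Nat.primeCounting ⌊x⌋₊ - Chebyshev.theta x / Real.log x := by
  have hl : 0 < Real.log x := Real.log_pos (by linarith)
  have e1 : piAP a x - thetaAP a x / Real.log x =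
      ∑ n ∈ primesAP a x, (1 - Real.log n / Real.log x) := by
    simp [piAP, thetaAP, Finset.sum_div]
  have e2 : (Nat.primeCounting ⌊x⌋₊ : ℝ) - Chebyshev.theta x / Real.log x =
      ∑ n ∈ Finset.Ioc 0 ⌊x⌋₊ with n.Prime, (1 - Real.log n / Real.log x) := by
    rw [← Nat.primesLE_card_eq_primeCounting, Nat.primesLE_eq_filter_Icc_one]
    simp [Chebyshev.theta, Finset.sum_div]
    rfl
  have hn : ∀ n ∈ (Finset.Ioc 0 ⌊x⌋₊).filter Nat.Prime, 0 ≤ 1 - Real.log n / Real.log x := by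
    intro n hn
    simp only [Finset.mem_filter, Finset.mem_Ioc] at hn
    have : (n : ℝ) ≤ x := (Nat.le_floor_iff' hn.1.1.ne').mp hn.1.2
    rw [sub_nonneg, div_le_one hl]
    exact Real.log_le_log (by exact_mod_cast hn.1.1) this
  have hsub : primesAP a x ⊆ (Finset.Ioc 0 ⌊x⌋₊).filter Nat.Prime := by
    intro n; unfold primesAP; simp only [Finset.mem_filter]; tauto
  rw [e1, e2, abs_of_nonneg (Finset.sum_nonneg fun i hi => hn i (hsub hi))]
  exact Finset.sum_le_sum_of_subset_of_nonneg hsub fun i hi _ => hn i hi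

/-- Prime number theorem in arithmetic progressions. -/
theorem piAP_tendsto {q : ℕ} [NeZero q] {a : ZMod q} (ha : IsUnit a) :
    Tendsto (fun x => piAP a x * Real.log x / x) atTop (nhds (q.totient : ℝ)⁻¹) := by
  have h1 := psiAP_tendsto ha
  have h2 : Tendsto (fun x => (psiAP a x - thetaAP a x) / x) atTop (nhds 0) := by
    have hb : (fun x => psiAP a x - thetaAP a x) =O[atTop] Real.sqrt := by
      refine Asymptotics.IsBigO.trans ?_ Chebyshev.isBigO_psi_sub_theta_sqrt
      refine Asymptotics.IsBigO.of_bound 1 (Eventually.of_forall fun x => ?_)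
      rw [one_mul]
      exact (thetaAP_bound a x).trans (le_abs_self _)
    have hs : Real.sqrt =o[atTop] (fun x : ℝ => x) := by
      refine Asymptotics.isLittleO_iff_tendsto' ?_ |>.mpr ?_
      · filter_upwards [eventually_gt_atTop 0] with x hx h0
        exact absurd h0 hx.ne'
      refine Tendsto.congr' (f₁ := fun x ↦ (Real.sqrt x)⁻¹) ?_
        Real.tendsto_sqrt_atTop.inv_tendsto_atTop
      filter_upwards [eventually_gt_atTop 0] with x hx
      rw [eq_div_iff hx.ne', ← Real.mul_self_sqrt hx.le]
      have := Real.sqrt_pos.mpr hx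
      rw [Real.mul_self_sqrt hx.le]
      nth_rewrite 2 [← Real.mul_self_sqrt hx.le]
      field_simp
    exact (hb.trans_isLittleO hs).tendsto_div_nhds_zero
  have h3 : Tendsto (fun x => (piAP a x - thetaAP a x / Real.log x) / (x / Real.log x)) atTop (nhds 0) := by
    have hb : (fun x => piAP a x - thetaAP a x / Real.log x) =O[atTop] fun x => x / Real.log x ^ 2 := by
      refine Asymptotics.IsBigO.trans ?_ Chebyshev.primeCounting_sub_theta_div_log_isBigO
      refine Asymptotics.IsBigO.of_bound 1 ?_
      filter_upwards [eventually_ge_atTop 2] with x hx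
      rw [one_mul]
      exact (piAP_bound a x hx).trans (le_abs_self _)
    have hs : (fun x : ℝ => x / Real.log x ^ 2) =o[atTop] (fun x : ℝ => x / Real.log x) := by
      refine Asymptotics.isLittleO_iff_tendsto' (by simp) |>.mpr ?_
      refine Tendsto.congr' (f₁ := fun x ↦ (Real.log x)⁻¹) ?_ Real.tendsto_log_atTop.inv_tendsto_atTop
      filter_upwards [eventually_gt_atTop 1] with x hx
      have := Real.log_pos hx
      field_simp
    exact (hb.trans_isLittleO hs).tendsto_div_nhds_zero
  have := (h1.sub h2).add h3
  simp only [sub_zero, add_zero] at this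
  refine this.congr' ?_
  filter_upwards [eventually_gt_atTop 1] with x hx
  have := Real.log_pos hx
  field_simp
  ring


/-- Weak convergence from convergence of distribution functions. -/
lemma weak_conv {ι : Type*} (l : Filter ι) (S : ι → Finset ℕ) (pos : ι → ℕ → ℝ) (w : ι → ℝ)
    (hw : ∀ᶠ i in l, 0 ≤ w i) (a b c : ℝ) (hab : a < b) (hc : 0 ≤ c)
    (hS : ∀ᶠ i in l, ∀ n ∈ S i, a < pos i n ∧ pos i n ≤ b)
    (hF : ∀ s ∈ Set.Icc a b,
      Tendsto (fun i => w i * (((S i).filter fun n => pos i n ≤ s).card : ℝ)) l (nhds (c * (s - a))))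
    (h : ℝ → ℝ) (hcont : ContinuousOn h (Set.Icc a b)) (g : ι → ℕ → ℝ)
    (hg : ∀ ε > 0, ∀ᶠ i in l, ∀ n ∈ S i, |g i n - h (pos i n)| ≤ ε) :
    Tendsto (fun i => w i * ∑ n ∈ S i, g i n) l (nhds (c * ∫ t in a..b, h t)) := by
  rw [Metric.tendsto_nhds]
  intro ε₀ hε₀
  set M := c * (b - a) with hM
  have hM0 : 0 ≤ M := mul_nonneg hc (by linarith)
  obtain ⟨ε, hε, hεM⟩ : ∃ ε > 0, 2 * ε * (M + 1) + ε + ε * M < ε₀ := by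
    refine ⟨ε₀ / (2 * (3 * M + 3)), by positivity, ?_⟩
    rw [show 2 * (ε₀ / (2 * (3 * M + 3))) * (M + 1) + ε₀ / (2 * (3 * M + 3)) +
      ε₀ / (2 * (3 * M + 3)) * M = ε₀ / 2 by field_simp; ring]
    linarith
  have huc := isCompact_Icc.uniformContinuousOn_of_continuous hcont
  rw [Metric.uniformContinuousOn_iff] at huc
  obtain ⟨δ, hδ, huc⟩ := huc ε hε
  obtain ⟨N, hN⟩ := exists_nat_gt ((b - a) / δ)
  have hN0 : 0 < (N : ℝ) := lt_trans (div_pos (by linarith) hδ) hN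
  set s : ℕ → ℝ := fun k => a + (b - a) * k / N with hs
  have hs0 : s 0 = a := by simp [hs]
  have hsN : s N = b := by simp only [hs]; field_simp; ring
  have hstep : ∀ k, s (k + 1) - s k = (b - a) / N := by
    intro k; simp only [hs]; push_cast; field_simp; ring
  have hsm : ∀ k, s k ≤ s (k + 1) := by
    intro k; have := hstep k
    have h2 : 0 ≤ (b - a) / N := div_nonneg (by linarith) hN0.le
    linarith
  have hstepδ : ∀ k, s (k + 1) - s k < δ := by
    intro k; rw [hstep, div_lt_iff₀ hN0]; rw [div_lt_iff₀ hδ] at hN; linarith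
  have hmono : Monotone s := monotone_nat_of_le_succ hsm
  have hmem : ∀ k ≤ N, s k ∈ Set.Icc a b := fun k hk =>
    ⟨hs0 ▸ hmono (Nat.zero_le k), hsN ▸ hmono hk⟩
  set F : ι → ℝ → ℝ := fun i t => w i * (((S i).filter fun n => pos i n ≤ t).card : ℝ) with hFdef
  have hlim : Tendsto (fun i => ∑ k ∈ Finset.range N,
      h (s k) * ((F i (s (k + 1)) - F i (s k)) - c * (s (k + 1) - s k))) l (nhds 0) := by
    rw [show (0:ℝ) = ∑ k ∈ Finset.range N, (0:ℝ) by simp]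
    refine tendsto_finsetSum _ fun k hk => ?_
    have hk' := Finset.mem_range.mp hk
    have h1 := hF (s (k + 1)) (hmem _ hk')
    have h2 := hF (s k) (hmem _ hk'.le)
    have h3 := ((h1.sub h2).sub (tendsto_const_nhds (x := c * (s (k + 1) - s k)))).const_mul (h (s k))
    convert h3 using 2
    ring
  have hFb : ∀ᶠ i in l, F i b ≤ M + 1 := by
    have := hF b ⟨hab.le, le_rfl⟩
    exact this.eventually_le_const (by linarith)
  have hlim' : ∀ᶠ i in l, |∑ k ∈ Finset.range N,
      h (s k) * ((F i (s (k + 1)) - F i (s k)) - c * (s (k + 1) - s k))| < ε := by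
    have := (Metric.tendsto_nhds.mp hlim) ε hε
    simpa [Real.dist_eq] using this
  have hcont_int : ∀ k < N, IntervalIntegrable h MeasureTheory.volume (s k) (s (k+1)) := by
    intro k hk
    apply ContinuousOn.intervalIntegrable
    rw [Set.uIcc_of_le (hsm k)]
    exact hcont.mono (Set.Icc_subset_Icc (hmem k hk.le).1 (hmem (k+1) hk).2)
  have hI : ∑ k ∈ Finset.range N, ∫ t in s k..s (k+1), h t = ∫ t in a..b, h t := by
    rw [intervalIntegral.sum_integral_adjacent_intervals (fun k hk => hcont_int k hk), hs0, hsN]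
  have hI2 : ∀ k < N, |h (s k) * (s (k+1) - s k) - ∫ t in s k..s (k+1), h t| ≤
      ε * (s (k+1) - s k) := by
    intro k hk
    have e : h (s k) * (s (k+1) - s k) - ∫ t in s k..s (k+1), h t =
        ∫ t in s k..s (k+1), (h (s k) - h t) := by
      rw [intervalIntegral.integral_sub (by simp) (hcont_int k hk)]
      simp [mul_comm]
    rw [e]
    have := intervalIntegral.norm_integral_le_of_norm_le_const (a := s k) (b := s (k+1))
      (f := fun t => h (s k) - h t) (C := ε) (by
        intro t ht
        rw [Set.uIoc_of_le (hsm k)] at ht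
        have hd := huc (s k) (hmem k hk.le) t
          ⟨(hmem k hk.le).1.trans ht.1.le, ht.2.trans (hmem (k+1) hk).2⟩ (by
            rw [Real.dist_eq, abs_sub_comm, abs_of_pos (by linarith [ht.1])]
            linarith [ht.2, hstepδ k])
        rw [Real.dist_eq] at hd
        exact hd.le)
    rwa [abs_of_nonneg (by linarith [hsm k]), Real.norm_eq_abs] at this
  filter_upwards [hw, hS, hg ε hε, hFb, hlim'] with i hwi hSi hgi hFbi hlimi
  set T : ℝ → ℝ := fun t => w i * ∑ n ∈ (S i).filter (fun n => pos i n ≤ t), g i n with hT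
  have hTb : T b = w i * ∑ n ∈ S i, g i n := by
    simp only [hT]; rw [Finset.filter_true_of_mem fun n hn => (hSi n hn).2]
  have hTa : T a = 0 := by
    simp only [hT]
    rw [Finset.filter_false_of_mem fun n hn => not_le.mpr (hSi n hn).1]; simp
  have hFa : F i a = 0 := by
    simp only [hFdef]
    rw [Finset.filter_false_of_mem fun n hn => not_le.mpr (hSi n hn).1]; simp
  have hdec : ∀ (f : ℕ → ℝ) k, ∑ n ∈ (S i).filter (fun n => pos i n ≤ s (k+1)), f n -
      ∑ n ∈ (S i).filter (fun n => pos i n ≤ s k), f n =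
      ∑ n ∈ (S i).filter (fun n => s k < pos i n ∧ pos i n ≤ s (k+1)), f n := by
    intro f k
    rw [sub_eq_iff_eq_add, ← Finset.sum_union]
    · congr 1
      ext n
      simp only [Finset.mem_filter, Finset.mem_union]
      have := hsm k
      constructor
      · rintro ⟨h1, h2⟩
        rcases le_or_gt (pos i n) (s k) with h3 | h3
        · exact Or.inr ⟨h1, h3⟩
        · exact Or.inl ⟨h1, h3, h2⟩
      · rintro (⟨h1, h2, h3⟩ | ⟨h1, h2⟩)
        · exact ⟨h1, h3⟩
        · exact ⟨h1, h2.trans this⟩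
    · rw [Finset.disjoint_filter]
      rintro n _ ⟨h1, _⟩ h2
      linarith
  have hFd : ∀ k, F i (s (k+1)) - F i (s k) =
      w i * ∑ n ∈ (S i).filter (fun n => s k < pos i n ∧ pos i n ≤ s (k+1)), (1:ℝ) := by
    intro k
    rw [← hdec]; simp [hFdef]; ring
  have hTd : ∀ k, T (s (k+1)) - T (s k) =
      w i * ∑ n ∈ (S i).filter (fun n => s k < pos i n ∧ pos i n ≤ s (k+1)), g i n := by
    intro k
    rw [← hdec]; simp [hT]; ring
  have hTF : ∀ k < N, |(T (s (k+1)) - T (s k)) - h (s k) * (F i (s (k+1)) - F i (s k))| ≤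
      2 * ε * (F i (s (k+1)) - F i (s k)) := by
    intro k hk
    rw [hTd, hFd]
    rw [show w i * ∑ n ∈ (S i).filter (fun n => s k < pos i n ∧ pos i n ≤ s (k+1)), g i n -
      h (s k) * (w i * ∑ n ∈ (S i).filter (fun n => s k < pos i n ∧ pos i n ≤ s (k+1)), (1:ℝ)) =
      w i * ∑ n ∈ (S i).filter (fun n => s k < pos i n ∧ pos i n ≤ s (k+1)), (g i n - h (s k)) by
        rw [Finset.sum_sub_distrib]; simp; ring]
    rw [abs_mul, abs_of_nonneg hwi]
    rw [show 2 * ε * (w i * ∑ n ∈ (S i).filter (fun n => s k < pos i n ∧ pos i n ≤ s (k+1)), (1:ℝ)) =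
      w i * ∑ n ∈ (S i).filter (fun n => s k < pos i n ∧ pos i n ≤ s (k+1)), (2 * ε) by
        simp; ring]
    refine mul_le_mul_of_nonneg_left ((Finset.abs_sum_le_sum_abs _ _).trans
      (Finset.sum_le_sum fun n hn => ?_)) hwi
    simp only [Finset.mem_filter] at hn
    obtain ⟨hn1, hn2, hn3⟩ := hn
    have h1 := hgi n hn1
    have h2 := huc (pos i n) ⟨(hSi n hn1).1.le, (hSi n hn1).2⟩ (s k) (hmem k hk.le) (by
      rw [Real.dist_eq, abs_of_pos (by linarith)]
      linarith [hstepδ k])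
    rw [Real.dist_eq] at h2
    calc |g i n - h (s k)| = |(g i n - h (pos i n)) + (h (pos i n) - h (s k))| := by congr 1; ring
      _ ≤ _ := abs_add_le _ _
      _ ≤ 2 * ε := by linarith
  have hTsum : w i * ∑ n ∈ S i, g i n = ∑ k ∈ Finset.range N, (T (s (k+1)) - T (s k)) := by
    rw [Finset.sum_range_sub (fun k => T (s k)), hs0, hsN, hTa, hTb, sub_zero]
  have hFsum : F i b = ∑ k ∈ Finset.range N, (F i (s (k+1)) - F i (s k)) := by
    rw [Finset.sum_range_sub (fun k => F i (s k)), hs0, hsN, hFa, sub_zero]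
  have hssum : b - a = ∑ k ∈ Finset.range N, (s (k+1) - s k) := by
    rw [Finset.sum_range_sub s, hs0, hsN]
  rw [Real.dist_eq, hTsum, ← hI]
  have key : ∑ k ∈ Finset.range N, (T (s (k+1)) - T (s k)) -
      c * ∑ k ∈ Finset.range N, ∫ t in s k..s (k+1), h t =
      ∑ k ∈ Finset.range N, ((T (s (k+1)) - T (s k)) - h (s k) * (F i (s (k+1)) - F i (s k))) +
      ∑ k ∈ Finset.range N, h (s k) * ((F i (s (k + 1)) - F i (s k)) - c * (s (k + 1) - s k)) +
      ∑ k ∈ Finset.range N, c * (h (s k) * (s (k+1) - s k) - ∫ t in s k..s (k+1), h t) := by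
    rw [Finset.mul_sum, ← Finset.sum_sub_distrib, ← Finset.sum_add_distrib, ← Finset.sum_add_distrib]
    refine Finset.sum_congr rfl fun k _ => ?_
    ring
  rw [key]
  have b1 : |∑ k ∈ Finset.range N, ((T (s (k+1)) - T (s k)) - h (s k) * (F i (s (k+1)) - F i (s k)))| ≤
      2 * ε * F i b := by
    rw [hFsum, Finset.mul_sum]
    exact (Finset.abs_sum_le_sum_abs _ _).trans
      (Finset.sum_le_sum fun k hk => hTF k (Finset.mem_range.mp hk))
  have b3 : |∑ k ∈ Finset.range N, c * (h (s k) * (s (k+1) - s k) - ∫ t in s k..s (k+1), h t)| ≤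
      ε * M := by
    rw [hM, hssum, Finset.mul_sum, Finset.mul_sum]
    refine (Finset.abs_sum_le_sum_abs _ _).trans
      (Finset.sum_le_sum fun k hk => ?_)
    rw [abs_mul, abs_of_nonneg hc]
    have := mul_le_mul_of_nonneg_left (hI2 k (Finset.mem_range.mp hk)) hc
    linarith
  have b1' : 2 * ε * F i b ≤ 2 * ε * (M + 1) := mul_le_mul_of_nonneg_left hFbi (by linarith)
  refine lt_of_le_of_lt ((abs_add_le _ _).trans (add_le_add_left (abs_add_le _ _) _)) ?_
  linarith

/-- Pointwise convergence of monotone functions to a linear function is uniform. -/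
lemma unif_of_mono {ι : Type*} (l : Filter ι) (F : ι → ℝ → ℝ) (hmono : ∀ᶠ i in l, Monotone (F i))
    (c M : ℝ) (hM : 0 < M) (hc : 0 ≤ c)
    (hF : ∀ s ∈ Set.Icc 0 M, Tendsto (fun i => F i s) l (nhds (c * s))) (ε : ℝ) (hε : 0 < ε) :
    ∀ᶠ i in l, ∀ s ∈ Set.Icc 0 M, |F i s - c * s| ≤ ε := by
  obtain ⟨N, hN⟩ := exists_nat_gt (2 * c * M / ε)
  have hN0 : 0 < (N : ℝ) := lt_of_le_of_lt (by positivity) hN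
  have hgrid : ∀ᶠ i in l, ∀ k ∈ Finset.range (N + 1), |F i (M * k / N) - c * (M * k / N)| < ε / 2 := by
    rw [Filter.eventually_all_finset]
    intro k hk
    have hk' : (k : ℝ) ≤ N := by exact_mod_cast Nat.lt_succ_iff.mp (Finset.mem_range.mp hk)
    have := hF (M * k / N) ⟨by positivity, by
      rw [div_le_iff₀ hN0]; exact mul_le_mul_of_nonneg_left hk' hM.le⟩
    simpa [Real.dist_eq] using (Metric.tendsto_nhds.mp this) (ε/2) (by linarith)
  filter_upwards [hmono, hgrid] with i hm hg s hs
  have hstep : c * (M / N) ≤ ε / 2 := by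
    rw [div_lt_iff₀ hε] at hN
    rw [← mul_div_assoc, div_le_iff₀ hN0]; linarith
  rcases eq_or_lt_of_le hs.2 with h | h
  · have := hg N (by simp)
    rw [show M * (N:ℝ) / N = M by field_simp] at this
    rw [h]; linarith
  · set k := ⌊s * N / M⌋₊ with hk
    have h1 : (k : ℝ) ≤ s * N / M := Nat.floor_le (div_nonneg (mul_nonneg hs.1 hN0.le) hM.le)
    have h2 : s * N / M < k + 1 := Nat.lt_floor_add_one _
    have h3 : M * k / N ≤ s := by
      rw [le_div_iff₀ hM] at h1; rw [div_le_iff₀ hN0]; linarith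
    have h4 : s ≤ M * ((k+1 : ℕ) : ℝ) / N := by
      rw [div_lt_iff₀ hM] at h2; rw [le_div_iff₀ hN0]; push_cast; linarith
    have hkN : k < N := by
      have : (k : ℝ) < N := by
        refine lt_of_le_of_lt h1 ?_
        rw [div_lt_iff₀ hM, mul_comm]
        exact mul_lt_mul_of_pos_left h hN0
      exact_mod_cast this
    have g1 := abs_lt.mp (hg k (Finset.mem_range.mpr (by omega)))
    have g2 := abs_lt.mp (hg (k+1) (Finset.mem_range.mpr (by omega)))
    have m1 := hm h3
    have m2 := hm h4
    have e : M * ((k+1 : ℕ) : ℝ) / N = M * k / N + M / N := by push_cast; field_simp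
    have c1 : c * (M * k / N) ≤ c * s := mul_le_mul_of_nonneg_left h3 hc
    have c2 : c * s ≤ c * (M * ((k+1 : ℕ) : ℝ) / N) := mul_le_mul_of_nonneg_left h4 hc
    have c3 : c * (M * ((k+1 : ℕ) : ℝ) / N) = c * (M * k / N) + c * (M / N) := by rw [e]; ring
    rw [abs_le]
    constructor <;> linarith


lemma log_ratio_tendsto (s : ℝ) (hs : 0 < s) :
    Tendsto (fun Y : ℝ => Real.log Y / Real.log (s * Y)) atTop (nhds 1) := by
  have h1 : Tendsto (fun Y : ℝ => (Real.log s / Real.log Y + 1)⁻¹) atTop (nhds ((0 + 1)⁻¹)) :=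
    ((tendsto_const_nhds.div_atTop Real.tendsto_log_atTop).add_const 1).inv₀ (by norm_num)
  rw [zero_add, inv_one] at h1
  refine h1.congr' ?_
  filter_upwards [eventually_gt_atTop 1] with Y hY
  have := Real.log_pos hY
  rw [Real.log_mul hs.ne' (by linarith), div_add_one this.ne', inv_div]

lemma piAP_scale {q : ℕ} [NeZero q] {a : ZMod q} (ha : IsUnit a) (s : ℝ) (hs : 0 ≤ s) :
    Tendsto (fun Y : ℝ => Real.log Y / Y * piAP a (s * Y)) atTop (nhds ((q.totient : ℝ)⁻¹ * s)) := by
  rcases eq_or_lt_of_le hs with rfl | hs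
  · have : piAP a 0 = 0 := by simp [piAP, primesAP]
    simp [this]
  have hm : Tendsto (fun Y : ℝ => s * Y) atTop atTop := tendsto_id.const_mul_atTop hs
  have h1 := (piAP_tendsto ha).comp hm
  have h2 := (h1.mul (log_ratio_tendsto s hs)).mul_const s
  rw [mul_one] at h2
  refine h2.congr' ?_
  filter_upwards [eventually_gt_atTop 1, hm.eventually_gt_atTop 1] with Y hY hY2
  have := Real.log_pos hY
  have h3 := Real.log_pos hY2
  have : 0 < Y := by linarith
  simp only [Function.comp]
  field_simp

/-- Integral in the main term. -/
lemma main_integral (κ : ℝ) (hκ : 1 < κ) :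
    ∫ s in (0:ℝ)..1, (min (κ * s) (1 / max s (1/κ)) - s) = Real.log κ / 2 := by
  have hκ0 : 0 < κ := by linarith
  have hsq : 0 < Real.sqrt κ := Real.sqrt_pos.mpr hκ0
  have hsq1 : 1 < Real.sqrt κ := by rw [Real.lt_sqrt (by norm_num)]; linarith
  have hss : Real.sqrt κ * Real.sqrt κ = κ := Real.mul_self_sqrt hκ0.le
  set m := (Real.sqrt κ)⁻¹ with hm
  have hm0 : 0 < m := inv_pos.mpr hsq
  have hm1 : m < 1 := inv_lt_one_of_one_lt₀ hsq1
  have hkm : κ * (m * m) = 1 := by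
    rw [hm, ← mul_inv, hss, mul_inv_cancel₀ hκ0.ne']
  have hcont : Continuous fun s : ℝ => min (κ * s) (1 / max s (1/κ)) - s := by
    have : ∀ s : ℝ, max s (1/κ) ≠ 0 := fun s => (lt_max_of_lt_right (by positivity)).ne'
    fun_prop (disch := assumption)
  rw [← intervalIntegral.integral_add_adjacent_intervals (b := m)
    (hcont.intervalIntegrable _ _) (hcont.intervalIntegrable _ _)]
  have e1 : ∫ s in (0:ℝ)..m, (min (κ * s) (1 / max s (1/κ)) - s) = ∫ s in (0:ℝ)..m, (κ - 1) * s := by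
    refine intervalIntegral.integral_congr fun s hs => ?_
    rw [Set.uIcc_of_le hm0.le] at hs
    have : κ * s ≤ 1 / max s (1/κ) := by
      rcases le_total s (1/κ) with h | h
      · rw [max_eq_right h, one_div_one_div]
        have : s ≤ 1 := hs.2.trans hm1.le
        nlinarith
      · have hs0 : 0 < s := lt_of_lt_of_le (by positivity) h
        rw [max_eq_left h, le_div_iff₀ hs0]
        nlinarith [mul_self_le_mul_self hs0.le hs.2]
    simp only [min_eq_left this]; ring
  have e2 : ∫ s in m..1, (min (κ * s) (1 / max s (1/κ)) - s) = ∫ s in m..1, (s⁻¹ - s) := by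
    refine intervalIntegral.integral_congr fun s hs => ?_
    rw [Set.uIcc_of_le hm1.le] at hs
    have hs0 : 0 < s := lt_of_lt_of_le hm0 hs.1
    have h1 : 1/κ ≤ s := by
      rw [div_le_iff₀ hκ0]; nlinarith [hs.1]
    have : 1 / s ≤ κ * s := by
      rw [div_le_iff₀ hs0]; nlinarith [hs.1, mul_self_le_mul_self hm0.le hs.1]
    change min (κ * s) (1 / max s (1/κ)) - s = _
    rw [max_eq_left h1, min_eq_right this, one_div]
  rw [e1, e2, intervalIntegral.integral_const_mul, integral_id, intervalIntegral.integral_sub,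
    integral_inv_of_pos hm0 one_pos, integral_id]
  · have : Real.log (1 / m) = Real.log κ / 2 := by
      rw [hm, one_div, inv_inv, Real.log_sqrt hκ0.le]
    rw [this]; nlinarith
  · apply ContinuousOn.intervalIntegrable
    rw [Set.uIcc_of_le hm1.le]
    exact continuousOn_inv₀.mono fun s hs => (lt_of_lt_of_le hm0 hs.1).ne'
  · exact intervalIntegral.intervalIntegrable_id

/-- Pairs `q < r ≤ κ q - d`, `q r ≤ y`, of primes in a residue class. -/
noncomputable def pairSet {p : ℕ} (a : ZMod p) (κ d y : ℝ) : Finset (Σ _ : ℕ, ℕ) :=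
  (primesAP a (Real.sqrt y)).sigma fun q =>
    primesAP a (min (κ * q - d) (y / q)) \ primesAP a q

lemma mem_pairSet {p : ℕ} {a : ZMod p} {κ d y : ℝ} {q r : ℕ} (hy : 0 ≤ y) :
    (⟨q, r⟩ : Σ _ : ℕ, ℕ) ∈ pairSet a κ d y ↔ q.Prime ∧ r.Prime ∧ (q : ZMod p) = a ∧
      (r : ZMod p) = a ∧ q < r ∧ (r : ℝ) ≤ κ * q - d ∧ (q * r : ℝ) ≤ y := by
  unfold pairSet
  simp only [Finset.mem_sigma, Finset.mem_sdiff, mem_primesAP, le_min_iff, Nat.cast_le]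
  constructor
  · rintro ⟨⟨h1, h2, h3⟩, ⟨h4, h5, h6, h7⟩, h8⟩
    have hq : (0:ℝ) < q := by exact_mod_cast h1.pos
    refine ⟨h1, h4, h2, h5, ?_, h6, ?_⟩
    · by_contra h; exact h8 ⟨h4, h5, by omega⟩
    · rw [le_div_iff₀ hq] at h7; linarith
  · rintro ⟨h1, h2, h3, h4, h5, h6, h7⟩
    have hq : (0:ℝ) < q := by exact_mod_cast h1.pos
    have hqr : (q:ℝ) < r := by exact_mod_cast h5
    refine ⟨⟨h1, h3, ?_⟩, ⟨h2, h4, h6, ?_⟩, ?_⟩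
    · apply Real.le_sqrt_of_sq_le; nlinarith
    · rw [le_div_iff₀ hq]; linarith
    · rintro ⟨_, _, h⟩; omega

lemma card_sdiff_primesAP {p : ℕ} (a : ZMod p) (u v : ℝ) (hv : 0 ≤ v) :
    ((primesAP a u \ primesAP a v).card : ℝ) = max 0 (piAP a u - piAP a v) := by
  rcases le_total v u with h | h
  · rw [Finset.cast_card_sdiff (primesAP_subset a h), max_eq_right]
    · rfl
    · exact sub_nonneg.mpr (piAP_mono a h)
  · rw [Finset.sdiff_eq_empty_iff_subset.mpr (primesAP_subset a h), max_eq_left]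
    · simp
    · exact sub_nonpos.mpr (piAP_mono a h)

set_option maxHeartbeats 1000000 in
lemma pairSet_tendsto {p : ℕ} [NeZero p] {a : ZMod p} (ha : IsUnit a) (κ d : ℝ) (hκ : 1 < κ)
    (hd : 0 ≤ d) :
    Tendsto (fun Y : ℝ => (Real.log Y / Y) ^ 2 * ((pairSet a κ d (Y ^ 2)).card : ℝ)) atTop
      (nhds ((p.totient : ℝ)⁻¹ ^ 2 * (Real.log κ / 2))) := by
  set c := (p.totient : ℝ)⁻¹ with hc
  have hc0 : 0 ≤ c := by positivity
  have hκ0 : 0 < κ := by linarith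
  set F : ℝ → ℝ → ℝ := fun Y s => Real.log Y / Y * piAP a (s * Y) with hF
  have hw : ∀ᶠ Y : ℝ in atTop, 0 ≤ Real.log Y / Y := by
    filter_upwards [eventually_ge_atTop 1] with Y hY
    exact div_nonneg (Real.log_nonneg hY) (by linarith)
  have hmono : ∀ᶠ Y in atTop, Monotone (F Y) := by
    filter_upwards [hw, eventually_ge_atTop 1] with Y hY h1 s t hst
    exact mul_le_mul_of_nonneg_left (piAP_mono a (by nlinarith)) hY
  have hunif := unif_of_mono atTop F hmono c κ hκ0 hc0 (fun s hs => piAP_scale ha s hs.1)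
  have hpos : ∀ (Y : ℝ), 0 < Y → ∀ s, ∀ n : ℕ, (n : ℝ) / Y ≤ s ↔ (n:ℝ) ≤ s * Y := by
    intro Y hY s n; rw [div_le_iff₀ hY]
  have := weak_conv atTop (fun Y : ℝ => primesAP a Y) (fun Y n => n / Y) (fun Y => Real.log Y / Y)
    hw 0 1 c one_pos hc0 (by
      filter_upwards [eventually_ge_atTop 1] with Y hY n hn
      rw [mem_primesAP] at hn
      have : (0:ℝ) < n := by exact_mod_cast hn.1.pos
      exact ⟨by positivity, by rw [div_le_one (by linarith)]; exact hn.2.2⟩)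
    (by
      intro s hs
      rw [sub_zero]
      refine (piAP_scale ha s hs.1).congr' ?_
      filter_upwards [eventually_gt_atTop 0] with Y hY
      congr 2
      unfold piAP
      congr 2
      ext n
      simp only [Finset.mem_filter, mem_primesAP, hpos Y hY]
      have : s * Y ≤ Y := by nlinarith [hs.2]
      constructor
      · rintro ⟨h1, h2, h3⟩; exact ⟨⟨h1, h2, h3.trans this⟩, h3⟩
      · rintro ⟨⟨h1, h2, _⟩, h3⟩; exact ⟨h1, h2, h3⟩)
    (fun s => c * (min (κ * s) (1 / max s (1/κ)) - s)) (by
      have : ∀ s : ℝ, max s (1/κ) ≠ 0 := fun s => (lt_max_of_lt_right (by positivity)).ne'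
      apply Continuous.continuousOn
      fun_prop (disch := assumption))
    (fun Y n => Real.log Y / Y *
      ((primesAP a (min (κ * n - d) (Y ^ 2 / n)) \ primesAP a n).card : ℝ))
    (by
      intro ε hε
      have hsmall : ∀ᶠ Y : ℝ in atTop, c * (d / Y) ≤ ε / 2 := by
        have : Tendsto (fun Y : ℝ => c * (d / Y)) atTop (nhds (c * 0)) :=
          (tendsto_const_nhds.div_atTop tendsto_id).const_mul c
        rw [mul_zero] at this
        exact this.eventually_le_const (by linarith)
      filter_upwards [hunif (ε/4) (by linarith), hsmall, hw, eventually_ge_atTop 1] with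
        Y hu hsm hwY hY n hn
      have hY0 : 0 < Y := by linarith
      rw [mem_primesAP] at hn
      have hn0 : (0:ℝ) < n := by exact_mod_cast hn.1.pos
      rw [card_sdiff_primesAP _ _ _ hn0.le]
      set s := (n:ℝ) / Y with hs
      have hs0 : 0 < s := by positivity
      have hs1 : s ≤ 1 := by rw [hs, div_le_one hY0]; exact hn.2.2
      have hnY : (n:ℝ) = s * Y := by rw [hs]; field_simp
      have hmin : min (κ * n - d) (Y ^ 2 / n) = min (κ * s - d / Y) (1 / s) * Y := by
        rw [min_mul_of_nonneg _ _ hY0.le]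
        congr 1
        · rw [hnY]; field_simp
        · rw [hnY]; field_simp
      have hmin2 : min (κ * s) (1 / max s (1/κ)) = min (κ * s) (1 / s) := by
        rcases le_total (1/κ) s with h | h
        · rw [max_eq_left h]
        · rw [max_eq_right h, one_div_one_div, min_eq_left (by nlinarith)]
          rw [min_eq_left]
          rw [le_div_iff₀ hs0]
          rw [le_div_iff₀ hκ0] at h
          nlinarith
      rw [hmin2, hmin, hnY, mul_max_of_nonneg _ _ hwY, mul_zero, mul_sub]
      change |max 0 (F Y (min (κ * s - d / Y) (1 / s)) - F Y s) - _| ≤ ε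
      set u := min (κ * s - d / Y) (1 / s) with hu_def
      set v := min (κ * s) (1 / s) with hv_def
      have hdY : 0 ≤ d / Y := by positivity
      have huv : u ≤ v := min_le_min_right _ (by linarith)
      have huv' : v - d / Y ≤ u := by
        rw [hu_def, hv_def, le_min_iff]
        constructor
        · linarith [min_le_left (κ * s) (1/s)]
        · linarith [min_le_right (κ * s) (1/s)]
      have hv1 : v ≤ κ := (min_le_left _ _).trans (by nlinarith)
      have hvs : s ≤ v := by
        rw [hv_def, le_min_iff]
        constructor
        · nlinarith
        · rw [le_div_iff₀ hs0]; nlinarith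
      have bs := hu s ⟨hs0.le, by linarith⟩
      rw [abs_le] at bs
      have hcv : 0 ≤ c * (v - s) := mul_nonneg hc0 (by linarith)
      have hcuv : c * v - ε / 2 ≤ c * u := by
        have := mul_le_mul_of_nonneg_left huv' hc0
        rw [mul_sub] at this
        linarith
      have hcuv' : c * u ≤ c * v := mul_le_mul_of_nonneg_left huv hc0
      rcases lt_or_ge u 0 with h0 | h0
      · have e1 : F Y u = 0 := by
          simp only [hF]
          have : ⌊u * Y⌋₊ = 0 := Nat.floor_eq_zero.mpr (by nlinarith)
          simp [piAP, primesAP, this]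
        have e2 : 0 ≤ F Y s := mul_nonneg hwY (piAP_nonneg _ _)
        rw [max_eq_left (by linarith), zero_sub, abs_neg, abs_of_nonneg hcv]
        have hcu0 : c * u ≤ 0 := mul_nonpos_of_nonneg_of_nonpos hc0 h0.le
        have hcs0 : 0 ≤ c * s := mul_nonneg hc0 hs0.le
        rw [mul_sub]
        linarith
      · have bu := hu u ⟨h0, by linarith⟩
        rw [abs_le] at bu
        have h3 : |(F Y u - F Y s) - c * (v - s)| ≤ ε := by
          rw [abs_le, mul_sub]; constructor <;> linarith
        rw [abs_le] at h3 ⊢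
        rcases le_total (F Y u - F Y s) 0 with h4 | h4
        · rw [max_eq_left h4]; constructor <;> linarith
        · rw [max_eq_right h4]; exact h3)
  rw [intervalIntegral.integral_const_mul, main_integral κ hκ] at this
  rw [sq c, mul_assoc]
  refine this.congr' ?_
  filter_upwards [eventually_gt_atTop 0] with Y hY
  unfold pairSet
  rw [Finset.card_sigma, Real.sqrt_sq hY.le, ← Finset.mul_sum]
  push_cast
  ring


lemma pairSet_tendsto_x {p : ℕ} [hp : Fact p.Prime] {a : ZMod p} (ha : IsUnit a) (κ d : ℝ) (hκ : 1 < κ)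
    (hd : 0 ≤ d) :
    Tendsto (fun x : ℝ => Real.log x ^ 2 / x * ((pairSet a κ d (x / p)).card : ℝ)) atTop
      (nhds (2 * (1 / ((p : ℝ) * ((p:ℝ) - 1) ^ 2) * Real.log κ))) := by
  have hp0 : (0:ℝ) < p := by exact_mod_cast hp.out.pos
  have hp1 : (0:ℝ) < (p:ℝ) - 1 := by
    have : (1:ℝ) < p := by exact_mod_cast hp.out.one_lt
    linarith
  have hY : Tendsto (fun x : ℝ => Real.sqrt (x / p)) atTop atTop :=
    Real.tendsto_sqrt_atTop.comp (tendsto_id.atTop_div_const hp0)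
  have h1 := (pairSet_tendsto ha κ d hκ hd).comp hY
  have h2 := ((log_ratio_tendsto (1/p) (by positivity)).pow 2).const_mul (4 / (p:ℝ))
  have h3 := h2.mul h1
  have htot : (p.totient : ℝ) = p - 1 := by
    rw [Nat.totient_prime hp.out, Nat.cast_sub hp.out.one_le]; simp
  rw [htot] at h3
  have e : (4 / (p:ℝ) * 1 ^ 2 * (((p:ℝ) - 1)⁻¹ ^ 2 * (Real.log κ / 2))) =
    2 * (1 / ((p : ℝ) * ((p:ℝ) - 1) ^ 2) * Real.log κ) := by field_simp; ring
  rw [e] at h3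
  refine h3.congr' ?_
  filter_upwards [eventually_gt_atTop 0, (tendsto_id.atTop_div_const hp0).eventually_gt_atTop 1] with x hx hx1
  simp only [id] at hx1
  have hl := Real.log_pos hx1
  simp only [Function.comp]
  rw [Real.sq_sqrt (by positivity), Real.log_sqrt (by positivity), div_pow _ (Real.sqrt _),
    Real.sq_sqrt (by positivity), one_div_mul_eq_div]
  field_simp
  ring

lemma log_le_two_sqrt (Y : ℝ) (hY : 0 < Y) : Real.log Y ≤ 2 * Real.sqrt Y - 2 := by
  have h := Real.log_le_sub_one_of_pos (Real.sqrt_pos.mpr hY)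
  rw [Real.log_sqrt hY.le] at h
  linarith

lemma pi_le_five (Y : ℝ) (hY : 1 < Y) : (Nat.primeCounting ⌊Y⌋₊ : ℝ) ≤ 5 * Y / Real.log Y := by
  have h := Chebyshev.pi_le_log4_mul_div hY
  have hl := Real.log_pos hY
  have h4 : Real.log 4 < 1.4 := by
    rw [show (4:ℝ) = 2 ^ 2 by norm_num, Real.log_pow]
    have := Real.log_two_lt_d9
    push_cast; linarith
  rw [Real.log_sqrt (by linarith)] at h
  refine h.trans ?_
  have hs := log_le_two_sqrt Y (by linarith)
  have hsp := Real.sqrt_pos.mpr (show 0 < Y by linarith)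
  rw [le_div_iff₀ hl, add_mul]
  have e : Real.log 4 * Y / (Real.log Y / 2) * Real.log Y = 2 * Real.log 4 * Y := by field_simp
  rw [e]
  have : Real.sqrt Y * Real.log Y ≤ 2 * Y := by
    have := Real.mul_self_sqrt (show 0 ≤ Y by linarith)
    nlinarith
  nlinarith

lemma card_primes_le (Y : ℝ) (hY : 1 < Y) (S : Finset ℕ) (hS : ∀ n ∈ S, n.Prime ∧ (n:ℝ) ≤ Y) :
    (S.card : ℝ) ≤ 5 * Y / Real.log Y := by
  refine le_trans ?_ (pi_le_five Y hY)
  rw [← Nat.primesLE_card_eq_primeCounting]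
  exact_mod_cast Finset.card_le_card fun n hn => by
    rw [Nat.mem_primesLE]
    exact ⟨(Nat.le_floor_iff (by linarith)).mpr (hS n hn).2, (hS n hn).1⟩

lemma sum_div_log_le (Y : ℝ) (hY : 2 ≤ Y) (S : Finset ℕ) (hS : ∀ n ∈ S, n.Prime ∧ (n:ℝ) ≤ Y) :
    ∑ n ∈ S, (n : ℝ) / Real.log n ≤ 16 * Y ^ 2 / Real.log Y ^ 2 := by
  have hY0 : 0 < Y := by linarith
  have hl := Real.log_pos (show 1 < Y by linarith)
  have hs := log_le_two_sqrt Y (by linarith)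
  have hsp := Real.sqrt_pos.mpr hY0
  have hss := Real.mul_self_sqrt hY0.le
  have hl2 := Real.log_two_gt_d9
  rw [← Finset.sum_filter_add_sum_filter_not S (fun n : ℕ => (n:ℝ) ≤ Real.sqrt Y)]
  have h1 : ∑ n ∈ S.filter (fun n : ℕ => (n:ℝ) ≤ Real.sqrt Y), (n : ℝ) / Real.log n ≤
      6 * Y ^ 2 / Real.log Y ^ 2 := by
    have hc : ((S.filter (fun n : ℕ => (n:ℝ) ≤ Real.sqrt Y)).card : ℝ) ≤ Real.sqrt Y := by
      have : S.filter (fun n : ℕ => (n:ℝ) ≤ Real.sqrt Y) ⊆ Finset.Ioc 0 ⌊Real.sqrt Y⌋₊ := by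
        intro n hn
        rw [Finset.mem_filter] at hn
        rw [Finset.mem_Ioc]
        exact ⟨(hS n hn.1).1.pos, (Nat.le_floor_iff hsp.le).mpr hn.2⟩
      have h := Finset.card_le_card this
      rw [Nat.card_Ioc] at h
      calc _ ≤ ((⌊Real.sqrt Y⌋₊ - 0 : ℕ) : ℝ) := by exact_mod_cast h
        _ ≤ _ := by simpa using Nat.floor_le hsp.le
    calc _ ≤ ∑ n ∈ S.filter (fun n : ℕ => (n:ℝ) ≤ Real.sqrt Y), Real.sqrt Y / Real.log 2 := by
          refine Finset.sum_le_sum fun n hn => ?_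
          rw [Finset.mem_filter] at hn
          have := (hS n hn.1).1.two_le
          gcongr
          · exact hn.2
          · exact_mod_cast this
      _ = (S.filter (fun n : ℕ => (n:ℝ) ≤ Real.sqrt Y)).card * (Real.sqrt Y / Real.log 2) := by simp
      _ ≤ Real.sqrt Y * (Real.sqrt Y / Real.log 2) := by gcongr
      _ = Y / Real.log 2 := by rw [← mul_div_assoc, hss]
      _ ≤ 6 * Y ^ 2 / Real.log Y ^ 2 := by
          rw [div_le_div_iff₀ (by linarith) (by positivity)]
          have : Real.log Y ^ 2 ≤ 4 * Y := by nlinarith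
          nlinarith [mul_pos hY0 hY0]
  have h2 : ∑ n ∈ S.filter (fun n : ℕ => ¬ (n:ℝ) ≤ Real.sqrt Y), (n : ℝ) / Real.log n ≤
      10 * Y ^ 2 / Real.log Y ^ 2 := by
    have hc := card_primes_le Y (by linarith) (S.filter (fun n : ℕ => ¬ (n:ℝ) ≤ Real.sqrt Y))
      fun n hn => hS n (Finset.mem_filter.mp hn).1
    calc _ ≤ ∑ n ∈ S.filter (fun n : ℕ => ¬ (n:ℝ) ≤ Real.sqrt Y), Y / (Real.log Y / 2) := by
          refine Finset.sum_le_sum fun n hn => ?_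
          rw [Finset.mem_filter, not_le] at hn
          have : Real.log Y / 2 ≤ Real.log n := by
            rw [← Real.log_sqrt hY0.le]
            exact Real.log_le_log hsp hn.2.le
          gcongr
          exact (hS n hn.1).2
      _ = (S.filter (fun n : ℕ => ¬ (n:ℝ) ≤ Real.sqrt Y)).card * (Y / (Real.log Y / 2)) := by simp
      _ ≤ 5 * Y / Real.log Y * (Y / (Real.log Y / 2)) := by gcongr
      _ = _ := by field_simp; ring
  calc _ ≤ _ := add_le_add h1 h2
    _ = _ := by ring

/-- Primes in short intervals, via binomial coefficients. -/
lemma primes_short (q M : ℕ) (hq : 1 ≤ q) (hM : 0 < M) (S : Finset ℕ)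
    (hS : ∀ r ∈ S, r.Prime ∧ q < r ∧ r ≤ q + M) (hMq : M ≤ q) :
    (S.card : ℝ) * Real.log q ≤ M * (1 + Real.log ((q + M) / M)) := by
  have hdvd : (∏ r ∈ S, r) ∣ (q + M).choose M := by
    refine Finset.prod_primes_dvd _ (fun r hr => (hS r hr).1.prime) fun r hr => ?_
    obtain ⟨h1, h2, h3⟩ := hS r hr
    have hd : r ∣ (q + M).choose M * M.factorial * q.factorial := by
      have := Nat.choose_mul_factorial_mul_factorial (show M ≤ q + M by omega)
      rw [Nat.add_sub_cancel] at this
      rw [this]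
      exact (h1.dvd_factorial).mpr h3
    rcases (h1.dvd_mul).mp hd with h | h
    · rcases (h1.dvd_mul).mp h with h | h
      · exact h
      · have := (h1.dvd_factorial).mp h; omega
    · have := (h1.dvd_factorial).mp h; omega
  have hle : q ^ S.card ≤ (q + M).choose M := by
    calc q ^ S.card = ∏ r ∈ S, q := by simp
      _ ≤ ∏ r ∈ S, r := Finset.prod_le_prod' fun r hr => (hS r hr).2.1.le
      _ ≤ _ := Nat.le_of_dvd (Nat.choose_pos (by omega)) hdvd
  have hM0 : (0:ℝ) < M := by exact_mod_cast hM
  have hq0 : (0:ℝ) < q := by exact_mod_cast hq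
  have hb : (q:ℝ) ^ S.card ≤ (((q:ℝ) + M) / M) ^ M * Real.exp M := by
    calc (q:ℝ) ^ S.card ≤ ((q + M).choose M : ℝ) := by exact_mod_cast hle
      _ ≤ ((q + M : ℕ) : ℝ) ^ M / (M.factorial : ℝ) := Nat.choose_le_pow_div M (q + M)
      _ = (((q:ℝ) + M) / M) ^ M * ((M:ℝ) ^ M / M.factorial) := by
          push_cast; rw [div_pow]; field_simp
      _ ≤ _ := by
          gcongr
          exact Real.pow_div_factorial_le_exp _ hM0.le _
  have := Real.log_le_log (by positivity) hb
  rw [Real.log_pow, Real.log_mul (by positivity) (by positivity), Real.log_pow, Real.log_exp] at this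
  linarith


lemma fiber_bound (p q : ℕ) (hp : 3 ≤ p) (hpq : p < q) (S : Finset ℕ)
    (hS : ∀ r ∈ S, r.Prime ∧ q < r ∧ (p - 2) * r ≤ (p - 1) * q) :
    (S.card : ℝ) ≤ (1 + Real.log (2 * p)) / ((p:ℝ) - 2) * (q / Real.log q) := by
  obtain ⟨k, rfl⟩ : ∃ k, p = k + 2 := ⟨p - 2, by omega⟩
  have hk : 1 ≤ k := by omega
  have hk0 : (0:ℝ) < k := by exact_mod_cast hk
  set M := q / k with hM
  have hM1 : 1 ≤ M := (Nat.le_div_iff_mul_le hk).mpr (by omega)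
  have hMk : M * k ≤ q := Nat.div_mul_le_self q k
  have hMk2 : q < M * k + k := by
    have := Nat.lt_div_mul_add (a := q) hk
    exact this
  have hMq : M ≤ q := Nat.div_le_self q k
  have hM0 : (0:ℝ) < M := by exact_mod_cast hM1
  have hq1 : (1:ℝ) < q := by exact_mod_cast (by omega : 1 < q)
  have hlq := Real.log_pos hq1
  have h := primes_short q M (by omega) hM1 S (by
    intro r hr
    obtain ⟨h1, h2, h3⟩ := hS r hr
    refine ⟨h1, h2, ?_⟩
    have h4 : k * r ≤ (k + 1) * q := by simpa using h3
    have h5 : (r - q) * k ≤ q := by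
      rw [Nat.sub_mul, mul_comm r k, mul_comm q k, Nat.sub_le_iff_le_add]
      linarith
    have := (Nat.le_div_iff_mul_le hk).mpr h5
    omega) hMq
  have hr : ((q:ℝ) + M) / M ≤ 2 * ((k + 2 : ℕ) : ℝ) := by
    rw [div_le_iff₀ hM0]
    have e1 : (q:ℝ) < M * k + k := by exact_mod_cast hMk2
    have e2 : (1:ℝ) ≤ M := by exact_mod_cast hM1
    push_cast
    nlinarith
  have hlog : Real.log (((q:ℝ) + M) / M) ≤ Real.log (2 * ((k + 2 : ℕ) : ℝ)) :=
    Real.log_le_log (by positivity) hr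
  have hlog0 : 0 ≤ Real.log (2 * ((k + 2 : ℕ) : ℝ)) := Real.log_nonneg (by push_cast; linarith)
  have hMle : (M:ℝ) ≤ q / k := by
    rw [le_div_iff₀ hk0]; exact_mod_cast hMk
  have hfin : (S.card : ℝ) * Real.log q ≤ q / k * (1 + Real.log (2 * ((k + 2 : ℕ) : ℝ))) := by
    refine h.trans ?_
    have h0 : 0 ≤ Real.log (((q:ℝ) + M) / M) := Real.log_nonneg (by
      rw [le_div_iff₀ hM0]; linarith)
    have h0' : 0 ≤ 1 + Real.log (((q:ℝ) + M) / M) := by linarith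
    gcongr
  rw [show (((k + 2 : ℕ) : ℝ) - 2) = k by push_cast; ring]
  rw [div_mul_div_comm, le_div_iff₀ (by positivity)]
  calc (S.card : ℝ) * (k * Real.log q) = (S.card * Real.log q) * k := by ring
    _ ≤ (q / k * (1 + Real.log (2 * ((k + 2 : ℕ) : ℝ)))) * k := by gcongr
    _ = _ := by field_simp

/-- Dominating sequence. -/
noncomputable def bdom (p : ℕ) : ℝ := 144 * (1 + Real.log (2 * p)) / (p * ((p:ℝ) - 2))

lemma tail_bound (p : ℕ) (hp : 3 ≤ p) (x : ℝ) (T : Finset (ℕ × ℕ))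
    (hT : ∀ t ∈ T, t.1.Prime ∧ t.2.Prime ∧ p < t.1 ∧ t.1 < t.2 ∧
      (p - 2) * t.2 ≤ (p - 1) * t.1 ∧ ((p * t.1 * t.2 : ℕ) : ℝ) ≤ x) :
    Real.log x ^ 2 / x * (T.card : ℝ) ≤ bdom p := by
  have hp3 : (3:ℝ) ≤ p := by exact_mod_cast hp
  have hlp : 0 ≤ Real.log (2 * (p:ℝ)) := Real.log_nonneg (by linarith)
  rcases T.eq_empty_or_nonempty with rfl | ⟨t₀, ht₀⟩
  · simp only [Finset.card_empty, Nat.cast_zero, mul_zero, bdom]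
    apply div_nonneg (by positivity)
    nlinarith
  have hp0 : (0:ℝ) < p := by linarith
  have hpx : (p:ℝ) ^ 3 ≤ x := by
    obtain ⟨_, _, h3, h4, _, h6⟩ := hT t₀ ht₀
    refine le_trans ?_ h6
    have : p ^ 3 ≤ p * t₀.1 * t₀.2 := by
      calc p ^ 3 = p * p * p := by ring
        _ ≤ _ := by gcongr; omega
    exact_mod_cast this
  have hx0 : 0 < x := lt_of_lt_of_le (by positivity) hpx
  set Y := Real.sqrt (x / p) with hY
  have hYsq : Y ^ 2 = x / p := Real.sq_sqrt (by positivity)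
  have hpY : (p:ℝ) ≤ Y := by
    apply Real.le_sqrt_of_sq_le
    rw [le_div_iff₀ hp0]; linarith
  have hY1 : 1 < Y := by linarith
  have hlY := Real.log_pos hY1
  have hlx : Real.log x ≤ 3 * Real.log Y := by
    have e1 : Real.log x = Real.log p + 2 * Real.log Y := by
      have : x = p * Y ^ 2 := by rw [hYsq]; field_simp
      rw [this, Real.log_mul (by positivity) (by positivity), Real.log_pow]; push_cast; ring
    have := Real.log_le_log hp0 hpY
    linarith
  have hlx0 : 0 ≤ Real.log x := Real.log_nonneg (by nlinarith [pow_le_pow_left₀ (by norm_num) hp3 3])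
  have hqY : ∀ t ∈ T, (t.1 : ℝ) ≤ Y := by
    intro t ht
    obtain ⟨_, _, _, h4, _, h6⟩ := hT t ht
    apply Real.le_sqrt_of_sq_le
    rw [le_div_iff₀ hp0]
    refine le_trans ?_ h6
    have : t.1 ^ 2 * p ≤ p * t.1 * t.2 := by
      calc t.1 ^ 2 * p = p * t.1 * t.1 := by ring
        _ ≤ _ := by gcongr
    exact_mod_cast this
  have hcard : (T.card : ℝ) ≤ (1 + Real.log (2 * p)) / ((p:ℝ) - 2) * (16 * Y ^ 2 / Real.log Y ^ 2) := by
    have hfib := Finset.card_eq_sum_card_image Prod.fst T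
    calc (T.card : ℝ) = ∑ q ∈ T.image Prod.fst, ((T.filter fun t => t.1 = q).card : ℝ) := by
          rw [hfib]; push_cast; rfl
      _ ≤ ∑ q ∈ T.image Prod.fst, (1 + Real.log (2 * p)) / ((p:ℝ) - 2) * (q / Real.log q) := by
          refine Finset.sum_le_sum fun q hq => ?_
          obtain ⟨t, ht, rfl⟩ := Finset.mem_image.mp hq
          have hinj : ((T.filter fun s => s.1 = t.1).image Prod.snd).card =
              (T.filter fun s => s.1 = t.1).card := by
            apply Finset.card_image_of_injOn
            intro u hu v hv huv
            simp only [Finset.coe_filter, Set.mem_ofPred_eq] at hu hv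
            exact Prod.ext (hu.2.trans hv.2.symm) huv
          rw [← hinj]
          refine fiber_bound p t.1 hp (hT t ht).2.2.1 _ fun r hr => ?_
          obtain ⟨u, hu, rfl⟩ := Finset.mem_image.mp hr
          obtain ⟨hu1, hu2⟩ := Finset.mem_filter.mp hu
          obtain ⟨_, h2, _, h4, h5, _⟩ := hT u hu1
          rw [← hu2]
          exact ⟨h2, h4, h5⟩
      _ = (1 + Real.log (2 * p)) / ((p:ℝ) - 2) * ∑ q ∈ T.image Prod.fst, ((q:ℝ) / Real.log q) := by
          rw [Finset.mul_sum]
      _ ≤ _ := by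
          apply mul_le_mul_of_nonneg_left
          · refine sum_div_log_le Y (by linarith) _ fun n hn => ?_
            obtain ⟨t, ht, rfl⟩ := Finset.mem_image.mp hn
            exact ⟨(hT t ht).1, hqY t ht⟩
          · exact div_nonneg (by linarith) (by linarith)
  have hp2 : (0:ℝ) < (p:ℝ) - 2 := by linarith
  calc Real.log x ^ 2 / x * (T.card : ℝ)
      ≤ (3 * Real.log Y) ^ 2 / x * ((1 + Real.log (2 * p)) / ((p:ℝ) - 2) * (16 * Y ^ 2 / Real.log Y ^ 2)) := by
        gcongr
    _ = bdom p := by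
        rw [hYsq, bdom]; field_simp; ring

lemma bdom_summable : Summable fun p : {p : ℕ // p.Prime ∧ 3 ≤ p} => bdom p.1 := by
  have hs : Summable fun n : ℕ => 1300 * (1 / (n:ℝ) ^ (3/2 : ℝ)) :=
    ((Real.summable_one_div_nat_rpow (p := 3/2)).mpr (by norm_num)).mul_left _
  refine Summable.of_nonneg_of_le ?_ ?_ (hs.comp_injective (Subtype.val_injective (p := fun p : ℕ => p.Prime ∧ 3 ≤ p)))
  · rintro ⟨p, hp, hp3⟩
    have hp3' : (3:ℝ) ≤ p := by exact_mod_cast hp3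
    have hlp : 0 ≤ Real.log (2 * (p:ℝ)) := Real.log_nonneg (by linarith)
    apply div_nonneg (by positivity)
    simp only; nlinarith
  · rintro ⟨p, hp, hp3⟩
    have hp3' : (3:ℝ) ≤ p := by exact_mod_cast hp3
    have hp0 : (0:ℝ) < p := by linarith
    have h1 := log_le_two_sqrt (2 * p) (by linarith)
    have h2 : Real.sqrt (2 * p) ≤ 1.5 * Real.sqrt p := by
      rw [Real.sqrt_mul (by norm_num)]
      gcongr
      rw [Real.sqrt_le_left (by norm_num)]; norm_num
    simp only [Function.comp, bdom]
    have e : (p:ℝ) ^ (3/2 : ℝ) = p * Real.sqrt p := by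
      rw [show (3/2:ℝ) = 1 + 1/2 by norm_num, Real.rpow_add hp0, Real.rpow_one, Real.sqrt_eq_rpow]
    have hsp := Real.sqrt_pos.mpr hp0
    have hss := Real.mul_self_sqrt hp0.le
    rw [e, mul_one_div, div_le_div_iff₀ (by nlinarith) (by positivity)]
    have h3 : (1 + Real.log (2 * p)) ≤ 3 * Real.sqrt p := by linarith
    calc 144 * (1 + Real.log (2 * p)) * (p * Real.sqrt p) ≤ 144 * (3 * Real.sqrt p) * (p * Real.sqrt p) := by gcongr
      _ = 432 * p * (Real.sqrt p * Real.sqrt p) := by ring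
      _ = 432 * p * p := by rw [hss]
      _ ≤ _ := by nlinarith


/-- Coefficients extended by zero to the integers. -/
noncomputable def ext0 (f : ℤ[X]) (m : ℤ) : ℤ := if 0 ≤ m then f.coeff m.toNat else 0

lemma ext0_X_pow_mul (f : ℤ[X]) (N : ℕ) (m : ℤ) : ext0 (X ^ N * f) m = ext0 f (m - N) := by
  unfold ext0
  by_cases h : 0 ≤ m
  · rw [if_pos h, coeff_X_pow_mul']
    by_cases h2 : N ≤ m.toNat
    · rw [if_pos h2, if_pos (by omega)]
      congr 1; omega
    · rw [if_neg h2, if_neg (by omega)]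
  · rw [if_neg h, if_neg (by omega)]

lemma ext0_sub (f g : ℤ[X]) (m : ℤ) : ext0 (f - g) m = ext0 f m - ext0 g m := by
  unfold ext0; split_ifs <;> simp

lemma ext0_sum {ι : Type*} (s : Finset ι) (f : ι → ℤ[X]) (m : ℤ) :
    ext0 (∑ i ∈ s, f i) m = ∑ i ∈ s, ext0 (f i) m := by
  unfold ext0; split_ifs <;> simp

lemma ext0_one (m : ℤ) : ext0 1 m = if m = 0 then 1 else 0 := by
  unfold ext0
  by_cases h : 0 ≤ m
  · rw [if_pos h, coeff_one]
    congr 1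
    simp only [eq_iff_iff]; omega
  · rw [if_neg h, if_neg (by omega)]

lemma ext0_neg (f : ℤ[X]) (m : ℤ) (hm : m < 0) : ext0 f m = 0 := if_neg (by omega)

lemma expand_cyc_prime (p r : ℕ) (hp : p.Prime) :
    expand ℤ r (cyclotomic p ℤ) = ∑ j ∈ Finset.range p, X ^ (j * r) := by
  have := Fact.mk hp
  rw [cyclotomic_prime, map_sum]
  refine Finset.sum_congr rfl fun j _ => ?_
  rw [map_pow, expand_X, ← pow_mul, mul_comm]

lemma cyc_pq (p q : ℕ) (hp : p.Prime) (hq : q.Prime) (hpq : p < q) :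
    cyclotomic (p * q) ℤ * (X ^ p - 1) = (X - 1) * ∑ j ∈ Finset.range p, X ^ (j * q) := by
  have hnd : ¬ q ∣ p := fun h => by
    have := Nat.le_of_dvd hp.pos h; omega
  have h1 := cyclotomic_expand_eq_cyclotomic_mul hq hnd ℤ
  rw [← expand_cyc_prime p q hp, h1]
  have := Fact.mk hp
  have h2 := cyclotomic_prime_mul_X_sub_one ℤ p
  rw [← h2]; ring

lemma invCyc_eq (p q r : ℕ) (hp : p.Prime) (hq : q.Prime) (hr : r.Prime) (hpq : p < q) (hqr : q < r) :
    invCyclotomic (p * q * r) = (X ^ (q * r) - 1) *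
      (cyclotomic (p * q) ℤ * ∑ j ∈ Finset.range p, X ^ (j * r)) := by
  have hnd : ¬ q ∣ p := fun h => by
    have := Nat.le_of_dvd hp.pos h; omega
  have hnd2 : ¬ r ∣ p * q := fun h => by
    rcases (hr.dvd_mul).mp h with h | h
    · have := Nat.le_of_dvd hp.pos h; omega
    · have := Nat.le_of_dvd hq.pos h; omega
  have h1 := cyclotomic_expand_eq_cyclotomic_mul hq hnd ℤ
  have h2 := cyclotomic_expand_eq_cyclotomic_mul hr hnd2 ℤ
  have := Fact.mk hp
  have h3 := cyclotomic_prime_mul_X_sub_one ℤ p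
  have h4 : (X ^ (p * q * r) - 1 : ℤ[X]) = cyclotomic (p * q * r) ℤ * ((X ^ (q * r) - 1) *
      (cyclotomic (p * q) ℤ * ∑ j ∈ Finset.range p, X ^ (j * r))) := by
    have e : (X ^ (p * q * r) - 1 : ℤ[X]) = expand ℤ r (expand ℤ q (X ^ p - 1)) := by
      simp only [map_sub, map_pow, expand_X, map_one, ← pow_mul]
      congr 2; ring
    rw [e, ← h3, map_mul, map_mul, h1, map_mul, h2, expand_cyc_prime p r hp]
    simp only [map_sub, map_pow, expand_X, map_one, ← pow_mul]
    rw [mul_comm r q]; ring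
  unfold invCyclotomic
  rw [h4, mul_divByMonic_cancel_left _ (cyclotomic.monic _ ℤ)]

lemma coeff_invCyc (p q r : ℕ) (hp : p.Prime) (hq : q.Prime) (hr : r.Prime) (hpq : p < q) (hqr : q < r)
    (k : ℤ) : ext0 (invCyclotomic (p * q * r)) k = ∑ j ∈ Finset.range p,
      (ext0 (cyclotomic (p * q) ℤ) (k - (q + j) * r) - ext0 (cyclotomic (p * q) ℤ) (k - j * r)) := by
  rw [invCyc_eq p q r hp hq hr hpq hqr]
  have e : (X ^ (q * r) - 1) * (cyclotomic (p * q) ℤ * ∑ j ∈ Finset.range p, X ^ (j * r)) =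
    ∑ j ∈ Finset.range p, (X ^ ((q + j) * r) * cyclotomic (p * q) ℤ -
      X ^ (j * r) * cyclotomic (p * q) ℤ) := by
    rw [Finset.mul_sum, Finset.mul_sum]
    refine Finset.sum_congr rfl fun j _ => ?_
    rw [add_mul, pow_add]; ring
  rw [e, ext0_sum]
  refine Finset.sum_congr rfl fun j _ => ?_
  rw [ext0_sub, ext0_X_pow_mul, ext0_X_pow_mul]
  push_cast; rfl

/-- semigroup indicator -/
def semi (p q v : ℤ) (m : ℤ) : ℤ := if (m * v) % p * q ≤ m then 1 else 0

lemma J_mod (p q v m : ℤ) (hv : q * v ≡ 1 [ZMOD p]) : (m * v) % p * q ≡ m [ZMOD p] := by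
  calc (m * v) % p * q ≡ (m * v) * q [ZMOD p] := (Int.mod_modEq _ _).mul_right _
    _ = m * (q * v) := by ring
    _ ≡ m * 1 [ZMOD p] := hv.mul_left _
    _ = m := by ring

lemma semi_rec (p q v : ℤ) (hp : 0 < p) (hv : q * v ≡ 1 [ZMOD p]) (m : ℤ) :
    semi p q v m - semi p q v (m - p) = if m = (m * v) % p * q then 1 else 0 := by
  have hJ : ((m - p) * v) % p = (m * v) % p := by
    rw [sub_mul, Int.sub_mul_emod_self_left]
  unfold semi
  rw [hJ]
  have h := J_mod p q v m hv
  set t := (m * v) % p * q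
  obtain ⟨c, hc⟩ := h.dvd
  have hcc : m = t + p * c := by linarith
  rcases lt_trichotomy c 0 with h0 | h0 | h0
  · have : p * c < 0 := mul_neg_of_pos_of_neg hp h0
    rw [if_neg (by linarith), if_neg (by linarith), if_neg (by intro h; linarith)]; rfl
  · subst h0
    rw [if_pos (by linarith), if_neg (by linarith), if_pos (by linarith)]; rfl
  · have : p * 1 ≤ p * c := mul_le_mul_of_nonneg_left (by omega) hp.le
    rw [if_pos (by linarith), if_pos (by linarith), if_neg (by intro h; linarith)]; rfl

lemma cyc_pq_coeff (p q : ℕ) (v : ℤ) (hp : p.Prime) (hq : q.Prime) (hpq : p < q)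
    (hv : (q:ℤ) * v ≡ 1 [ZMOD p]) (m : ℤ) :
    ext0 (cyclotomic (p * q) ℤ) m = semi p q v m - semi p q v (m - 1) := by
  set a := ext0 (cyclotomic (p * q) ℤ) with ha
  have hp0 : (0:ℤ) < p := by exact_mod_cast hp.pos
  have hq0 : (0:ℤ) < q := by exact_mod_cast hq.pos
  have hsum : ∀ m : ℤ, ext0 (∑ j ∈ Finset.range p, X ^ (j * q)) m =
      if m = (m * v) % p * q then 1 else 0 := by
    intro m
    have h1 : ∀ j : ℕ, ext0 (X ^ (j * q)) m = if m = j * q then 1 else 0 := by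
      intro j
      have := ext0_X_pow_mul 1 (j * q) m
      rw [mul_one] at this
      rw [this, ext0_one]
      congr 1
      simp only [eq_iff_iff]; push_cast
      exact sub_eq_zero
    rw [ext0_sum]
    simp_rw [h1]
    have hJ0 : 0 ≤ (m * v) % p := Int.emod_nonneg _ hp0.ne'
    have hJ1 : (m * v) % p < p := Int.emod_lt_of_pos _ hp0
    by_cases h : m = (m * v) % p * q
    · rw [if_pos h]
      rw [Finset.sum_eq_single ((m * v) % p).toNat]
      · rw [if_pos]; rw [Int.toNat_of_nonneg hJ0]; exact h
      · intro b hb hne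
        rw [if_neg]
        intro hm
        have : (b : ℤ) * q = (m * v) % p * q := by rw [← hm]; exact h
        have := mul_right_cancel₀ hq0.ne' this
        apply hne; omega
      · intro hh; exfalso; apply hh; rw [Finset.mem_range]; omega
    · rw [if_neg h]
      refine Finset.sum_eq_zero fun j hj => ?_
      rw [if_neg]
      intro hm
      apply h
      have hj' := Finset.mem_range.mp hj
      have : (m * v) % p = j := by
        have h2 : m * v ≡ j [ZMOD p] := by
          calc m * v = j * (q * v) := by rw [hm]; ring
            _ ≡ j * 1 [ZMOD p] := hv.mul_left _
            _ = j := mul_one _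
        rw [h2, Int.emod_eq_of_lt (by omega) (by omega)]
      rw [this]; exact hm
  have hrec : ∀ m, a m = a (m - p) + (semi p q v m - semi p q v (m - p)) -
      (semi p q v (m - 1) - semi p q v (m - 1 - p)) := by
    intro m
    have h := congrArg (fun f => ext0 f m) (cyc_pq p q hp hq hpq)
    have e1 : cyclotomic (p * q) ℤ * (X ^ p - 1) =
      X ^ p * cyclotomic (p * q) ℤ - cyclotomic (p * q) ℤ := by ring
    have e2 : (X - 1 : ℤ[X]) * ∑ j ∈ Finset.range p, X ^ (j * q) =
      X ^ 1 * ∑ j ∈ Finset.range p, X ^ (j * q) - ∑ j ∈ Finset.range p, X ^ (j * q) := by ring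
    rw [e1, e2, ext0_sub, ext0_sub, ext0_X_pow_mul, ext0_X_pow_mul, hsum, hsum] at h
    rw [semi_rec p q v hp0 hv, semi_rec p q v hp0 hv]
    push_cast at h
    linarith
  have hsneg : ∀ m : ℤ, m < 0 → semi p q v m = 0 := by
    intro m hm
    unfold semi
    rw [if_neg]
    have hJ0 : 0 ≤ (m * v) % p := Int.emod_nonneg _ hp0.ne'
    have := mul_nonneg hJ0 hq0.le
    linarith
  have hind : ∀ N : ℕ, ∀ m : ℤ, m < N * p → a m = semi p q v m - semi p q v (m - 1) := by
    intro N
    induction N with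
    | zero =>
      intro m hm
      have hm' : m < 0 := by simpa using hm
      rw [hsneg m hm', hsneg _ (by linarith)]
      exact ext0_neg _ _ hm'
    | succ N ih =>
      intro m hm
      rw [hrec, ih (m - p) (by push_cast at hm; linarith)]
      rw [show m - p - 1 = m - 1 - p by ring]
      ring
  refine hind (m.toNat + 1) m ?_
  have : m < (m.toNat + 1 : ℕ) := by omega
  nlinarith


lemma J_pred (p v m : ℤ) (hp : 0 < p) (hv0 : 0 < v) (hv1 : v < p) :
    ((m - 1) * v) % p = if v ≤ (m * v) % p then (m * v) % p - v else (m * v) % p - v + p := by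
  have hJ0 : 0 ≤ (m * v) % p := Int.emod_nonneg _ hp.ne'
  have hJ1 : (m * v) % p < p := Int.emod_lt_of_pos _ hp
  have h1 : (m - 1) * v ≡ (m * v) % p - v [ZMOD p] := by
    calc (m - 1) * v = m * v - v := by ring
      _ ≡ (m * v) % p - v [ZMOD p] := (Int.mod_modEq _ _).symm.sub_right _
  split_ifs with h
  · rw [h1, Int.emod_eq_of_lt (by omega) (by omega)]
  · have h2 : (m - 1) * v ≡ (m * v) % p - v + p [ZMOD p] := by
      refine h1.trans ?_
      simp [Int.ModEq]
    rw [h2, Int.emod_eq_of_lt (by omega) (by omega)]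

section
variable {p q v : ℤ} (hp : 0 < p) (hq : 0 < q) (hv0 : 0 < v) (hv1 : v < p)
  (hv : q * v ≡ 1 [ZMOD p]) {m : ℤ}

/-- value of the coefficient -/
def aval (p q v m : ℤ) : ℤ := semi p q v m - semi p q v (m - 1)

lemma aval_cases (p q v m : ℤ) : aval p q v m = 1 ∨ aval p q v m = 0 ∨ aval p q v m = -1 := by
  unfold aval semi; split_ifs <;> simp

lemma aval_one_iff (hp : 0 < p) (hq : 0 < q) (hv0 : 0 < v) (hv1 : v < p) :
    aval p q v m = 1 ↔ (m * v) % p < v ∧ (m * v) % p * q ≤ m ∧ m ≤ ((m * v) % p + p - v) * q := by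
  unfold aval semi
  rw [J_pred p v m hp hv0 hv1]
  set j := (m * v) % p
  by_cases h : v ≤ j
  · rw [if_pos h]
    have : (j - v) * q ≤ j * q - 1 := by nlinarith
    constructor
    · intro hh
      exfalso
      by_cases h1 : j * q ≤ m
      · rw [if_pos h1, if_pos (by linarith)] at hh; norm_num at hh
      · rw [if_neg h1] at hh; split_ifs at hh <;> norm_num at hh
    · intro hh; omega
  · rw [if_neg h]
    rw [show j - v + p = j + p - v by ring]
    constructor
    · intro hh
      refine ⟨by omega, ?_⟩
      split_ifs at hh with h1 h2 h2
      · norm_num at hh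
      · exact ⟨h1, by linarith⟩
      · norm_num at hh
      · norm_num at hh
    · rintro ⟨_, h1, h2⟩
      rw [if_pos h1, if_neg (by linarith)]; norm_num

lemma aval_neg_one_iff (hp : 0 < p) (hq : 0 < q) (hv0 : 0 < v) (hv1 : v < p) :
    aval p q v m = -1 ↔ v ≤ (m * v) % p ∧ m < (m * v) % p * q ∧ ((m * v) % p - v) * q + 1 ≤ m := by
  unfold aval semi
  rw [J_pred p v m hp hv0 hv1]
  set j := (m * v) % p
  by_cases h : v ≤ j
  · rw [if_pos h]
    constructor
    · intro hh
      refine ⟨h, ?_⟩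
      split_ifs at hh with h1 h2 h2
      · norm_num at hh
      · norm_num at hh
      · exact ⟨by linarith, by linarith⟩
      · norm_num at hh
    · rintro ⟨_, h1, h2⟩
      rw [if_neg (by linarith), if_pos (by linarith)]; norm_num
  · rw [if_neg h]
    have : j * q ≤ (j - v + p) * q := by nlinarith
    constructor
    · intro hh
      exfalso
      by_cases h1 : j * q ≤ m
      · rw [if_pos h1] at hh; split_ifs at hh <;> norm_num at hh
      · rw [if_neg h1, if_neg (by linarith)] at hh; norm_num at hh
    · intro hh; omega

lemma aval_support (hp : 0 < p) (hq : 0 < q) (hv0 : 0 < v) (hv1 : v < p) (h : aval p q v m ≠ 0) :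
    0 ≤ m ∧ m ≤ (p - 1) * q := by
  have hJ0 : 0 ≤ (m * v) % p := Int.emod_nonneg _ hp.ne'
  have hJ1 : (m * v) % p < p := Int.emod_lt_of_pos _ hp
  rcases aval_cases p q v m with h1 | h1 | h1
  · obtain ⟨h2, h3, h4⟩ := (aval_one_iff hp hq hv0 hv1).mp h1
    set j := (m * v) % p
    exact ⟨by nlinarith, by nlinarith⟩
  · exact absurd h1 h
  · obtain ⟨h2, h3, h4⟩ := (aval_neg_one_iff hp hq hv0 hv1).mp h1
    set j := (m * v) % p
    exact ⟨by nlinarith, by nlinarith⟩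
end

/-- strictly increasing integer sequences of full length -/
lemma seq_full (n : ℕ) (j : ℕ → ℤ) (b : ℤ) (hlo : ∀ t < n, b ≤ j t) (hhi : ∀ t < n, j t < b + n)
    (hinc : ∀ t, t + 1 < n → j t < j (t + 1)) : ∀ t < n, j t = b + t := by
  have h1 : ∀ t < n, b + t ≤ j t := by
    intro t
    induction t with
    | zero => intro h; simpa using hlo 0 h
    | succ t ih =>
      intro h
      have := ih (by omega); have := hinc t h
      push_cast; omega
  have h2 : ∀ s, ∀ t, t + s + 1 = n → j t ≤ b + t := by
    intro s
    induction s with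
    | zero => intro t h; have := hhi t (by omega); omega
    | succ s ih =>
      intro t h
      have := ih (t + 1) (by omega); have := hinc t (by omega)
      push_cast at *; omega
  intro t ht
  exact le_antisymm (h2 (n - t - 1) t (by omega)) (h1 t ht)

/-- pigeonhole for the residues -/
lemma J_inj (p : ℕ) (hp : p.Prime) (q v r m : ℤ) (hv : q * v ≡ 1 [ZMOD p]) (hr : ¬ (p:ℤ) ∣ r)
    (lo hi : ℤ) (h : ∀ t < p - 1, lo ≤ ((m + t * r) * v) % p ∧ ((m + t * r) * v) % p < hi) :
    ((p - 1 : ℕ) : ℤ) ≤ hi - lo := by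
  have hcard : (Finset.range (p - 1)).card ≤ (Finset.Ico lo hi).card := by
    refine Finset.card_le_card_of_injOn (fun t : ℕ => ((m + t * r) * v) % p) ?_ ?_
    · intro t ht
      have := h t (by simpa using ht)
      simpa using this
    · intro s hs t ht hst
      have hs' : s < p - 1 := by simpa using hs
      have ht' : t < p - 1 := by simpa using ht
      have h1 : (m + s * r) * v ≡ (m + t * r) * v [ZMOD p] := hst
      have h2 : m + s * r ≡ m + t * r [ZMOD p] := by
        have h3 := h1.mul_left q
        have e : ∀ z : ℤ, q * (z * v) ≡ z [ZMOD p] := fun z => by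
          calc q * (z * v) = z * (q * v) := by ring
            _ ≡ z * 1 [ZMOD p] := hv.mul_left _
            _ = z := mul_one _
        exact (e _).symm.trans (h3.trans (e _))
      have h3 : (p:ℤ) ∣ ((t:ℤ) - s) * r := by
        have := h2.dvd
        have e : m + (t:ℤ) * r - (m + s * r) = (t - s) * r := by ring
        rwa [e] at this
      rcases (Nat.prime_iff_prime_int.mp hp).dvd_or_dvd h3 with h4 | h4
      · have := Int.eq_zero_of_abs_lt_dvd h4 (by rw [abs_lt]; omega)
        omega
      · exact absurd h4 hr
  rw [Finset.card_range, Int.card_Ico] at hcard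
  have := hp.two_le
  omega

lemma window_pos (p : ℕ) (hp : p.Prime) (hp3 : 3 ≤ p) (q v r m : ℤ) (hq : 0 < q) (hv0 : 0 < v) (hv1 : v < p)
    (hv : q * v ≡ 1 [ZMOD p]) (hqr : q < r) (hr : ¬ (p:ℤ) ∣ r)
    (h : ∀ t < p - 1, aval p q v (m + (t:ℤ) * r) = 1) :
    q ≡ -1 [ZMOD p] ∧ r ≡ -1 [ZMOD p] ∧ ((p:ℤ) - 2) * r ≤ (p - 1) * q := by
  have hp0 : (0:ℤ) < p := by omega
  have h' := fun t (ht : t < p - 1) => (aval_one_iff hp0 hq hv0 hv1).mp (h t ht)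
  have hpig := J_inj p hp q v r m hv hr 0 v (fun t ht => ⟨Int.emod_nonneg _ hp0.ne', (h' t ht).1⟩)
  have hvp : v = p - 1 := by omega
  have hq1 : q ≡ -1 [ZMOD p] := by
    rw [hvp] at hv
    have : q ≡ -(q * (p - 1)) [ZMOD p] := by
      apply Int.modEq_of_dvd; exact ⟨-q, by ring⟩
    exact this.trans hv.neg
  have hseq := seq_full (p - 1) (fun t => ((m + (t:ℤ) * r) * v) % p) 0
    (fun t ht => Int.emod_nonneg _ hp0.ne') (fun t ht => by have := (h' t ht).1; omega) (by
      intro t ht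
      obtain ⟨_, a2, a3⟩ := h' t (by omega)
      obtain ⟨_, b2, b3⟩ := h' (t + 1) ht
      set j := ((m + (t:ℤ) * r) * v) % p
      set j' := ((m + ((t + 1 : ℕ):ℤ) * r) * v) % p
      change j < j'
      push_cast at b3
      rw [show j + (p:ℤ) - v = j + 1 by omega] at a3
      rw [show j' + (p:ℤ) - v = j' + 1 by omega] at b3
      by_contra hcon
      have : j' * q ≤ j * q := mul_le_mul_of_nonneg_right (by omega) hq.le
      nlinarith)
  have j0 := hseq 0 (by omega)
  have j1 := hseq 1 (by omega)
  have jl := hseq (p - 2) (by omega)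
  refine ⟨hq1, ?_, ?_⟩
  · have m0 := J_mod p q v (m + ((0:ℕ):ℤ) * r) hv
    have m1 := J_mod p q v (m + ((1:ℕ):ℤ) * r) hv
    rw [j0] at m0
    rw [j1] at m1
    have := m1.sub m0
    have e : r ≡ q [ZMOD p] := by
      have h3 := this.symm
      convert h3 using 1 <;> push_cast <;> ring
    exact e.trans hq1
  · obtain ⟨_, a2, _⟩ := h' 0 (by omega)
    obtain ⟨_, _, b3⟩ := h' (p - 2) (by omega)
    rw [j0] at a2
    rw [jl] at b3
    have e : ((p - 2 : ℕ) : ℤ) = p - 2 := by omega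
    rw [e] at b3
    have e2 : (0 + ((p:ℤ) - 2) + p - v) = p - 1 := by omega
    rw [e2] at b3
    simp at a2
    linarith

lemma window_neg (p : ℕ) (hp : p.Prime) (hp3 : 3 ≤ p) (q v r m : ℤ) (hq : 0 < q) (hv0 : 0 < v) (hv1 : v < p)
    (hv : q * v ≡ 1 [ZMOD p]) (hqr : q < r) (hr : ¬ (p:ℤ) ∣ r)
    (h : ∀ t < p - 1, aval p q v (m + (t:ℤ) * r) = -1) :
    q ≡ 1 [ZMOD p] ∧ r ≡ 1 [ZMOD p] ∧ ((p:ℤ) - 2) * r ≤ (p - 1) * q := by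
  have hp0 : (0:ℤ) < p := by omega
  have h' := fun t (ht : t < p - 1) => (aval_neg_one_iff hp0 hq hv0 hv1).mp (h t ht)
  have hlt : ∀ t : ℕ, ((m + (t:ℤ) * r) * v) % p < p := fun t => Int.emod_lt_of_pos _ hp0
  have hpig := J_inj p hp q v r m hv hr v p (fun t ht => ⟨(h' t ht).1, hlt t⟩)
  have hvp : v = 1 := by omega
  have hq1 : q ≡ 1 [ZMOD p] := by
    rw [hvp, mul_one] at hv; exact hv
  have hseq := seq_full (p - 1) (fun t => ((m + (t:ℤ) * r) * v) % p) 1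
    (fun t ht => by have := (h' t ht).1; omega) (fun t ht => by have := hlt t; omega) (by
      intro t ht
      obtain ⟨_, a2, a3⟩ := h' t (by omega)
      obtain ⟨_, b2, b3⟩ := h' (t + 1) ht
      set j := ((m + (t:ℤ) * r) * v) % p
      set j' := ((m + ((t + 1 : ℕ):ℤ) * r) * v) % p
      change j < j'
      push_cast at b2
      rw [hvp] at a3
      by_contra hcon
      have : j' * q ≤ j * q := mul_le_mul_of_nonneg_right (by omega) hq.le
      nlinarith)
  have j0 := hseq 0 (by omega)
  have j1 := hseq 1 (by omega)
  have jl := hseq (p - 2) (by omega)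
  refine ⟨hq1, ?_, ?_⟩
  · have m0 := J_mod p q v (m + ((0:ℕ):ℤ) * r) hv
    have m1 := J_mod p q v (m + ((1:ℕ):ℤ) * r) hv
    rw [j0] at m0
    rw [j1] at m1
    have := m1.sub m0
    have e : r ≡ q [ZMOD p] := by
      have h3 := this.symm
      convert h3 using 1 <;> push_cast <;> ring
    exact e.trans hq1
  · obtain ⟨_, _, a3⟩ := h' 0 (by omega)
    obtain ⟨_, b2, _⟩ := h' (p - 2) (by omega)
    rw [j0] at a3
    rw [jl] at b2
    have e : ((p - 2 : ℕ) : ℤ) = p - 2 := by omega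
    rw [e] at b2
    rw [hvp] at a3
    simp at a3
    linarith


lemma block_sum (p : ℕ) (b K : ℤ) (f : ℤ → ℤ) (hf : ∀ i, f i ≠ 0 → i ≤ K ∧ K - i < p - 1) :
    ∑ j ∈ Finset.range p, f (b + j) =
      ∑ t ∈ Finset.range (p - 1), if b ≤ K - t ∧ K - t < b + p then f (K - t) else 0 := by
  refine Finset.sum_bij_ne_zero (fun j _ _ => (K - (b + j)).toNat) ?_ ?_ ?_ ?_
  · intro j hj h
    obtain ⟨h1, h2⟩ := hf _ h
    rw [Finset.mem_range] at *
    omega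
  · intro j hj h j' hj' h' e
    obtain ⟨h1, h2⟩ := hf _ h
    obtain ⟨h1', h2'⟩ := hf _ h'
    omega
  · intro t ht h
    rw [ne_eq, ite_eq_right_iff, Classical.not_imp] at h
    obtain ⟨⟨h1, h2⟩, h3⟩ := h
    rw [Finset.mem_range] at ht
    refine ⟨(K - t - b).toNat, by rw [Finset.mem_range]; omega, ?_, ?_⟩
    · rw [show b + ((K - t - b).toNat : ℤ) = K - t by omega]; exact h3
    · omega
  · intro j hj h
    obtain ⟨h1, h2⟩ := hf _ h
    rw [Finset.mem_range] at hj
    have e : K - ((K - (b + j)).toNat : ℤ) = b + j := by omega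
    rw [e, if_pos (by omega)]

lemma coeff_formula (p q r : ℕ) (v : ℤ) (hp : p.Prime) (hq : q.Prime) (hr : r.Prime) (hpq : p < q)
    (hqr : q < r) (hv0 : 0 < v) (hv1 : v < p) (hv : (q:ℤ) * v ≡ 1 [ZMOD p]) (m0 K : ℤ) (hm0 : 0 ≤ m0)
    (hm1 : m0 < r) :
    ext0 (invCyclotomic (p * q * r)) (m0 + K * r) = ∑ t ∈ Finset.range (p - 1),
      ((if (q:ℤ) ≤ K - t ∧ K - t < q + p then aval p q v (m0 + t * r) else 0)
       - (if 0 ≤ K - t ∧ K - t < 0 + p then aval p q v (m0 + t * r) else 0)) := by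
  rw [coeff_invCyc p q r hp hq hr hpq hqr]
  have hcf : ∀ m, ext0 (cyclotomic (p * q) ℤ) m = aval p q v m := cyc_pq_coeff p q v hp hq hpq hv
  simp only [hcf]
  have hp0 : (0:ℤ) < p := by exact_mod_cast hp.pos
  have hq0 : (0:ℤ) < q := by exact_mod_cast hq.pos
  have hr0 : (0:ℤ) < r := by exact_mod_cast hr.pos
  have hqr' : (q:ℤ) < r := by exact_mod_cast hqr
  have hp2 : (2:ℤ) ≤ p := by exact_mod_cast hp.two_le
  have hf : ∀ i : ℤ, aval p q v (m0 + K * r - i * r) ≠ 0 → i ≤ K ∧ K - i < p - 1 := by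
    intro i hi
    obtain ⟨h1, h2⟩ := aval_support hp0 hq0 hv0 hv1 hi
    constructor
    · by_contra hc
      have : (K - i) * r ≤ (-1) * r := mul_le_mul_of_nonneg_right (by omega) hr0.le
      nlinarith
    · by_contra hc
      have : ((p:ℤ) - 1) * r ≤ (K - i) * r := mul_le_mul_of_nonneg_right (by omega) hr0.le
      nlinarith
  rw [Finset.sum_sub_distrib, Finset.sum_sub_distrib]
  have e1 := block_sum p q K (fun i => aval p q v (m0 + K * r - i * r)) hf
  have e2 := block_sum p 0 K (fun i => aval p q v (m0 + K * r - i * r)) hf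
  have e3 : ∀ t : ℕ, m0 + K * r - (K - t) * r = m0 + t * r := fun t => by ring
  simp only [e3, zero_add] at e1 e2
  simp only [zero_add]
  rw [← e1, ← e2]

lemma exists_inv (p q : ℕ) (hp : p.Prime) (hq : q.Prime) (hpq : p < q) :
    ∃ v : ℤ, 0 < v ∧ v < p ∧ (q:ℤ) * v ≡ 1 [ZMOD p] := by
  have hcop : IsCoprime (q:ℤ) (p:ℤ) := by
    rw [Nat.isCoprime_iff_coprime]
    exact (Nat.coprime_primes hq hp).mpr (by omega)
  obtain ⟨a, b, hab⟩ := hcop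
  have hp0 : (0:ℤ) < p := by exact_mod_cast hp.pos
  have h1 : (q:ℤ) * (a % p) ≡ 1 [ZMOD p] := by
    calc (q:ℤ) * (a % p) ≡ q * a [ZMOD p] := (Int.mod_modEq _ _).mul_left _
      _ ≡ 1 [ZMOD p] := by
        apply Int.modEq_of_dvd; exact ⟨b, by linarith⟩
  refine ⟨a % p, ?_, Int.emod_lt_of_pos _ hp0, h1⟩
  have h0 := Int.emod_nonneg a hp0.ne'
  rcases h0.lt_or_eq with h | h
  · exact h
  · exfalso
    rw [← h, mul_zero] at h1
    have h2 := h1.dvd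
    rw [sub_zero] at h2
    have := Int.le_of_dvd one_pos h2
    have := hp.two_le
    omega

lemma all_eq_one (n : ℕ) (g : ℕ → ℤ) (h1 : ∀ t < n, g t ≤ 1) (hs : ∑ t ∈ Finset.range n, g t = n) :
    ∀ t < n, g t = 1 := by
  have h2 : ∑ t ∈ Finset.range n, g t = ∑ t ∈ Finset.range n, (1:ℤ) := by simp [hs]
  have := (Finset.sum_eq_sum_iff_of_le (fun t ht => h1 t (Finset.mem_range.mp ht))).mp h2
  exact fun t ht => this t (Finset.mem_range.mpr ht)

lemma coeff_analysis (p q r : ℕ) (hp : p.Prime) (hq : q.Prime) (hr : r.Prime) (hp3 : 3 ≤ p) (hpq : p < q)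
    (hqr : q < r) (k : ℤ) :
    |ext0 (invCyclotomic (p * q * r)) k| ≤ (p:ℤ) - 1 ∧ 
    (|ext0 (invCyclotomic (p * q * r)) k| = (p:ℤ) - 1 → 
      (((q:ℤ) ≡ 1 [ZMOD p] ∧ (r:ℤ) ≡ 1 [ZMOD p]) ∨ ((q:ℤ) ≡ -1 [ZMOD p] ∧ (r:ℤ) ≡ -1 [ZMOD p])) ∧
      ((p:ℤ) - 2) * r ≤ (p - 1) * q) := by
  obtain ⟨v, hv0, hv1, hv⟩ := exists_inv p q hp hq hpq
  have hp0 : (0:ℤ) < p := by exact_mod_cast hp.pos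
  have hq0 : (0:ℤ) < q := by exact_mod_cast hq.pos
  have hr0 : (0:ℤ) < r := by exact_mod_cast hr.pos
  have hqr' : (q:ℤ) < r := by exact_mod_cast hqr
  have hpq' : (p:ℤ) < q := by exact_mod_cast hpq
  have hrp : ¬ (p:ℤ) ∣ r := by
    intro h
    have := (Nat.prime_dvd_prime_iff_eq hp hr).mp (by exact_mod_cast h)
    omega
  set m0 := k % r with hm0
  set K := k / r with hK
  have hk : k = m0 + K * r := by rw [hm0, hK]; have := Int.emod_add_mul_ediv k r; linarith
  have hform := coeff_formula p q r v hp hq hr hpq hqr hv0 hv1 hv m0 K (Int.emod_nonneg _ hr0.ne')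
    (Int.emod_lt_of_pos _ hr0)
  rw [← hk] at hform
  set g : ℕ → ℤ := fun t => ((if (q:ℤ) ≤ K - t ∧ K - t < q + p then aval p q v (m0 + t * r) else 0)
       - (if 0 ≤ K - t ∧ K - t < 0 + p then aval p q v (m0 + t * r) else 0)) with hg
  have hgle : ∀ t, |g t| ≤ 1 := by
    intro t
    have ha : |aval p q v (m0 + t * r)| ≤ 1 := by
      rcases aval_cases p q v (m0 + t * r) with h | h | h <;> rw [h] <;> norm_num
    simp only [hg]
    split_ifs with h1 h2 h2
    · omega
    · simpa using ha
    · simpa using ha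
    · simp
  have hsum : ∀ s : ℤ, ∑ t ∈ Finset.range (p - 1), s * g t = s * ext0 (invCyclotomic (p * q * r)) k := by
    intro s; rw [hform, Finset.mul_sum]
  have hn : ((p - 1 : ℕ) : ℤ) = p - 1 := by omega
  refine ⟨?_, ?_⟩
  · rw [hform]
    refine (Finset.abs_sum_le_sum_abs _ _).trans ?_
    refine (Finset.sum_le_sum fun t _ => hgle t).trans ?_
    simp [hn]
  · intro habs
    -- a sign s with all s * g t = 1
    have hs : ∃ s : ℤ, (s = 1 ∨ s = -1) ∧ ∀ t < p - 1, s * g t = 1 := by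
      rcases abs_choice (ext0 (invCyclotomic (p * q * r)) k) with h | h
      · refine ⟨1, Or.inl rfl, all_eq_one _ _ (fun t _ => ?_) ?_⟩
        · have := (abs_le.mp (hgle t)).2; linarith
        · rw [hsum, hn]; linarith
      · refine ⟨-1, Or.inr rfl, all_eq_one _ _ (fun t _ => ?_) ?_⟩
        · have := (abs_le.mp (hgle t)).1; linarith
        · rw [hsum, hn]; linarith
    obtain ⟨s, hs, hall⟩ := hs
    have hblock : ∀ t < p - 1, ((q:ℤ) ≤ K - t ∧ K - t < q + p) ∨ (0 ≤ K - t ∧ K - t < 0 + p) := by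
      intro t ht
      by_contra hc
      rw [not_or] at hc
      have := hall t ht
      simp only [hg] at this
      rw [if_neg hc.1, if_neg hc.2] at this
      simp at this
    have hs' : ∃ s' : ℤ, (s' = 1 ∨ s' = -1) ∧ ∀ t < p - 1, aval p q v (m0 + (t:ℤ) * r) = s' := by
      rcases hblock 0 (by omega) with h0 | h0
      · have hb : ∀ t : ℕ, t < p - 1 → ((q:ℤ) ≤ K - t ∧ K - t < q + p) := by
          intro t
          induction t with
          | zero => intro _; exact h0
          | succ t ih =>
            intro ht
            have h1 := ih (by omega)
            have h2 := hblock (t + 1) ht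
            push_cast at *
            omega
        refine ⟨s, hs, fun t ht => ?_⟩
        have h1 := hall t ht
        have h2 := hb t ht
        simp only [hg] at h1
        rw [if_pos h2, if_neg (by omega)] at h1
        rcases hs with rfl | rfl <;> linarith
      · have hb : ∀ t : ℕ, t < p - 1 → (0 ≤ K - t ∧ K - t < 0 + p) := by
          intro t ht
          rcases hblock t ht with h | h
          · push_cast at h0; omega
          · exact h
        refine ⟨-s, by omega, fun t ht => ?_⟩
        have h1 := hall t ht
        have h2 := hb t ht
        simp only [hg] at h1
        rw [if_pos h2, if_neg (by omega)] at h1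
        rcases hs with rfl | rfl <;> linarith
    obtain ⟨s', hs', hw⟩ := hs'
    rcases hs' with rfl | rfl
    · obtain ⟨a, b, c⟩ := window_pos p hp hp3 q v r m0 hq0 hv0 hv1 hv hqr' hrp hw
      exact ⟨Or.inr ⟨a, b⟩, c⟩
    · obtain ⟨a, b, c⟩ := window_neg p hp hp3 q v r m0 hq0 hv0 hv1 hv hqr' hrp hw
      exact ⟨Or.inl ⟨a, b⟩, c⟩

lemma ext0_nat (f : ℤ[X]) (k : ℕ) : ext0 f k = f.coeff k := by
  unfold ext0; rw [if_pos (by omega)]; simp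

lemma height_le (p q r : ℕ) (hp : p.Prime) (hq : q.Prime) (hr : r.Prime) (hp3 : 3 ≤ p) (hpq : p < q)
    (hqr : q < r) : polyHeight (invCyclotomic (p * q * r)) ≤ p - 1 := by
  unfold polyHeight
  refine Finset.sup_le fun k _ => ?_
  have := (coeff_analysis p q r hp hq hr hp3 hpq hqr k).1
  rw [ext0_nat, Int.abs_eq_natAbs] at this
  omega

lemma height_necessary (p q r : ℕ) (hp : p.Prime) (hq : q.Prime) (hr : r.Prime) (hp3 : 3 ≤ p) (hpq : p < q)
    (hqr : q < r) (h : polyHeight (invCyclotomic (p * q * r)) = p - 1) :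
      (((q:ℤ) ≡ 1 [ZMOD p] ∧ (r:ℤ) ≡ 1 [ZMOD p]) ∨ ((q:ℤ) ≡ -1 [ZMOD p] ∧ (r:ℤ) ≡ -1 [ZMOD p])) ∧
      ((p:ℤ) - 2) * r ≤ (p - 1) * q := by
  unfold polyHeight at h
  have hne : (invCyclotomic (p * q * r)).support.Nonempty := by
    rw [Finset.nonempty_iff_ne_empty]
    intro he
    rw [he, Finset.sup_empty] at h
    change 0 = p - 1 at h
    omega
  obtain ⟨k, -, hk⟩ := Finset.exists_mem_eq_sup _ hne (fun k => ((invCyclotomic (p * q * r)).coeff k).natAbs)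
  rw [h] at hk
  have := (coeff_analysis p q r hp hq hr hp3 hpq hqr k).2
  rw [ext0_nat, Int.abs_eq_natAbs] at this
  exact this (by omega)

lemma height_of_coeff (p q r : ℕ) (hp : p.Prime) (hq : q.Prime) (hr : r.Prime) (hp3 : 3 ≤ p) (hpq : p < q)
    (hqr : q < r) (k : ℕ) (h : |ext0 (invCyclotomic (p * q * r)) k| = (p:ℤ) - 1) :
    polyHeight (invCyclotomic (p * q * r)) = p - 1 := by
  refine le_antisymm (height_le p q r hp hq hr hp3 hpq hqr) ?_
  rw [ext0_nat, Int.abs_eq_natAbs] at h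
  have hk : p - 1 = ((invCyclotomic (p * q * r)).coeff k).natAbs := by omega
  rw [hk]
  unfold polyHeight
  refine Finset.le_sup (f := fun k => ((invCyclotomic (p * q * r)).coeff k).natAbs) ?_
  rw [mem_support_iff]
  intro h0
  rw [h0] at hk
  simp at hk; omega

lemma height_suff_neg (p q r : ℕ) (hp : p.Prime) (hq : q.Prime) (hr : r.Prime) (hp3 : 3 ≤ p) (hpq : p < q)
    (hqr : q < r) (h1 : (q:ℤ) ≡ -1 [ZMOD p]) (h2 : (r:ℤ) ≡ -1 [ZMOD p])
    (h3 : ((p:ℤ) - 2) * r ≤ (p - 1) * q) : polyHeight (invCyclotomic (p * q * r)) = p - 1 := by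
  refine height_of_coeff p q r hp hq hr hp3 hpq hqr ((p - 2) * r) ?_
  have hp0 : (0:ℤ) < p := by exact_mod_cast hp.pos
  have hq0 : (0:ℤ) < q := by exact_mod_cast hq.pos
  have hr0 : (0:ℤ) < r := by exact_mod_cast hr.pos
  have hqr' : (q:ℤ) < r := by exact_mod_cast hqr
  have hpq' : (p:ℤ) < q := by exact_mod_cast hpq
  have hpm : (p:ℤ) - 1 ≡ -1 [ZMOD p] := by apply Int.modEq_of_dvd; exact ⟨-1, by ring⟩
  have hv : (q:ℤ) * (p - 1) ≡ 1 [ZMOD p] := by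
    have := h1.mul hpm; simpa using this
  have hform := coeff_formula p q r (p - 1) hp hq hr hpq hqr (by omega) (by omega) hv 0 (p - 2) le_rfl hr0
  have e : (((p - 2) * r : ℕ) : ℤ) = 0 + ((p:ℤ) - 2) * r := by
    push_cast [Nat.cast_sub (show 2 ≤ p by omega)]; ring
  rw [e, hform]
  have hterm : ∀ t ∈ Finset.range (p - 1), 
      ((if (q:ℤ) ≤ ((p:ℤ) - 2) - t ∧ ((p:ℤ) - 2) - t < q + p then aval p q (p - 1) (0 + t * r) else 0)
       - (if 0 ≤ ((p:ℤ) - 2) - t ∧ ((p:ℤ) - 2) - t < 0 + p then aval p q (p - 1) (0 + t * r) else 0)) = -1 := by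
    intro t ht
    rw [Finset.mem_range] at ht
    rw [if_neg (by omega), if_pos (by omega)]
    have hJ : ((0 + (t:ℤ) * r) * (p - 1)) % p = t := by
      have h5 : (0 + (t:ℤ) * r) * (p - 1) ≡ t [ZMOD p] := by
        have := (h2.mul hpm).mul_left t
        calc (0 + (t:ℤ) * r) * (p - 1) = t * (r * (p - 1)) := by ring
          _ ≡ t * (-1 * -1) [ZMOD p] := this
          _ = t := by ring
      rw [h5, Int.emod_eq_of_lt (by omega) (by omega)]
    have : aval p q (p - 1) (0 + t * r) = 1 := by
      rw [aval_one_iff hp0 hq0 (by omega) (by omega), hJ]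
      refine ⟨by omega, by nlinarith, ?_⟩
      have : (t:ℤ) * (r - q) ≤ (p - 2) * (r - q) := mul_le_mul_of_nonneg_right (by omega) (by omega)
      nlinarith
    rw [this]; norm_num
  rw [Finset.sum_congr rfl hterm, Finset.sum_const, Finset.card_range, nsmul_eq_mul, mul_neg_one, abs_neg,
    abs_of_nonneg (by positivity)]
  omega

lemma height_suff_pos (p q r : ℕ) (hp : p.Prime) (hq : q.Prime) (hr : r.Prime) (hp3 : 3 ≤ p) (hpq : p < q)
    (hqr : q < r) (h1 : (q:ℤ) ≡ 1 [ZMOD p]) (h2 : (r:ℤ) ≡ 1 [ZMOD p])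
    (h3 : ((p:ℤ) - 2) * r + 1 < (p - 1) * q) : polyHeight (invCyclotomic (p * q * r)) = p - 1 := by
  refine height_of_coeff p q r hp hq hr hp3 hpq hqr (1 + (p - 2) * r) ?_
  have hp0 : (0:ℤ) < p := by exact_mod_cast hp.pos
  have hq0 : (0:ℤ) < q := by exact_mod_cast hq.pos
  have hr0 : (0:ℤ) < r := by exact_mod_cast hr.pos
  have hqr' : (q:ℤ) < r := by exact_mod_cast hqr
  have hpq' : (p:ℤ) < q := by exact_mod_cast hpq
  have hv : (q:ℤ) * 1 ≡ 1 [ZMOD p] := by rwa [mul_one]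
  have hform := coeff_formula p q r 1 hp hq hr hpq hqr (by omega) (by omega) hv 1 (p - 2) (by norm_num) (by omega)
  have e : ((1 + (p - 2) * r : ℕ) : ℤ) = 1 + ((p:ℤ) - 2) * r := by
    push_cast [Nat.cast_sub (show 2 ≤ p by omega)]; ring
  rw [e, hform]
  have hterm : ∀ t ∈ Finset.range (p - 1), 
      ((if (q:ℤ) ≤ ((p:ℤ) - 2) - t ∧ ((p:ℤ) - 2) - t < q + p then aval p q 1 (1 + t * r) else 0)
       - (if 0 ≤ ((p:ℤ) - 2) - t ∧ ((p:ℤ) - 2) - t < 0 + p then aval p q 1 (1 + t * r) else 0)) = 1 := by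
    intro t ht
    rw [Finset.mem_range] at ht
    rw [if_neg (by omega), if_pos (by omega)]
    have hJ : ((1 + (t:ℤ) * r) * 1) % p = 1 + t := by
      have h5 : (1 + (t:ℤ) * r) * 1 ≡ 1 + t [ZMOD p] := by
        have := (h2.mul_left t).add_left 1
        simpa using this
      rw [h5, Int.emod_eq_of_lt (by omega) (by omega)]
    have : aval p q 1 (1 + t * r) = -1 := by
      rw [aval_neg_one_iff hp0 hq0 (by omega) (by omega), hJ]
      refine ⟨by omega, ?_, by nlinarith⟩
      have : (t:ℤ) * (r - q) ≤ (p - 2) * (r - q) := mul_le_mul_of_nonneg_right (by omega) (by omega)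
      nlinarith
    rw [this]; norm_num
  rw [Finset.sum_congr rfl hterm, Finset.sum_const, Finset.card_range, nsmul_eq_mul, mul_one, 
    abs_of_nonneg (by positivity)]
  omega


lemma tern_unique {p q r p' q' r' : ℕ} (hp : p.Prime) (hq : q.Prime) (hr : r.Prime) (hpq : p < q) (hqr : q < r)
    (hp' : p'.Prime) (hq' : q'.Prime) (hr' : r'.Prime) (hpq' : p' < q') (hqr' : q' < r')
    (h : p * q * r = p' * q' * r') : p = p' ∧ q = q' ∧ r = r' := by
  have key : ∀ {p q r p' q' r' : ℕ}, p.Prime → q.Prime → r.Prime → p < q → q < r →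
    p'.Prime → q'.Prime → r'.Prime → p' < q' → q' < r' → p * q * r = p' * q' * r' → p' ≤ p := by
    intro p q r p' q' r' hp hq hr hpq hqr hp' hq' hr' hpq' hqr' h
    have hd : p ∣ p' * q' * r' := ⟨q * r, by rw [← h]; ring⟩
    rcases hp.dvd_mul.mp hd with hd | hd
    · rcases hp.dvd_mul.mp hd with hd | hd
      · rw [(Nat.prime_dvd_prime_iff_eq hp hp').mp hd]
      · rw [(Nat.prime_dvd_prime_iff_eq hp hq').mp hd]; omega
    · rw [(Nat.prime_dvd_prime_iff_eq hp hr').mp hd]; omega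
  have e1 : p = p' := le_antisymm (key hp' hq' hr' hpq' hqr' hp hq hr hpq hqr h.symm)
    (key hp hq hr hpq hqr hp' hq' hr' hpq' hqr' h)
  subst e1
  have h2 : q * r = q' * r' := by
    apply Nat.eq_of_mul_eq_mul_left hp.pos
    rw [← mul_assoc, ← mul_assoc, h]
  have key2 : ∀ {q r q' r' : ℕ}, q.Prime → q'.Prime → r'.Prime → q' < r' → q * r = q' * r' → q' ≤ q := by
    intro q r q' r' hq hq' hr' h1 h
    have hd : q ∣ q' * r' := ⟨r, by rw [← h]⟩
    rcases hq.dvd_mul.mp hd with hd | hd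
    · rw [(Nat.prime_dvd_prime_iff_eq hq hq').mp hd]
    · rw [(Nat.prime_dvd_prime_iff_eq hq hr').mp hd]; omega
  have e2 : q = q' := le_antisymm (key2 hq' hq hr hqr h2.symm) (key2 hq hq' hr' hqr' h2)
  subst e2
  exact ⟨rfl, rfl, Nat.eq_of_mul_eq_mul_left hq.pos h2⟩

open Classical in
/-- Pairs `(q, r)` completing `p` to a counted ternary integer with property `P`. -/
noncomputable def tSet (P : ℕ → ℕ → ℕ → Prop) (p : ℕ) (x : ℝ) : Finset (ℕ × ℕ) :=
  ((Finset.range (⌊x⌋₊ + 1)) ×ˢ (Finset.range (⌊x⌋₊ + 1))).filter fun t =>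
    t.1.Prime ∧ t.2.Prime ∧ p < t.1 ∧ t.1 < t.2 ∧ ((p * t.1 * t.2 : ℕ) : ℝ) ≤ x ∧ P p t.1 t.2

lemma mem_tSet {P : ℕ → ℕ → ℕ → Prop} {p : ℕ} (hp : 0 < p) {x : ℝ} {t : ℕ × ℕ} :
    t ∈ tSet P p x ↔ t.1.Prime ∧ t.2.Prime ∧ p < t.1 ∧ t.1 < t.2 ∧ ((p * t.1 * t.2 : ℕ) : ℝ) ≤ x ∧ P p t.1 t.2 := by
  classical
  unfold tSet
  rw [Finset.mem_filter, and_iff_right_iff_imp]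
  rintro ⟨h1, h2, h3, h4, h5, -⟩
  have h6 : p * t.1 * t.2 ≤ ⌊x⌋₊ := Nat.le_floor h5
  have h7 : 1 * t.2 ≤ p * t.1 * t.2 := Nat.mul_le_mul_right _ (Nat.mul_pos hp h1.pos)
  rw [Finset.mem_product, Finset.mem_range, Finset.mem_range]
  omega

lemma tern_count (P : ℕ → ℕ → ℕ → Prop) (x : ℝ) :
    ({n : ℕ | ∃ p q r : ℕ, p.Prime ∧ q.Prime ∧ r.Prime ∧
      3 ≤ p ∧ p < q ∧ q < r ∧ n = p * q * r ∧ (n : ℝ) ≤ x ∧ P p q r}.ncard : ℝ) =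
      ∑' p : {p : ℕ // p.Prime ∧ 3 ≤ p}, ((tSet P p.1 x).card : ℝ) := by
  classical
  set Q : Finset {p : ℕ // p.Prime ∧ 3 ≤ p} := (Finset.range (⌊x⌋₊ + 1)).subtype _ with hQ
  have hQ' : ∀ p : {p : ℕ // p.Prime ∧ 3 ≤ p}, ∀ t ∈ tSet P p.1 x, p ∈ Q := by
    intro p t ht
    rw [mem_tSet p.2.1.pos] at ht
    obtain ⟨h1, h2, h3, h4, h5, -⟩ := ht
    have h6 : p.1 * t.1 * t.2 ≤ ⌊x⌋₊ := Nat.le_floor h5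
    have h7 : p.1 * 1 ≤ p.1 * (t.1 * t.2) := Nat.mul_le_mul_left _ (Nat.mul_pos h1.pos h2.pos)
    rw [hQ, Finset.mem_subtype, Finset.mem_range]
    rw [mul_assoc] at h6
    omega
  rw [tsum_eq_sum (s := Q)]
  swap
  · intro p hp
    rw [Nat.cast_eq_zero, Finset.card_eq_zero, Finset.eq_empty_iff_forall_notMem]
    intro t ht
    exact hp (hQ' p t ht)
  rw [← Nat.cast_sum, ← Finset.card_sigma, ← Set.ncard_coe_finset, Nat.cast_inj]
  symm
  refine Set.ncard_congr (fun s _ => s.1.1 * s.2.1 * s.2.2) ?_ ?_ ?_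
  · rintro ⟨p, t⟩ hs
    rw [Finset.mem_coe, Finset.mem_sigma, mem_tSet p.2.1.pos] at hs
    obtain ⟨-, h1, h2, h3, h4, h5, h6⟩ := hs
    exact ⟨p.1, t.1, t.2, p.2.1, h1, h2, p.2.2, h3, h4, rfl, h5, h6⟩
  · rintro ⟨p, t⟩ ⟨p', t'⟩ hs hs' he
    rw [Finset.mem_coe, Finset.mem_sigma, mem_tSet p.2.1.pos] at hs
    rw [Finset.mem_coe, Finset.mem_sigma, mem_tSet p'.2.1.pos] at hs'
    obtain ⟨-, h1, h2, h3, h4, h5, h6⟩ := hs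
    obtain ⟨-, h1', h2', h3', h4', h5', h6'⟩ := hs'
    obtain ⟨a, b, c⟩ := tern_unique p.2.1 h1 h2 h3 h4 p'.2.1 h1' h2' h3' h4' he
    have a' : p = p' := Subtype.ext a
    subst a'
    congr 1
    exact Prod.ext b c
  · rintro n ⟨p, q, r, h1, h2, h3, h4, h5, h6, h7, h8, h9⟩
    have ht : (q, r) ∈ tSet P p x := by
      rw [mem_tSet h1.pos]; subst h7; exact ⟨h2, h3, h5, h6, h8, h9⟩
    refine ⟨⟨⟨p, h1, h4⟩, (q, r)⟩, ?_, h7.symm⟩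
    rw [Finset.mem_coe, Finset.mem_sigma]
    exact ⟨hQ' ⟨p, h1, h4⟩ _ ht, ht⟩

/-- the coefficient-optimal property -/
def coP (p q r : ℕ) : Prop := polyHeight (invCyclotomic (p * q * r)) = p - 1

lemma NCO_eq (x : ℝ) : (NCOcount x : ℝ) = ∑' p : {p : ℕ // p.Prime ∧ 3 ≤ p}, ((tSet coP p.1 x).card : ℝ) := by
  rw [← tern_count]
  unfold NCOcount coP
  congr 2
  ext n
  constructor
  · rintro ⟨p, q, r, h1, h2, h3, h4, h5, h6, h7, h8, h9⟩
    exact ⟨p, q, r, h1, h2, h3, h4, h5, h6, h7, h8, by rw [← h7]; exact h9⟩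
  · rintro ⟨p, q, r, h1, h2, h3, h4, h5, h6, h7, h8, h9⟩
    exact ⟨p, q, r, h1, h2, h3, h4, h5, h6, h7, h8, by rw [h7]; exact h9⟩

lemma NT_eq (x : ℝ) : (NTcount x : ℝ) = ∑' p : {p : ℕ // p.Prime ∧ 3 ≤ p},
    ((tSet (fun _ _ _ => True) p.1 x).card : ℝ) := by
  rw [← tern_count]
  unfold NTcount
  simp

lemma co_upper (p : ℕ) (hp : p.Prime) (hp3 : 3 ≤ p) (x : ℝ) (hx : 0 ≤ x) :
    (tSet coP p x).card ≤ (pairSet (1 : ZMod p) (((p:ℝ) - 1) / (p - 2)) 0 (x / p)).card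
      + (pairSet (-1 : ZMod p) (((p:ℝ) - 1) / (p - 2)) 0 (x / p)).card := by
  classical
  have hp0 : (0:ℝ) < p := by exact_mod_cast hp.pos
  have hp3' : (3:ℝ) ≤ p := by exact_mod_cast hp3
  refine le_trans ?_ (Finset.card_union_le _ _)
  refine Finset.card_le_card_of_injOn (fun t => ⟨t.1, t.2⟩) ?_ ?_
  · intro t ht
    rw [Finset.mem_coe, mem_tSet hp.pos] at ht
    obtain ⟨h1, h2, h3, h4, h5, h6⟩ := ht
    obtain ⟨hm, hle⟩ := height_necessary p t.1 t.2 hp h1 h2 hp3 h3 h4 h6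
    have hle' : ((p:ℝ) - 2) * t.2 ≤ (p - 1) * t.1 := by exact_mod_cast hle
    have hc : (t.2:ℝ) ≤ ((p:ℝ) - 1) / (p - 2) * t.1 - 0 := by
      rw [sub_zero, div_mul_eq_mul_div, le_div_iff₀ (by linarith)]; linarith
    have hd : (t.1 * t.2 : ℝ) ≤ x / p := by
      rw [le_div_iff₀ hp0]; push_cast at h5; linarith
    rw [Finset.coe_union, Set.mem_union, Finset.mem_coe, Finset.mem_coe, mem_pairSet (by positivity),
      mem_pairSet (by positivity)]
    rcases hm with ⟨ha, hb⟩ | ⟨ha, hb⟩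
    · left
      have ha' := (ZMod.intCast_eq_intCast_iff _ _ p).mpr ha
      have hb' := (ZMod.intCast_eq_intCast_iff _ _ p).mpr hb
      push_cast at ha' hb'
      exact ⟨h1, h2, ha', hb', h4, hc, hd⟩
    · right
      have ha' := (ZMod.intCast_eq_intCast_iff _ _ p).mpr ha
      have hb' := (ZMod.intCast_eq_intCast_iff _ _ p).mpr hb
      push_cast at ha' hb'
      exact ⟨h1, h2, ha', hb', h4, hc, hd⟩
  · intro t _ t' _ h
    simp only [Sigma.mk.injEq, heq_eq_eq] at h
    exact Prod.ext h.1 h.2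

lemma co_lower (p : ℕ) (hp : p.Prime) (hp3 : 3 ≤ p) (x : ℝ) (hx : 0 ≤ x) :
    (pairSet (1 : ZMod p) (((p:ℝ) - 1) / (p - 2)) 4 (x / p)).card
      + (pairSet (-1 : ZMod p) (((p:ℝ) - 1) / (p - 2)) 4 (x / p)).card ≤ (tSet coP p x).card := by
  classical
  have hp0 : (0:ℝ) < p := by exact_mod_cast hp.pos
  have hp3' : (3:ℝ) ≤ p := by exact_mod_cast hp3
  have : Fact (2 < p) := ⟨by omega⟩
  have hdis : Disjoint (pairSet (1 : ZMod p) (((p:ℝ) - 1) / (p - 2)) 4 (x / p))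
      (pairSet (-1 : ZMod p) (((p:ℝ) - 1) / (p - 2)) 4 (x / p)) := by
    rw [Finset.disjoint_left]
    rintro ⟨q, r⟩ h h'
    rw [mem_pairSet (by positivity)] at h h'
    have := h.2.2.1.symm.trans h'.2.2.1
    exact ZMod.neg_one_ne_one this.symm
  rw [← Finset.card_union_of_disjoint hdis]
  have common : ∀ q r : ℕ, q < r → (r:ℝ) ≤ ((p:ℝ) - 1) / (p - 2) * q - 4 → 
      ((p:ℤ) - 2) * r + 4 * (p - 2) ≤ (p - 1) * q ∧ p < q := by
    intro q r hqr h
    have h1 : ((p:ℝ) - 2) * r + 4 * (p - 2) ≤ (p - 1) * q := by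
      have h2 : (r:ℝ) + 4 ≤ ((p:ℝ) - 1) / (p - 2) * q := by linarith
      rw [div_mul_eq_mul_div, le_div_iff₀ (by linarith)] at h2; linarith
    have h2 : ((p:ℤ) - 2) * r + 4 * (p - 2) ≤ (p - 1) * q := by exact_mod_cast h1
    refine ⟨h2, ?_⟩
    have hqr' : (q:ℤ) + 1 ≤ r := by omega
    have : ((p:ℤ) - 2) * (q + 1) ≤ (p - 2) * r := mul_le_mul_of_nonneg_left hqr' (by omega)
    have : 5 * ((p:ℤ) - 2) ≤ q := by nlinarith
    omega
  refine Finset.card_le_card_of_injOn (fun s => (s.1, s.2)) ?_ ?_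
  · rintro ⟨q, r⟩ hs
    rw [Finset.coe_union, Set.mem_union, Finset.mem_coe, Finset.mem_coe, mem_pairSet (by positivity),
      mem_pairSet (by positivity)] at hs
    rw [Finset.mem_coe, mem_tSet hp.pos]
    have hd : ∀ {q r : ℕ}, (q * r : ℝ) ≤ x / p → ((p * q * r : ℕ) : ℝ) ≤ x := by
      intro q r h
      rw [le_div_iff₀ hp0] at h; push_cast; linarith
    have hp3z : (3:ℤ) ≤ p := by exact_mod_cast hp3
    rcases hs with ⟨h1, h2, ha, hb, h4, hc, h5⟩ | ⟨h1, h2, ha, hb, h4, hc, h5⟩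
    · obtain ⟨c1, c2⟩ := common q r h4 hc
      refine ⟨h1, h2, c2, h4, hd h5, ?_⟩
      refine height_suff_pos p q r hp h1 h2 hp3 c2 h4 ?_ ?_ (by linarith)
      · rw [← ZMod.intCast_eq_intCast_iff]; push_cast; exact ha
      · rw [← ZMod.intCast_eq_intCast_iff]; push_cast; exact hb
    · obtain ⟨c1, c2⟩ := common q r h4 hc
      refine ⟨h1, h2, c2, h4, hd h5, ?_⟩
      refine height_suff_neg p q r hp h1 h2 hp3 c2 h4 ?_ ?_ (by linarith)
      · rw [← ZMod.intCast_eq_intCast_iff]; push_cast; exact ha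
      · rw [← ZMod.intCast_eq_intCast_iff]; push_cast; exact hb
  · rintro ⟨q, r⟩ _ ⟨q', r'⟩ _ h
    simp only [Prod.mk.injEq] at h
    obtain ⟨rfl, rfl⟩ := h
    rfl

lemma co_tendsto (p : ℕ) (hp : p.Prime) (hp3 : 3 ≤ p) :
    Tendsto (fun x : ℝ => log x ^ 2 / x * (tSet coP p x).card) atTop
      (nhds (4 * (1 / ((p:ℝ) * ((p:ℝ) - 1) ^ 2) * log (((p:ℝ) - 1) / ((p:ℝ) - 2))))) := by
  have := Fact.mk hp
  have hp3' : (3:ℝ) ≤ p := by exact_mod_cast hp3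
  have hκ : 1 < ((p:ℝ) - 1) / (p - 2) := by rw [lt_div_iff₀ (by linarith)]; linarith
  have A := fun d hd => (pairSet_tendsto_x (p := p) (a := 1) isUnit_one (((p:ℝ) - 1) / (p - 2)) d hκ hd).add
    (pairSet_tendsto_x (p := p) (a := -1) isUnit_one.neg (((p:ℝ) - 1) / (p - 2)) d hκ hd)
  have hlim : 2 * (1 / ((p:ℝ) * ((p:ℝ) - 1) ^ 2) * log (((p:ℝ) - 1) / ((p:ℝ) - 2))) + 
     2 * (1 / ((p:ℝ) * ((p:ℝ) - 1) ^ 2) * log (((p:ℝ) - 1) / ((p:ℝ) - 2))) = 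
     4 * (1 / ((p:ℝ) * ((p:ℝ) - 1) ^ 2) * log (((p:ℝ) - 1) / ((p:ℝ) - 2))) := by ring
  simp only [hlim] at A
  refine tendsto_of_tendsto_of_tendsto_of_le_of_le' (A 4 (by norm_num)) (A 0 le_rfl) ?_ ?_
  · filter_upwards [eventually_ge_atTop 0] with x hx
    rw [← mul_add]
    refine mul_le_mul_of_nonneg_left ?_ (by positivity)
    exact_mod_cast co_lower p hp hp3 x hx
  · filter_upwards [eventually_ge_atTop 0] with x hx
    rw [← mul_add]
    refine mul_le_mul_of_nonneg_left ?_ (by positivity)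
    exact_mod_cast co_upper p hp hp3 x hx

lemma NCO_tendsto : Tendsto (fun x : ℝ => log x ^ 2 / x * NCOcount x) atTop (nhds C1) := by
  have h := tendsto_tsum_of_dominated_convergence (𝓕 := atTop)
    (f := fun (x : ℝ) (p : {p : ℕ // p.Prime ∧ 3 ≤ p}) => log x ^ 2 / x * ((tSet coP p.1 x).card : ℝ))
    (g := fun p => 4 * (1 / ((p.1:ℝ) * ((p.1:ℝ) - 1) ^ 2) * log (((p.1:ℝ) - 1) / ((p.1:ℝ) - 2))))
    (bound := fun p => bdom p.1) bdom_summable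
    (fun p => co_tendsto p.1 p.2.1 p.2.2) (by
      filter_upwards [eventually_ge_atTop 0] with x hx p
      rw [Real.norm_of_nonneg (by positivity)]
      refine tail_bound p.1 p.2.2 x _ ?_
      intro t ht
      rw [mem_tSet p.2.1.pos] at ht
      obtain ⟨h1, h2, h3, h4, h5, h6⟩ := ht
      obtain ⟨-, hle⟩ := height_necessary p.1 t.1 t.2 p.2.1 h1 h2 p.2.2 h3 h4 h6
      refine ⟨h1, h2, h3, h4, ?_, h5⟩
      first | exact_mod_cast hle | (have := p.2.2; zify [show 2 ≤ p.1 by omega, show 1 ≤ p.1 by omega]; exact hle))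
  simp only [tsum_mul_left] at h
  simpa only [NCO_eq, C1] using h

lemma C1_pos : 0 < C1 := by
  unfold C1
  have hterm : ∀ p : {p : ℕ // p.Prime ∧ 3 ≤ p}, 0 < 
     (1 / ((p.1 : ℝ) * ((p.1 : ℝ) - 1) ^ 2)) * Real.log (((p.1 : ℝ) - 1) / ((p.1 : ℝ) - 2)) := by
    intro p
    have hp3' : (3:ℝ) ≤ p.1 := by exact_mod_cast p.2.2
    have h1 : 0 < (p.1:ℝ) - 1 := by linarith
    have hκ : 1 < ((p.1:ℝ) - 1) / (p.1 - 2) := by rw [lt_div_iff₀ (by linarith)]; linarith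
    have := Real.log_pos hκ
    positivity
  have hsum : Summable fun p : {p : ℕ // p.Prime ∧ 3 ≤ p} => 
     (1 / ((p.1 : ℝ) * ((p.1 : ℝ) - 1) ^ 2)) * Real.log (((p.1 : ℝ) - 1) / ((p.1 : ℝ) - 2)) := by
    refine Summable.of_nonneg_of_le (fun p => (hterm p).le) (fun p => ?_) bdom_summable
    have h1 := co_tendsto p.1 p.2.1 p.2.2
    have h2 := le_of_tendsto h1 (b := bdom p.1) (by
      filter_upwards [eventually_ge_atTop 0] with x hx
      refine tail_bound p.1 p.2.2 x _ ?_
      intro t ht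
      rw [mem_tSet p.2.1.pos] at ht
      obtain ⟨h1, h2, h3, h4, h5, h6⟩ := ht
      obtain ⟨-, hle⟩ := height_necessary p.1 t.1 t.2 p.2.1 h1 h2 p.2.2 h3 h4 h6
      refine ⟨h1, h2, h3, h4, ?_, h5⟩
      first | exact_mod_cast hle | (have := p.2.2; zify [show 2 ≤ p.1 by omega, show 1 ≤ p.1 by omega]; exact hle))
    have := hterm p
    linarith
  have := hsum.tsum_pos (fun p => (hterm p).le) ⟨3, Nat.prime_three, le_rfl⟩ (hterm _)
  positivity


lemma log_div_log_tendsto {ι : Type*} {l : Filter ι} {f g : ι → ℝ} {c : ℝ} (hc : 0 < c)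
    (h : Tendsto (fun i => f i / g i) l (nhds c)) (hg : Tendsto g l atTop) :
    Tendsto (fun i => Real.log (f i) / Real.log (g i)) l (nhds 1) := by
  have h1 : Tendsto (fun i => Real.log (f i / g i)) l (nhds (Real.log c)) :=
    ((Real.continuousAt_log hc.ne').tendsto).comp h
  have h2 : Tendsto (fun i => Real.log (g i)) l atTop := Real.tendsto_log_atTop.comp hg
  have h3 : Tendsto (fun i => 1 + Real.log (f i / g i) / Real.log (g i)) l (nhds (1 + 0)) :=
    tendsto_const_nhds.add (h1.div_atTop h2)
  rw [add_zero] at h3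
  refine h3.congr' ?_
  filter_upwards [h2.eventually_gt_atTop 0, hg.eventually_gt_atTop 0, h.eventually (lt_mem_nhds hc)] with i h4 h5 h6
  have hf : f i ≠ 0 := by
    intro h; rw [h, zero_div] at h6; exact lt_irrefl _ h6
  rw [Real.log_div hf h5.ne']
  field_simp
  ring

/-- odd primes up to y -/
noncomputable def PP (y : ℝ) : Finset ℕ := (Finset.range (⌊y⌋₊ + 1)).filter fun n => n.Prime ∧ 3 ≤ n

lemma mem_PP {y : ℝ} {n : ℕ} : n ∈ PP y ↔ n.Prime ∧ 3 ≤ n ∧ (n:ℝ) ≤ y := by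
  unfold PP
  rw [Finset.mem_filter, Finset.mem_range]
  constructor
  · rintro ⟨h1, h2, h3⟩
    exact ⟨h2, h3, (Nat.le_floor_iff' (by omega)).mp (by omega)⟩
  · rintro ⟨h2, h3, h1⟩
    have := (Nat.le_floor_iff' (show n ≠ 0 by omega)).mpr h1
    exact ⟨by omega, h2, h3⟩

lemma PP_mono {y z : ℝ} (h : y ≤ z) : PP y ⊆ PP z := fun n hn => by
  rw [mem_PP] at *
  exact ⟨hn.1, hn.2.1, hn.2.2.trans h⟩

/-- reciprocal sum over odd primes -/
noncomputable def SS (y : ℝ) : ℝ := ∑ n ∈ PP y, 1 / (n:ℝ)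

lemma SS_mono : Monotone SS := fun y z h =>
  Finset.sum_le_sum_of_subset_of_nonneg (PP_mono h) fun n _ _ => by positivity

lemma SS_nonneg (y : ℝ) : 0 ≤ SS y := Finset.sum_nonneg fun n _ => by positivity

lemma exp_nat_tendsto : Tendsto (fun k : ℕ => Real.exp ((k:ℝ) + 1)) atTop atTop :=
  Real.tendsto_exp_atTop.comp (tendsto_atTop_add_const_right _ _ tendsto_natCast_atTop_atTop)

lemma block_recip : Tendsto (fun k : ℕ => ((k:ℝ) + 1) * 
    ∑ n ∈ PP (Real.exp ((k:ℝ) + 2)) \ PP (Real.exp ((k:ℝ) + 1)), 1 / (n:ℝ)) atTop (nhds 1) := by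
  have he : (1:ℝ) < Real.exp 1 := by simp
  have h2e : (2:ℝ) < Real.exp 1 := by have := Real.exp_one_gt_d9; linarith
  have hE : ∀ k : ℕ, 0 < Real.exp ((k:ℝ) + 1) := fun k => Real.exp_pos _
  have hE2 : ∀ k : ℕ, Real.exp ((k:ℝ) + 2) = Real.exp 1 * Real.exp ((k:ℝ) + 1) := fun k => by
    rw [← Real.exp_add]; congr 1; ring
  have hE3 : ∀ k : ℕ, 2 < Real.exp ((k:ℝ) + 1) := fun k => h2e.trans_le (Real.exp_le_exp.mpr (by
    have : (0:ℝ) ≤ k := by positivity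
    linarith))
  have hu : IsUnit (1 : ZMod 1) := isUnit_one
  have hmem : ∀ (k : ℕ) (n : ℕ), n ∈ PP (Real.exp ((k:ℝ) + 2)) \ PP (Real.exp ((k:ℝ) + 1)) ↔
      n.Prime ∧ Real.exp ((k:ℝ) + 1) < n ∧ (n:ℝ) ≤ Real.exp 1 * Real.exp ((k:ℝ) + 1) := by
    intro k n
    rw [Finset.mem_sdiff, mem_PP, mem_PP, hE2]
    constructor
    · rintro ⟨⟨h1, h2, h3⟩, h4⟩
      refine ⟨h1, ?_, h3⟩
      by_contra hc
      exact h4 ⟨h1, h2, not_lt.mp hc⟩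
    · rintro ⟨h1, h2, h3⟩
      have h5 : 3 ≤ n := by
        have : (2:ℝ) < n := (hE3 k).trans h2
        have : 2 < n := by exact_mod_cast this
        omega
      exact ⟨⟨h1, h5, h3⟩, fun h => absurd h.2.2 (not_le.mpr h2)⟩
  have key := weak_conv atTop (fun k : ℕ => PP (Real.exp ((k:ℝ) + 2)) \ PP (Real.exp ((k:ℝ) + 1)))
    (fun k n => (n:ℝ) / Real.exp ((k:ℝ) + 1)) (fun k => ((k:ℝ) + 1) / Real.exp ((k:ℝ) + 1))
    (Eventually.of_forall fun k => by positivity) 1 (Real.exp 1) 1 he zero_le_one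
    (Eventually.of_forall fun k n hn => by
      rw [hmem] at hn
      rw [lt_div_iff₀ (hE k), div_le_iff₀ (hE k), one_mul]
      exact hn.2) (by
      intro s hs
      have h1 := (piAP_scale hu s (by linarith [hs.1])).comp exp_nat_tendsto
      have h2 := (piAP_scale hu 1 (by norm_num)).comp exp_nat_tendsto
      have h3 := h1.sub h2
      simp only [Nat.totient_one, Nat.cast_one, inv_one, Function.comp_def, Real.log_exp] at h3
      have e0 : (1:ℝ) * s - 1 * 1 = 1 * (s - 1) := by ring
      rw [e0] at h3
      refine h3.congr fun k => ?_
      rw [← mul_sub]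
      congr 1
      have hsub : primesAP (1 : ZMod 1) (1 * Real.exp ((k:ℝ) + 1)) ⊆ primesAP (1 : ZMod 1) (s * Real.exp ((k:ℝ) + 1)) :=
        primesAP_subset _ (mul_le_mul_of_nonneg_right hs.1 (hE k).le)
      unfold piAP
      rw [← Nat.cast_sub (Finset.card_le_card hsub), ← Finset.card_sdiff_of_subset hsub]
      congr 2
      ext n
      rw [Finset.mem_filter, hmem, Finset.mem_sdiff, mem_primesAP, mem_primesAP, div_le_iff₀ (hE k), one_mul]
      have hs2 : (n:ℝ) ≤ s * Real.exp ((k:ℝ) + 1) → (n:ℝ) ≤ Real.exp 1 * Real.exp ((k:ℝ) + 1) := fun h =>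
        h.trans (mul_le_mul_of_nonneg_right hs.2 (hE k).le)
      have htriv : (n : ZMod 1) = 1 := Subsingleton.elim _ _
      constructor
      · rintro ⟨⟨h1, -, h2⟩, h3⟩
        refine ⟨⟨h1, ?_, hs2 h2⟩, h2⟩
        by_contra hc
        exact h3 ⟨h1, htriv, not_lt.mp hc⟩
      · rintro ⟨⟨h1, h2, h3⟩, h4⟩
        exact ⟨⟨h1, htriv, h4⟩, fun h => absurd h.2.2 (not_le.mpr h2)⟩)
    (fun s => s⁻¹) (by
      refine ContinuousOn.inv₀ continuousOn_id fun s hs => ?_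
      have := hs.1
      exact (by linarith : (0:ℝ) < s).ne')
    (fun k n => Real.exp ((k:ℝ) + 1) / n) (by
      intro ε hε
      refine Eventually.of_forall fun k n hn => ?_
      simp only [inv_div, sub_self, abs_zero]; exact hε.le)
  have hintg : (1:ℝ) * ∫ t in (1:ℝ)..(Real.exp 1), t⁻¹ = 1 := by
    rw [integral_inv_of_pos one_pos (Real.exp_pos 1)]; simp
  rw [hintg] at key
  refine key.congr fun k => ?_
  rw [div_mul_eq_mul_div, mul_div_assoc]
  congr 1
  rw [Finset.sum_div]
  refine Finset.sum_congr rfl fun n _ => ?_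
  have := (hE k).ne'
  field_simp

lemma SS_exp_sum (n : ℕ) : SS (Real.exp ((n:ℝ) + 1)) = ∑ k ∈ Finset.range n,
    ∑ n ∈ PP (Real.exp ((k:ℝ) + 2)) \ PP (Real.exp ((k:ℝ) + 1)), 1 / (n:ℝ) := by
  induction n with
  | zero =>
    simp only [Finset.range_zero, Finset.sum_empty]
    unfold SS
    have : PP (Real.exp (((0:ℕ):ℝ) + 1)) = ∅ := by
      rw [Finset.eq_empty_iff_forall_notMem]
      intro n hn
      rw [mem_PP] at hn
      have h1 : (3:ℝ) ≤ n := by exact_mod_cast hn.2.1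
      have h2 := hn.2.2
      simp only [Nat.cast_zero, zero_add] at h2
      have := Real.exp_one_lt_d9
      linarith
    rw [this, Finset.sum_empty]
  | succ n ih =>
    rw [Finset.sum_range_succ, ← ih]
    unfold SS
    rw [add_comm (∑ n ∈ _, _), Finset.sum_sdiff (PP_mono (Real.exp_le_exp.mpr (by linarith)))]
    push_cast
    rw [show (n:ℝ) + 1 + 1 = n + 2 by ring]

lemma SS_exp_tendsto : Tendsto (fun n : ℕ => SS (Real.exp n) / Real.log n) atTop (nhds 1) := by
  rw [← tendsto_add_atTop_iff_nat 1]
  set B : ℕ → ℝ := fun k => ∑ n ∈ PP (Real.exp ((k:ℝ) + 2)) \ PP (Real.exp ((k:ℝ) + 1)), 1 / (n:ℝ) with hB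
  have hb := block_recip
  have h0 : (fun k : ℕ => B k - 1 / ((k:ℝ) + 1)) =o[atTop] (fun k : ℕ => 1 / ((k:ℝ) + 1)) := by
    rw [Asymptotics.isLittleO_iff_tendsto' (Eventually.of_forall fun k h => by
      exfalso; have : (0:ℝ) < 1 / ((k:ℝ) + 1) := by positivity
      exact this.ne' h)]
    have := hb.sub_const 1
    rw [sub_self] at this
    refine this.congr fun k => ?_
    have : (k:ℝ) + 1 ≠ 0 := by positivity
    rw [hB]
    field_simp
  have hH : ∀ n : ℕ, ∑ k ∈ Finset.range n, 1 / ((k:ℝ) + 1) = (harmonic n : ℝ) := by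
    intro n; unfold harmonic; push_cast
    exact Finset.sum_congr rfl fun k _ => by rw [one_div]
  have hlogt : Tendsto (fun n : ℕ => Real.log n) atTop atTop :=
    Real.tendsto_log_atTop.comp tendsto_natCast_atTop_atTop
  have hdiff := Real.tendsto_harmonic_sub_log
  have hHt : Tendsto (fun n : ℕ => (harmonic n : ℝ)) atTop atTop := by
    have := hdiff.add_atTop hlogt
    refine this.congr fun n => by ring
  have h1 := h0.sum_range (fun k => by positivity) (by
    refine hHt.congr fun n => (hH n).symm)
  have h2 : Tendsto (fun n : ℕ => SS (Real.exp ((n:ℝ) + 1)) / (harmonic n : ℝ)) atTop (nhds 1) := by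
    have h3 := h1.tendsto_div_nhds_zero.add_const 1
    rw [zero_add] at h3
    refine h3.congr' ?_
    filter_upwards [hHt.eventually_gt_atTop 0] with n hn
    rw [hH, Finset.sum_sub_distrib, hH, ← SS_exp_sum]
    field_simp
    ring
  have h3 : Tendsto (fun n : ℕ => (harmonic n : ℝ) / Real.log n) atTop (nhds 1) := by
    have h4 := (hdiff.div_atTop hlogt).add_const 1
    rw [zero_add] at h4
    refine h4.congr' ?_
    filter_upwards [hlogt.eventually_gt_atTop 0] with n hn
    field_simp
    ring
  have h4 : Tendsto (fun n : ℕ => Real.log n / Real.log (n + 1)) atTop (nhds 1) :=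
    log_div_log_tendsto one_pos (tendsto_natCast_div_add_atTop (1:ℝ))
      (tendsto_atTop_add_const_right _ _ tendsto_natCast_atTop_atTop)
  have h5 := (h2.mul h3).mul h4
  simp only [one_mul] at h5
  refine h5.congr' ?_
  filter_upwards [hHt.eventually_gt_atTop 0, hlogt.eventually_gt_atTop 0] with n h6 h7
  push_cast
  field_simp

lemma SS_tendsto : Tendsto (fun y : ℝ => SS y / Real.log (Real.log y)) atTop (nhds 1) := by
  suffices h : Tendsto (fun u : ℝ => SS (Real.exp u) / Real.log u) atTop (nhds 1) by
    refine (h.comp Real.tendsto_log_atTop).congr' ?_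
    filter_upwards [eventually_gt_atTop 0] with y hy
    simp only [Function.comp, Real.exp_log hy]
  have hfl : Tendsto (fun u : ℝ => ⌊u⌋₊) atTop atTop := tendsto_nat_floor_atTop
  have hr : Tendsto (fun u : ℝ => (⌊u⌋₊ : ℝ) / u) atTop (nhds 1) := tendsto_nat_floor_div_atTop
  have hr2 : Tendsto (fun u : ℝ => ((⌊u⌋₊ + 1 : ℕ) : ℝ) / u) atTop (nhds 1) := by
    have := hr.add (tendsto_inv_atTop_zero (𝕜 := ℝ))
    rw [add_zero] at this
    refine this.congr fun u => ?_
    push_cast; rw [add_div, one_div]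
  have a1 := (SS_exp_tendsto.comp hfl).mul (log_div_log_tendsto one_pos hr tendsto_id)
  have a2 := (SS_exp_tendsto.comp ((tendsto_add_atTop_nat 1).comp hfl)).mul
    (log_div_log_tendsto one_pos hr2 tendsto_id)
  rw [one_mul] at a1 a2
  refine tendsto_of_tendsto_of_tendsto_of_le_of_le' a1 a2 ?_ ?_
  · filter_upwards [eventually_ge_atTop 2] with u hu
    have h1 : 2 ≤ ⌊u⌋₊ := Nat.le_floor (by exact_mod_cast hu)
    have h2 : 0 < Real.log (⌊u⌋₊ : ℝ) := Real.log_pos (by exact_mod_cast (show 1 < ⌊u⌋₊ by omega))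
    have h3 : 0 < Real.log u := Real.log_pos (by linarith)
    simp only [Function.comp, id]
    rw [div_mul_div_cancel₀ h2.ne']
    exact div_le_div_of_nonneg_right (SS_mono (Real.exp_le_exp.mpr (Nat.floor_le (by linarith)))) h3.le
  · filter_upwards [eventually_ge_atTop 2] with u hu
    have h1 : 2 ≤ ⌊u⌋₊ := Nat.le_floor (by exact_mod_cast hu)
    have h2 : 0 < Real.log ((⌊u⌋₊ + 1 : ℕ) : ℝ) := Real.log_pos (by exact_mod_cast (show 1 < ⌊u⌋₊ + 1 by omega))
    have h3 : 0 < Real.log u := Real.log_pos (by linarith)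
    simp only [Function.comp, id]
    rw [div_mul_div_cancel₀ h2.ne']
    exact div_le_div_of_nonneg_right (SS_mono (Real.exp_le_exp.mpr (by push_cast; exact (Nat.lt_floor_add_one u).le))) h3.le

lemma loglog_tendsto : Tendsto (fun x : ℝ => Real.log (Real.log x)) atTop atTop :=
  Real.tendsto_log_atTop.comp Real.tendsto_log_atTop

lemma SS_atTop : Tendsto SS atTop atTop := by
  have := SS_tendsto.pos_mul_atTop one_pos loglog_tendsto
  refine this.congr' ?_
  filter_upwards [loglog_tendsto.eventually_gt_atTop 0] with x hx
  field_simp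

lemma SS_rpow (δ : ℝ) (hδ : 0 < δ) : Tendsto (fun x : ℝ => SS (x ^ δ) / SS x) atTop (nhds 1) := by
  have h1 := SS_tendsto.comp (tendsto_rpow_atTop hδ)
  have h2 : Tendsto (fun x : ℝ => Real.log (Real.log (x ^ δ)) / Real.log (Real.log x)) atTop (nhds 1) := by
    refine log_div_log_tendsto hδ ?_ Real.tendsto_log_atTop
    refine (tendsto_const_nhds (x := δ)).congr' ?_
    filter_upwards [eventually_gt_atTop 1] with x hx
    have := Real.log_pos hx
    rw [Real.log_rpow (by linarith)]; field_simp
  have h3 := (h1.mul h2).div SS_tendsto one_ne_zero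
  rw [one_mul, div_one] at h3
  refine h3.congr' ?_
  filter_upwards [loglog_tendsto.eventually_gt_atTop 0, (loglog_tendsto.comp (tendsto_rpow_atTop hδ)).eventually_gt_atTop 0,
    SS_atTop.eventually_gt_atTop 0] with x h4 h5 h6
  simp only [Function.comp, Pi.div_apply] at *
  field_simp


/-- increasing pairs of odd primes -/
noncomputable def DD (y : ℝ) : Finset (ℕ × ℕ) := (PP y ×ˢ PP y).filter fun t => t.1 < t.2

/-- third prime factors -/
noncomputable def RR (t : ℕ × ℕ) (x : ℝ) : Finset ℕ :=
  (tSet (fun _ q _ => q = t.2) t.1 x).image Prod.snd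

lemma mem_DD {y : ℝ} {t : ℕ × ℕ} : t ∈ DD y ↔ t.1 ∈ PP y ∧ t.2 ∈ PP y ∧ t.1 < t.2 := by
  unfold DD; rw [Finset.mem_filter, Finset.mem_product, and_assoc]

lemma mem_RR {t : ℕ × ℕ} (h0 : 0 < t.1) (h1 : t.1 < t.2) (h2 : t.2.Prime) {x : ℝ} {r : ℕ} :
    r ∈ RR t x ↔ r.Prime ∧ t.2 < r ∧ ((t.1 * t.2 * r : ℕ) : ℝ) ≤ x := by
  unfold RR
  rw [Finset.mem_image]
  constructor
  · rintro ⟨s, hs, rfl⟩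
    rw [mem_tSet h0] at hs
    obtain ⟨a1, a2, a3, a4, a5, a6⟩ := hs
    rw [a6] at a4 a5
    exact ⟨a2, a4, a5⟩
  · rintro ⟨a1, a2, a3⟩
    exact ⟨(t.2, r), by rw [mem_tSet h0]; exact ⟨h2, a1, h1, a2, a3, rfl⟩, rfl⟩

lemma NT_sum (x : ℝ) : (NTcount x : ℝ) = ∑ t ∈ DD x, ((RR t x).card : ℝ) := by
  classical
  unfold NTcount
  rw [← Nat.cast_sum, ← Finset.card_sigma, ← Set.ncard_coe_finset, Nat.cast_inj]
  symm
  have hm : ∀ t ∈ DD x, t.1.Prime ∧ t.2.Prime ∧ 3 ≤ t.1 ∧ t.1 < t.2 := by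
    intro t ht
    rw [mem_DD, mem_PP, mem_PP] at ht
    exact ⟨ht.1.1, ht.2.1.1, ht.1.2.1, ht.2.2⟩
  refine Set.ncard_congr (fun s _ => s.1.1 * s.1.2 * s.2) ?_ ?_ ?_
  · rintro ⟨t, r⟩ hs
    rw [Finset.mem_coe, Finset.mem_sigma] at hs
    obtain ⟨h1, h2⟩ := hs
    obtain ⟨h3, h4, h5, h6⟩ := hm t h1
    rw [mem_RR h3.pos h6 h4] at h2
    exact ⟨t.1, t.2, r, h3, h4, h2.1, h5, h6, h2.2.1, rfl, h2.2.2⟩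
  · rintro ⟨t, r⟩ ⟨t', r'⟩ hs hs' he
    rw [Finset.mem_coe, Finset.mem_sigma] at hs hs'
    obtain ⟨h1, h2⟩ := hs
    obtain ⟨h3, h4, h5, h6⟩ := hm t h1
    rw [mem_RR h3.pos h6 h4] at h2
    obtain ⟨h1', h2'⟩ := hs'
    obtain ⟨h3', h4', h5', h6'⟩ := hm t' h1'
    rw [mem_RR h3'.pos h6' h4'] at h2'
    obtain ⟨a, b, c⟩ := tern_unique h3 h4 h2.1 h6 h2.2.1 h3' h4' h2'.1 h6' h2'.2.1 he
    have a' : t = t' := Prod.ext a b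
    subst a'
    subst c
    rfl
  · rintro n ⟨p, q, r, h1, h2, h3, h4, h5, h6, h7, h8⟩
    refine ⟨⟨(p, q), r⟩, ?_, h7.symm⟩
    subst h7
    have hp0 : (1:ℝ) ≤ p := by exact_mod_cast h1.one_lt.le
    have hq0 : (1:ℝ) ≤ q := by exact_mod_cast h2.one_lt.le
    have hr0 : (1:ℝ) ≤ r := by exact_mod_cast h3.one_lt.le
    have hqr : (1:ℝ) ≤ (q:ℝ) * r := one_le_mul_of_one_le_of_one_le hq0 hr0
    have hpr : (1:ℝ) ≤ (p:ℝ) * r := one_le_mul_of_one_le_of_one_le hp0 hr0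
    have h9 := h8
    push_cast at h9
    rw [Finset.mem_coe, Finset.mem_sigma, mem_RR h1.pos h5 h2, mem_DD, mem_PP, mem_PP]
    exact ⟨⟨⟨h1, h4, by nlinarith⟩, ⟨h2, h4.trans h5.le, by nlinarith⟩, h5⟩, h3, h6, h8⟩

lemma pair_sum (y : ℝ) : 2 * ∑ t ∈ DD y, (1 / (t.1:ℝ) * (1 / (t.2:ℝ))) + ∑ n ∈ PP y, (1 / (n:ℝ)) ^ 2 = SS y ^ 2 := by
  set f : ℕ → ℝ := fun n => 1 / (n:ℝ) with hf
  have h1 : SS y ^ 2 = ∑ a ∈ PP y, ∑ b ∈ PP y, f a * f b := by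
    rw [sq]; unfold SS; rw [Finset.sum_mul_sum]
  have h2 : ∑ t ∈ DD y, (f t.1 * f t.2) = ∑ a ∈ PP y, ∑ b ∈ PP y, if a < b then f a * f b else 0 := by
    unfold DD
    rw [Finset.sum_filter, Finset.sum_product]
  have h3 : ∑ t ∈ DD y, (f t.1 * f t.2) = ∑ a ∈ PP y, ∑ b ∈ PP y, if b < a then f a * f b else 0 := by
    rw [h2, Finset.sum_comm]
    refine Finset.sum_congr rfl fun a _ => Finset.sum_congr rfl fun b _ => ?_
    rw [mul_comm]
  have h4 : ∑ n ∈ PP y, (f n) ^ 2 = ∑ a ∈ PP y, ∑ b ∈ PP y, if a = b then f a * f b else 0 := by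
    refine Finset.sum_congr rfl fun a ha => ?_
    rw [Finset.sum_ite_eq, if_pos ha, sq]
  change 2 * ∑ t ∈ DD y, (f t.1 * f t.2) + ∑ n ∈ PP y, (f n) ^ 2 = _
  rw [two_mul]
  nth_rewrite 1 [h2]
  rw [h3, h4, h1, ← Finset.sum_add_distrib, ← Finset.sum_add_distrib]
  refine Finset.sum_congr rfl fun a _ => ?_
  rw [← Finset.sum_add_distrib, ← Finset.sum_add_distrib]
  refine Finset.sum_congr rfl fun b _ => ?_
  rcases lt_trichotomy a b with h | h | h
  · rw [if_pos h, if_neg (by omega), if_neg (by omega)]; ring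
  · rw [if_neg (by omega), if_neg (by omega), if_pos h]; ring
  · rw [if_neg (by omega), if_pos h, if_neg (by omega)]; ring

lemma pair_sum_le (y : ℝ) : ∑ t ∈ DD y, (1 / (t.1:ℝ) * (1 / (t.2:ℝ))) ≤ SS y ^ 2 / 2 := by
  have := pair_sum y
  have h : 0 ≤ ∑ n ∈ PP y, (1 / (n:ℝ)) ^ 2 := Finset.sum_nonneg fun n _ => by positivity
  linarith

lemma pair_sum_ge (y : ℝ) : (SS y ^ 2 - SS y) / 2 ≤ ∑ t ∈ DD y, (1 / (t.1:ℝ) * (1 / (t.2:ℝ))) := by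
  have := pair_sum y
  have h : ∑ n ∈ PP y, (1 / (n:ℝ)) ^ 2 ≤ SS y := by
    unfold SS
    refine Finset.sum_le_sum fun n hn => ?_
    rw [mem_PP] at hn
    have h3 : (3:ℝ) ≤ n := by exact_mod_cast hn.2.1
    have h4 : 1 / (n:ℝ) ≤ 1 := by rw [div_le_one (by linarith)]; linarith
    have h5 : 0 ≤ 1 / (n:ℝ) := by positivity
    nlinarith
  linarith

lemma pnt_bounds (δ : ℝ) (hδ : 0 < δ) : ∀ᶠ Y : ℝ in atTop, (1 - δ) * Y / log Y ≤ piAP (1 : ZMod 1) Y ∧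
    piAP (1 : ZMod 1) Y ≤ (1 + δ) * Y / log Y := by
  have h := piAP_tendsto (q := 1) (a := 1) isUnit_one
  simp only [Nat.totient_one, Nat.cast_one, inv_one] at h
  filter_upwards [h.eventually (lt_mem_nhds (show 1 - δ < 1 by linarith)),
    h.eventually (gt_mem_nhds (show 1 < 1 + δ by linarith)), eventually_gt_atTop 1] with Y h1 h2 h3
  have h4 := Real.log_pos h3
  rw [lt_div_iff₀ (by linarith)] at h1
  rw [div_lt_iff₀ (by linarith)] at h2
  rw [div_le_iff₀ h4, le_div_iff₀ h4]
  exact ⟨h1.le, h2.le⟩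

lemma RR_bound {t : ℕ × ℕ} (h0 : 0 < t.1) (h1 : t.1 < t.2) (h2 : t.2.Prime) {x : ℝ} :
    ∀ r ∈ RR t x, r.Prime ∧ (r:ℝ) ≤ x / (t.1 * t.2) := by
  intro r hr
  rw [mem_RR h0 h1 h2] at hr
  have hp0 : (0:ℝ) < t.1 := by exact_mod_cast h0
  have hq0 : (0:ℝ) < t.2 := by exact_mod_cast h2.pos
  refine ⟨hr.1, ?_⟩
  rw [le_div_iff₀ (by positivity)]
  have := hr.2.2
  push_cast at this
  linarith

lemma NT_upper (δ : ℝ) (hδ : 0 < δ) (hδ1 : δ < 1 / 4) : ∀ᶠ x : ℝ in atTop,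
    (NTcount x : ℝ) ≤ x / log x * ((1 + δ) / (1 - 2 * δ) * (SS x ^ 2 / 2) + 5 / δ * (SS x * (SS x - SS (x ^ δ)))) := by
  have ht : Tendsto (fun x : ℝ => x ^ (1 - 2 * δ)) atTop atTop := tendsto_rpow_atTop (by linarith)
  obtain ⟨Y0, hY0⟩ := eventually_atTop.mp (pnt_bounds δ hδ)
  filter_upwards [ht.eventually_ge_atTop Y0, eventually_gt_atTop 1] with x hx1 hx
  have hx0 : 0 < x := by linarith
  have hL : 0 < log x := Real.log_pos hx
  set z := x ^ δ with hz
  have hz1 : 1 < z := Real.one_lt_rpow hx hδ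
  have hzx : z ≤ x := by
    rw [hz]; nth_rewrite 2 [← Real.rpow_one x]
    exact Real.rpow_le_rpow_of_exponent_le hx.le (by linarith)
  have hm : ∀ t ∈ DD x, t.1.Prime ∧ t.2.Prime ∧ 3 ≤ t.1 ∧ t.1 < t.2 := by
    intro t ht
    rw [mem_DD, mem_PP, mem_PP] at ht
    exact ⟨ht.1.1, ht.2.1.1, ht.1.2.1, ht.2.2⟩
  have hA : ∀ t ∈ DD x, (t.2:ℝ) ≤ z → ((RR t x).card : ℝ) ≤ 
      x / log x * ((1 + δ) / (1 - 2 * δ)) * (1 / (t.1:ℝ) * (1 / (t.2:ℝ))) := by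
    intro t ht hq
    obtain ⟨h1, h2, h3, h4⟩ := hm t ht
    have hp0 : (0:ℝ) < t.1 := by exact_mod_cast h1.pos
    have hq0 : (0:ℝ) < t.2 := by exact_mod_cast h2.pos
    have hpq : (t.1:ℝ) ≤ t.2 := by exact_mod_cast h4.le
    set Y := x / (t.1 * t.2 : ℝ) with hY
    have hY1 : x ^ (1 - 2 * δ) ≤ Y := by
      rw [hY, le_div_iff₀ (by positivity)]
      have : (t.1:ℝ) * t.2 ≤ x ^ (2 * δ) := by
        rw [two_mul, Real.rpow_add hx0]
        exact mul_le_mul (hpq.trans hq) hq hq0.le (by positivity)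
      calc x ^ (1 - 2 * δ) * (t.1 * t.2) ≤ x ^ (1 - 2 * δ) * x ^ (2 * δ) :=
            mul_le_mul_of_nonneg_left this (by positivity)
        _ = x := by rw [← Real.rpow_add hx0]; simp
    have hlog : (1 - 2 * δ) * log x ≤ log Y := by
      rw [← Real.log_rpow hx0]
      exact Real.log_le_log (by positivity) hY1
    have hc : 0 < (1 - 2 * δ) * log x := mul_pos (by linarith) hL
    have hYpos : 0 < Y := by positivity
    have hcard : ((RR t x).card : ℝ) ≤ piAP (1 : ZMod 1) Y := by
      unfold piAP
      refine Nat.cast_le.mpr (Finset.card_le_card fun r hr => ?_)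
      have := RR_bound h1.pos h4 h2 r hr
      rw [mem_primesAP]
      exact ⟨this.1, Subsingleton.elim _ _, this.2⟩
    calc ((RR t x).card : ℝ) ≤ (1 + δ) * Y / log Y := hcard.trans (hY0 Y (hx1.trans hY1)).2
      _ ≤ (1 + δ) * Y / ((1 - 2 * δ) * log x) := div_le_div_of_nonneg_left (by positivity) hc hlog
      _ = _ := by
        have : 1 - 2 * δ ≠ 0 := by linarith
        rw [hY]; field_simp
  have hB : ∀ t ∈ DD x, ¬ (t.2:ℝ) ≤ z → ((RR t x).card : ℝ) ≤ 
      x / log x * (5 / δ) * (1 / (t.1:ℝ) * (1 / (t.2:ℝ))) := by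
    intro t ht hq
    obtain ⟨h1, h2, h3, h4⟩ := hm t ht
    have hp0 : (0:ℝ) < t.1 := by exact_mod_cast h1.pos
    have hq0 : (0:ℝ) < t.2 := by exact_mod_cast h2.pos
    rcases (RR t x).eq_empty_or_nonempty with he | ⟨r, hr⟩
    · rw [he, Finset.card_empty, Nat.cast_zero]; positivity
    · have hb := RR_bound h1.pos h4 h2 (x := x)
      have hr1 := (hb r hr).2
      rw [mem_RR h1.pos h4 h2] at hr
      have hqr : (t.2:ℝ) < r := by exact_mod_cast hr.2.1
      set Y := x / (t.1 * t.2 : ℝ) with hY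
      have hzY : z ≤ Y := by linarith [not_le.mp hq]
      have hlog : δ * log x ≤ log Y := by
        rw [← Real.log_rpow hx0]
        exact Real.log_le_log (by positivity) hzY
      have hc : 0 < δ * log x := mul_pos hδ hL
      calc ((RR t x).card : ℝ) ≤ 5 * Y / log Y := card_primes_le Y (by linarith) _ hb
        _ ≤ 5 * Y / (δ * log x) := div_le_div_of_nonneg_left (by positivity) hc hlog
        _ = _ := by rw [hY]; field_simp
  rw [NT_sum, ← Finset.sum_filter_add_sum_filter_not (DD x) (fun t => (t.2:ℝ) ≤ z), mul_add]
  refine add_le_add ?_ ?_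
  · calc ∑ t ∈ DD x with (t.2:ℝ) ≤ z, ((RR t x).card : ℝ) 
        ≤ ∑ t ∈ DD x with (t.2:ℝ) ≤ z, x / log x * ((1 + δ) / (1 - 2 * δ)) * (1 / (t.1:ℝ) * (1 / (t.2:ℝ))) :=
          Finset.sum_le_sum fun t ht => by
            rw [Finset.mem_filter] at ht; exact hA t ht.1 ht.2
      _ = x / log x * ((1 + δ) / (1 - 2 * δ)) * ∑ t ∈ DD x with (t.2:ℝ) ≤ z, (1 / (t.1:ℝ) * (1 / (t.2:ℝ))) := by
          rw [Finset.mul_sum]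
      _ ≤ x / log x * ((1 + δ) / (1 - 2 * δ)) * (SS x ^ 2 / 2) := by
          have hc : 0 < 1 - 2 * δ := by linarith
          refine mul_le_mul_of_nonneg_left (le_trans ?_ (pair_sum_le x)) (by positivity)
          exact Finset.sum_le_sum_of_subset_of_nonneg (Finset.filter_subset _ _) fun t _ _ => by positivity
      _ = _ := by ring
  · calc ∑ t ∈ DD x with ¬ (t.2:ℝ) ≤ z, ((RR t x).card : ℝ) 
        ≤ ∑ t ∈ DD x with ¬ (t.2:ℝ) ≤ z, x / log x * (5 / δ) * (1 / (t.1:ℝ) * (1 / (t.2:ℝ))) :=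
          Finset.sum_le_sum fun t ht => by
            rw [Finset.mem_filter] at ht; exact hB t ht.1 ht.2
      _ = x / log x * (5 / δ) * ∑ t ∈ DD x with ¬ (t.2:ℝ) ≤ z, (1 / (t.1:ℝ) * (1 / (t.2:ℝ))) := by
          rw [Finset.mul_sum]
      _ ≤ x / log x * (5 / δ) * (SS x * (SS x - SS z)) := by
          refine mul_le_mul_of_nonneg_left ?_ (by positivity)
          have e : SS x - SS z = ∑ n ∈ PP x \ PP z, 1 / (n:ℝ) := by
            unfold SS
            rw [← Finset.sum_sdiff (PP_mono hzx)]; ring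
          rw [e]
          unfold SS
          rw [Finset.sum_mul_sum, ← Finset.sum_product']
          refine Finset.sum_le_sum_of_subset_of_nonneg ?_ fun t _ _ => by positivity
          intro t ht
          rw [Finset.mem_filter, mem_DD] at ht
          rw [Finset.mem_product, Finset.mem_sdiff]
          exact ⟨ht.1.1, ht.1.2.1, fun h => ht.2 (mem_PP.mp h).2.2⟩
      _ = _ := by ring

lemma NT_lower (δ : ℝ) (hδ : 0 < δ) (hδ1 : δ < 1 / 4) : ∀ᶠ x : ℝ in atTop,
    x / log x * ((1 - δ) * ((SS (x ^ δ) ^ 2 - SS (x ^ δ)) / 2)) - x ^ (3 * δ) ≤ (NTcount x : ℝ) := by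
  have ht : Tendsto (fun x : ℝ => x ^ (1 - 2 * δ)) atTop atTop := tendsto_rpow_atTop (by linarith)
  obtain ⟨Y0, hY0⟩ := eventually_atTop.mp (pnt_bounds δ hδ)
  filter_upwards [ht.eventually_ge_atTop Y0, eventually_gt_atTop 1] with x hx1 hx
  have hx0 : 0 < x := by linarith
  have hL : 0 < log x := Real.log_pos hx
  set z := x ^ δ with hz
  have hz1 : 1 < z := Real.one_lt_rpow hx hδ
  have hzx : z ≤ x := by
    rw [hz]; nth_rewrite 2 [← Real.rpow_one x]
    exact Real.rpow_le_rpow_of_exponent_le hx.le (by linarith)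
  have hz3 : x ^ (3 * δ) = z ^ 3 := by
    rw [hz, ← Real.rpow_natCast, ← Real.rpow_mul hx0.le]; congr 1; push_cast; ring
  have hA : ∀ t ∈ DD z, x / log x * (1 - δ) * (1 / (t.1:ℝ) * (1 / (t.2:ℝ))) - z ≤ ((RR t x).card : ℝ) := by
    intro t ht
    rw [mem_DD, mem_PP, mem_PP] at ht
    obtain ⟨⟨h1, h3, -⟩, ⟨h2, -, hq⟩, h4⟩ := ht
    have hp0 : (0:ℝ) < t.1 := by exact_mod_cast h1.pos
    have hq0 : (0:ℝ) < t.2 := by exact_mod_cast h2.pos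
    have hp1 : (1:ℝ) ≤ t.1 := by exact_mod_cast h1.one_lt.le
    have hq1 : (1:ℝ) ≤ t.2 := by exact_mod_cast h2.one_lt.le
    have hpq : (t.1:ℝ) ≤ t.2 := by exact_mod_cast h4.le
    set Y := x / (t.1 * t.2 : ℝ) with hY
    have hY1 : x ^ (1 - 2 * δ) ≤ Y := by
      rw [hY, le_div_iff₀ (by positivity)]
      have : (t.1:ℝ) * t.2 ≤ x ^ (2 * δ) := by
        rw [two_mul, Real.rpow_add hx0]
        exact mul_le_mul (hpq.trans hq) hq hq0.le (by positivity)
      calc x ^ (1 - 2 * δ) * (t.1 * t.2) ≤ x ^ (1 - 2 * δ) * x ^ (2 * δ) :=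
            mul_le_mul_of_nonneg_left this (by positivity)
        _ = x := by rw [← Real.rpow_add hx0]; simp
    have hY2 : 1 < Y := (Real.one_lt_rpow hx (by linarith)).trans_le hY1
    have hYx : Y ≤ x := div_le_self hx0.le (one_le_mul_of_one_le_of_one_le hp1 hq1)
    have hlog : log Y ≤ log x := Real.log_le_log (by linarith) hYx
    have hcard : piAP (1 : ZMod 1) Y ≤ ((RR t x).card : ℝ) + t.2 := by
      unfold piAP
      have hsub : primesAP (1 : ZMod 1) Y ⊆ RR t x ∪ Finset.Ioc 0 t.2 := by
        intro r hr
        rw [mem_primesAP, hY, le_div_iff₀ (by positivity)] at hr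
        rw [Finset.mem_union, mem_RR h1.pos h4 h2, Finset.mem_Ioc]
        by_cases h : t.2 < r
        · left
          refine ⟨hr.1, h, ?_⟩
          push_cast; linarith [hr.2.2]
        · right
          exact ⟨hr.1.pos, by omega⟩
      have := (Finset.card_le_card hsub).trans (Finset.card_union_le _ _)
      rw [Nat.card_Ioc, Nat.sub_zero] at this
      exact_mod_cast this
    have h5 := (hY0 Y (hx1.trans hY1)).1
    have h6 : (1 - δ) * Y / log x ≤ (1 - δ) * Y / log Y := 
      div_le_div_of_nonneg_left (mul_nonneg (by linarith) (by linarith)) (Real.log_pos hY2) hlog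
    have h7 : x / log x * (1 - δ) * (1 / (t.1:ℝ) * (1 / (t.2:ℝ))) = (1 - δ) * Y / log x := by
      rw [hY]; field_simp
    rw [h7]; linarith
  have hsub : DD z ⊆ DD x := by
    intro t ht
    rw [mem_DD] at *
    exact ⟨PP_mono hzx ht.1, PP_mono hzx ht.2.1, ht.2.2⟩
  have hDcard : ((DD z).card : ℝ) ≤ z ^ 2 := by
    have h1 : (DD z).card ≤ (PP z).card * (PP z).card := by
      unfold DD; refine (Finset.card_filter_le _ _).trans ?_
      rw [Finset.card_product]
    have h2 : (PP z).card ≤ ⌊z⌋₊ := by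
      have : PP z ⊆ Finset.Ioc 0 ⌊z⌋₊ := by
        intro n hn
        rw [mem_PP] at hn
        rw [Finset.mem_Ioc]
        exact ⟨hn.1.pos, Nat.le_floor hn.2.2⟩
      simpa using Finset.card_le_card this
    have h3 : ((PP z).card : ℝ) ≤ z := (Nat.cast_le.mpr h2).trans (Nat.floor_le (by linarith))
    have h4 : ((DD z).card : ℝ) ≤ (PP z).card * (PP z).card := by exact_mod_cast h1
    have h5 : (0:ℝ) ≤ (PP z).card := by positivity
    nlinarith
  calc x / log x * ((1 - δ) * ((SS z ^ 2 - SS z) / 2)) - x ^ (3 * δ) 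
      ≤ x / log x * ((1 - δ) * ∑ t ∈ DD z, (1 / (t.1:ℝ) * (1 / (t.2:ℝ)))) - (DD z).card * z := by
        refine sub_le_sub ?_ ?_
        · refine mul_le_mul_of_nonneg_left ?_ (by positivity)
          exact mul_le_mul_of_nonneg_left (pair_sum_ge z) (by linarith)
        · rw [hz3, pow_succ]
          exact mul_le_mul_of_nonneg_right hDcard (by linarith)
    _ = ∑ t ∈ DD z, (x / log x * (1 - δ) * (1 / (t.1:ℝ) * (1 / (t.2:ℝ))) - z) := by
        rw [Finset.sum_sub_distrib, Finset.sum_const, nsmul_eq_mul, ← Finset.mul_sum]; ring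
    _ ≤ ∑ t ∈ DD z, ((RR t x).card : ℝ) := Finset.sum_le_sum hA
    _ ≤ _ := by
        rw [NT_sum]
        exact Finset.sum_le_sum_of_subset_of_nonneg hsub fun t _ _ => by positivity

lemma NT_SS_tendsto : Tendsto (fun x : ℝ => NTcount x * log x / (x * SS x ^ 2)) atTop (nhds (1 / 2)) := by
  rw [tendsto_order]
  have hcont0 : Tendsto (fun δ : ℝ => δ) (nhdsWithin 0 (Set.Ioi 0)) (nhds 0) := nhdsWithin_le_nhds
  have hsmall : ∀ᶠ δ : ℝ in nhdsWithin 0 (Set.Ioi 0), 0 < δ ∧ δ < 1 / 4 := by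
    have h1 : ∀ᶠ δ : ℝ in nhdsWithin 0 (Set.Ioi 0), 0 < δ := self_mem_nhdsWithin
    have h2 := hcont0.eventually (gt_mem_nhds (show (0:ℝ) < 1 / 4 by norm_num))
    exact h1.and h2
  constructor
  · intro c hc
    have hl : Tendsto (fun δ : ℝ => (1 - δ) * (1 / 2)) (nhdsWithin 0 (Set.Ioi 0)) (nhds (1 / 2)) := by
      have := (hcont0.const_sub 1).mul_const (1 / 2 : ℝ)
      simpa using this
    obtain ⟨δ, ⟨hδ, hδ1⟩, hδc⟩ := (hsmall.and (hl.eventually (lt_mem_nhds hc))).exists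
    have hS := SS_rpow δ hδ
    have hinv : Tendsto (fun x => (SS x)⁻¹) atTop (nhds 0) := tendsto_inv_atTop_zero.comp SS_atTop
    have hlog : Tendsto (fun x : ℝ => log x / x ^ (1 - 3 * δ)) atTop (nhds 0) :=
      (isLittleO_log_rpow_atTop (by linarith)).tendsto_div_nhds_zero
    have hlim : Tendsto (fun x : ℝ => (1 - δ) * (((SS (x ^ δ) / SS x) ^ 2 - (SS (x ^ δ) / SS x) * (SS x)⁻¹) / 2) 
        - log x / x ^ (1 - 3 * δ) * (SS x)⁻¹ ^ 2) atTop (nhds ((1 - δ) * ((1 ^ 2 - 1 * 0) / 2) - 0 * 0 ^ 2)) :=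
      ((((hS.pow 2).sub (hS.mul hinv)).div_const 2).const_mul (1 - δ)).sub (hlog.mul (hinv.pow 2))
    have e : (1 - δ) * (((1:ℝ) ^ 2 - 1 * 0) / 2) - 0 * 0 ^ 2 = (1 - δ) * (1 / 2) := by ring
    rw [e] at hlim
    filter_upwards [hlim.eventually (lt_mem_nhds hδc), NT_lower δ hδ hδ1, eventually_gt_atTop 1,
      SS_atTop.eventually_gt_atTop 0] with x h1 h2 hx hS0
    refine h1.trans_le ?_
    have hx0 : 0 < x := by linarith
    have hL : 0 < log x := Real.log_pos hx
    rw [le_div_iff₀ (by positivity)]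
    refine le_trans (le_of_eq ?_) (mul_le_mul_of_nonneg_right h2 hL.le)
    have hxx : x ^ (1 - 3 * δ) = x / x ^ (3 * δ) := by rw [Real.rpow_sub hx0, Real.rpow_one]
    have : 0 < x ^ (3 * δ) := by positivity
    rw [hxx]
    field_simp
  · intro c hc
    have hl : Tendsto (fun δ : ℝ => (1 + δ) / (1 - 2 * δ) * (1 / 2)) (nhdsWithin 0 (Set.Ioi 0)) (nhds (1 / 2)) := by
      have := ((hcont0.const_add 1).div ((hcont0.const_mul 2).const_sub 1) (by norm_num)).mul_const (1 / 2 : ℝ)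
      simpa using this
    obtain ⟨δ, ⟨hδ, hδ1⟩, hδc⟩ := (hsmall.and (hl.eventually (gt_mem_nhds hc))).exists
    have hS := SS_rpow δ hδ
    have hlim : Tendsto (fun x : ℝ => (1 + δ) / (1 - 2 * δ) * (1 / 2) + 5 / δ * (1 - SS (x ^ δ) / SS x)) atTop 
        (nhds ((1 + δ) / (1 - 2 * δ) * (1 / 2) + 5 / δ * (1 - 1))) :=
      ((hS.const_sub 1).const_mul (5 / δ)).const_add _
    rw [sub_self, mul_zero, add_zero] at hlim
    filter_upwards [hlim.eventually (gt_mem_nhds hδc), NT_upper δ hδ hδ1, eventually_gt_atTop 1,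
      SS_atTop.eventually_gt_atTop 0] with x h1 h2 hx hS0
    refine lt_of_le_of_lt ?_ h1
    have hx0 : 0 < x := by linarith
    have hL : 0 < log x := Real.log_pos hx
    rw [div_le_iff₀ (by positivity)]
    refine le_trans (mul_le_mul_of_nonneg_right h2 hL.le) (le_of_eq ?_)
    have : 1 - 2 * δ ≠ 0 := by linarith
    field_simp

lemma NT_tendsto : Tendsto (fun x : ℝ => NTcount x * log x / (x * log (log x) ^ 2)) atTop (nhds (1 / 2)) := by
  have h := NT_SS_tendsto.mul (SS_tendsto.pow 2)
  rw [one_pow, mul_one] at h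
  refine h.congr' ?_
  filter_upwards [loglog_tendsto.eventually_gt_atTop 0, SS_atTop.eventually_gt_atTop 0, eventually_gt_atTop 0] with x h1 h2 h3
  field_simp

theorem NCO_div_NT_asymptotic :
    Tendsto (fun x : ℝ =>
      ((NCOcount x : ℝ) / (NTcount x : ℝ)) /
        (2 * C1 / (Real.log x * (Real.log (Real.log x)) ^ 2)))
      atTop (nhds 1) := by
  have h := (NCO_tendsto.div NT_tendsto (by norm_num)).mul_const (1 / (2 * C1))
  have hC := C1_pos
  have e : C1 / (1 / 2) * (1 / (2 * C1)) = 1 := by field_simp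
  rw [e] at h
  refine h.congr' ?_
  filter_upwards [loglog_tendsto.eventually_gt_atTop 0, eventually_gt_atTop 1,
    NT_tendsto.eventually (lt_mem_nhds (show (0:ℝ) < 1 / 2 by norm_num))] with x h1 h2 h3
  have hL : 0 < log x := Real.log_pos h2
  have hN : (NTcount x : ℝ) ≠ 0 := by
    intro h0; rw [h0, zero_mul, zero_div] at h3; exact lt_irrefl _ h3
  have hx0 : 0 < x := by linarith
  simp only [Pi.div_apply]
  field_simp
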